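/- Let n ≥ 2 and k ≥ 2 be integers and let A ∈ ℝ^{n×(n+k)} have columns a_1,…,a_{n+k} ∈ ℝⁿ that do not all lie in a single affine hyperplane and that form a combinatorially simplicial point configuration. Then there is an open dense subset U ⊆ ℝ^{n+k} such that for every c ∈ U, the zero set Z_ℝ(g_c) has at most (n+k)(n+k−1)/2 + ⌊S(n+2, k−2)/2⌋ connected components. -/

import Mathlib

/-- The exponential sum `g_c(y) = ∑_j c_j · exp(a_j · y)`. -/
noncomputable def expSum {n N : ℕ} (a : Fin N → Fin n → ℝ) (c : Fin N → ℝ)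
    (y : Fin n → ℝ) : ℝ :=
  ∑ j, c j * Real.exp (∑ i, a j i * y i)

/-- The columns `a_1, …, a_N` do not all lie in a single affine hyperplane of ℝⁿ. -/
def NotAllInAffineHyperplane {n N : ℕ} (a : Fin N → Fin n → ℝ) : Prop :=
  ¬ ∃ (w : Fin n → ℝ) (b : ℝ), w ≠ 0 ∧ ∀ j, (∑ i, w i * a j i) = b

/-- The dimension of the affine span of a set of points in ℝⁿ. -/
noncomputable def affDim {n : ℕ} (s : Set (Fin n → ℝ)) : ℕ :=
  Module.finrank ℝ (affineSpan ℝ s).direction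

/-- The indices of the columns lying on the face of `Conv{a_1,…,a_N}` with outer
normal `w`, i.e. those `j` maximizing `a_j · w`. -/
noncomputable def faceIdx {n N : ℕ} (a : Fin N → Fin n → ℝ) (w : Fin n → ℝ) : Finset (Fin N) :=
  Finset.univ.filter fun j => ∀ i, (∑ l, a i l * w l) ≤ (∑ l, a j l * w l)

/-- The set of columns lying on the face of `Conv{a_1,…,a_N}` with outer normal `w`. -/
def facePts {n N : ℕ} (a : Fin N → Fin n → ℝ) (w : Fin n → ℝ) : Set (Fin n → ℝ) :=
  a '' ↑(faceIdx a w)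

/-- The configuration `{a_1,…,a_N}` is combinatorially simplicial: every proper face `Q`
of `Conv{a_1,…,a_N}` contains exactly `1 + dim Q` of the points `a_j` (counting indices). -/
def CombSimplicial {n N : ℕ} (a : Fin N → Fin n → ℝ) : Prop :=
  ∀ w : Fin n → ℝ, affDim (facePts a w) < affDim (Set.range a) →
    (faceIdx a w).card = 1 + affDim (facePts a w)

/-- The fewnomial-type bound `S(m,j)`: `S(m,0) = 1`, `S(m,1) = m+1`, and
`S(m,j) = ((e²+3)/4)·2^{j(j−1)/2}·mʲ` for `j ≥ 2`. -/
noncomputable def S (m j : ℕ) : ℝ :=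
  if j = 0 then 1
  else if j = 1 then (m : ℝ) + 1
  else ((Real.exp 1) ^ 2 + 3) / 4 * (2 : ℝ) ^ (j * (j - 1) / 2) * (m : ℝ) ^ j

section PartP0
open scoped ContDiff Topology
open MeasureTheory

noncomputable def jac {l : ℕ} (G : Fin l → (Fin l → ℝ) → ℝ) (x : Fin l → ℝ) :
    Matrix (Fin l) (Fin l) ℝ :=
  Matrix.of fun i m => fderiv ℝ (G i) x (Pi.single m 1)

def CB {l : ℕ} (Δ : Set (Fin l → ℝ)) (G : Fin l → (Fin l → ℝ) → ℝ) (B : ℝ) : Prop :=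
  ∀ᵐ v : Fin l → ℝ, ∀ T : Finset (Fin l → ℝ), (∀ x ∈ T, x ∈ Δ ∧ ∀ i, G i x = v i) →
    (T.card : ℝ) ≤ B

theorem fderiv_toLin_jac {l : ℕ} (G : Fin l → (Fin l → ℝ) → ℝ) (x : Fin l → ℝ)
    (h : ∀ i, DifferentiableAt ℝ (G i) x) :
    (fderiv ℝ (fun x i => G i x) x) = LinearMap.toContinuousLinearMap (Matrix.toLin' (jac G x)) := by
  rw [fderiv_pi h]
  ext v i
  simp [Matrix.toLin'_apply, Matrix.mulVec, dotProduct, jac]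
  conv_lhs => rw [← Finset.univ_sum_single v]
  rw [map_sum]
  refine Finset.sum_congr rfl fun m _ => ?_
  have : (Pi.single m (v m) : Fin l → ℝ) = v m • Pi.single m 1 := by
    rw [← Pi.single_smul]; simp
  rw [this, map_smul, smul_eq_mul, mul_comm]

theorem fderiv_det_jac {l : ℕ} (G : Fin l → (Fin l → ℝ) → ℝ) (x : Fin l → ℝ)
    (h : ∀ i, DifferentiableAt ℝ (G i) x) :
    (fderiv ℝ (fun x i => G i x) x).det = (jac G x).det := by
  rw [fderiv_toLin_jac G x h]
  simp [ContinuousLinearMap.det]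

theorem sard {l : ℕ} (Δ : Set (Fin l → ℝ)) (hΔ : IsOpen Δ) (G : Fin l → (Fin l → ℝ) → ℝ)
    (hG : ∀ i, ContDiffOn ℝ ∞ (G i) Δ) :
    ∀ᵐ v : Fin l → ℝ, ∀ x ∈ Δ, (∀ i, G i x = v i) → (jac G x).det ≠ 0 := by
  have hd : ∀ x ∈ Δ, ∀ i, DifferentiableAt ℝ (G i) x := fun x hx i =>
    ((hG i).contDiffAt (hΔ.mem_nhds hx)).differentiableAt (by simp)
  have := addHaar_image_eq_zero_of_det_fderivWithin_eq_zero volume (f := fun x i => G i x)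
    (s := {x | x ∈ Δ ∧ (jac G x).det = 0}) (f' := fun x => fderiv ℝ (fun x i => G i x) x)
    (fun x hx => by
      exact (differentiableAt_pi.2 (hd x hx.1)).hasFDerivAt.hasFDerivWithinAt)
    (fun x hx => by rw [fderiv_det_jac _ _ (hd x hx.1)]; exact hx.2)
  rw [ae_iff]
  refine measure_mono_null ?_ this
  intro v hv
  simp only [Set.mem_ofPred_eq] at hv
  push Not at hv
  obtain ⟨x, hx, h1, h2⟩ := hv
  exact ⟨x, ⟨hx, h2⟩, funext h1⟩

/-- local inverse at regular points -/
theorem loc_inv {l : ℕ} (Δ : Set (Fin l → ℝ)) (hΔ : IsOpen Δ) (G : Fin l → (Fin l → ℝ) → ℝ)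
    (hG : ∀ i, ContDiffOn ℝ ∞ (G i) Δ) (x : Fin l → ℝ) (hx : x ∈ Δ) (hJ : (jac G x).det ≠ 0) :
    ∃ e : OpenPartialHomeomorph (Fin l → ℝ) (Fin l → ℝ), x ∈ e.source ∧
      (e : (Fin l → ℝ) → (Fin l → ℝ)) = fun x i => G i x := by
  have hd : ∀ i, DifferentiableAt ℝ (G i) x := fun i =>
    ((hG i).contDiffAt (hΔ.mem_nhds hx)).differentiableAt (by simp)
  have hc : ContDiffAt ℝ ∞ (fun x i => G i x) x :=
    contDiffAt_pi.2 fun i => (hG i).contDiffAt (hΔ.mem_nhds hx)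
  have hdet : (fderiv ℝ (fun x i => G i x) x).det ≠ 0 := by rwa [fderiv_det_jac _ _ hd]
  have hf : HasFDerivAt (fun x i => G i x)
    ((fderiv ℝ (fun x i => G i x) x).toContinuousLinearEquivOfDetNeZero hdet : (Fin l → ℝ) →L[ℝ] (Fin l → ℝ)) x := by
    simpa using (differentiableAt_pi.2 hd).hasFDerivAt
  exact ⟨hc.toOpenPartialHomeomorph _ hf (by simp), hc.mem_toOpenPartialHomeomorph_source hf (by simp),
    hc.toOpenPartialHomeomorph_coe hf (by simp)⟩

end PartP0

section PartPA
open scoped ContDiff Topology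
open MeasureTheory

/-- number of exponents of total degree at most R -/
def expo (l R : ℕ) : Finset (Fin l → ℕ) :=
  (Fintype.piFinset fun _ => Finset.range (R + 1)).filter fun e => ∑ i, e i ≤ R

theorem mem_expo {l R : ℕ} {e : Fin l → ℕ} : e ∈ expo l R ↔ ∑ i, e i ≤ R := by
  simp only [expo, Finset.mem_filter, Fintype.mem_piFinset, Finset.mem_range, and_iff_right_iff_imp]
  intro h i
  have := Finset.single_le_sum (f := e) (fun i _ => Nat.zero_le _) (Finset.mem_univ i)
  omega

theorem card_expo_le (l R : ℕ) : (expo l R).card ≤ (R + 1) ^ l := by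
  refine (Finset.card_filter_le _ _).trans ?_
  simp

/-- weighted exponents -/
def wexpo {l : ℕ} (d : Fin l → ℕ) (R : ℕ) : Finset (Fin l → ℕ) :=
  (expo l R).filter fun b => ∑ i, d i * b i ≤ R

theorem card_wexpo {l : ℕ} (d : Fin l → ℕ) (hd : ∀ i, 1 ≤ d i) (R : ℕ) :
    (expo l R).card ≤ (wexpo d R).card * ∏ i, d i := by
  have : ((wexpo d R) ×ˢ (Fintype.piFinset fun i => Finset.range (d i))).card
      = (wexpo d R).card * ∏ i, d i := by simp
  rw [← this]
  apply Finset.card_le_card_of_injOn (fun e => (fun i => e i / d i, fun i => e i % d i))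
  · intro e he
    have he := mem_expo.1 he
    simp only [Finset.coe_product, Set.mem_prod, Finset.mem_coe, wexpo, Finset.mem_filter, mem_expo,
      Fintype.mem_piFinset, Finset.mem_range]
    refine ⟨⟨?_, ?_⟩, fun i => Nat.mod_lt _ (hd i)⟩
    · exact (Finset.sum_le_sum fun i _ => Nat.div_le_self _ _).trans he
    · exact (Finset.sum_le_sum fun i _ => Nat.mul_div_le _ _).trans he
  · intro e _ e' _ h
    simp only [Prod.mk.injEq] at h
    funext i
    rw [← Nat.div_add_mod (e i) (d i), ← Nat.div_add_mod (e' i) (d i)]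
    rw [show e i / d i = e' i / d i from congrFun h.1 i, show e i % d i = e' i % d i from congrFun h.2 i]

theorem growth (l D : ℕ) (hD : 1 ≤ D) : ∃ R, D * (expo l (R + D)).card < (D + 1) * (expo l R).card := by
  by_contra! h
  have key : ∀ t : ℕ, ((D + 1 : ℝ) / D) ^ t ≤ (expo l (t * D)).card := by
    intro t
    induction t with
    | zero =>
      simp only [pow_zero, zero_mul, Nat.one_le_cast, Finset.one_le_card]
      exact ⟨0, mem_expo.2 (by simp)⟩
    | succ t ih =>
      have h1 := h (t * D)
      have h2 : ((D : ℝ) + 1) * (expo l (t * D)).card ≤ D * (expo l (t * D + D)).card := by exact_mod_cast h1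
      rw [pow_succ, show (t + 1) * D = t * D + D by ring]
      have hD' : (0:ℝ) < D := by positivity
      rw [← mul_div_assoc, div_le_iff₀ hD']
      nlinarith
  have h1 : 1 < ((D + 1 : ℝ) / D) := by
    have hD' : (0:ℝ) < D := by positivity
    rw [lt_div_iff₀ hD']; linarith
  have key2 : ∀ t : ℕ, 1 ≤ t → ((D + 1 : ℝ) / D) ^ t ≤ (2 * D : ℝ) ^ l * (t : ℝ) ^ l := by
    intro t ht
    refine (key t).trans ?_
    have := card_expo_le l (t * D)
    have h3 : t * D + 1 ≤ 2 * D * t := by nlinarith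
    have h4 : (expo l (t * D)).card ≤ (2 * D * t) ^ l := this.trans (Nat.pow_le_pow_left h3 l)
    rw [← mul_pow]
    exact_mod_cast h4
  have := tendsto_pow_const_div_const_pow_of_one_lt l h1
  have h5 := (this.eventually (gt_mem_nhds (show (0:ℝ) < 1 / (2 * D : ℝ) ^ l by positivity))).and
    (Filter.eventually_ge_atTop 1)
  obtain ⟨t, ht, ht1⟩ := h5.exists
  have h6 := key2 t ht1
  have hp : (0:ℝ) < ((D + 1 : ℝ) / D) ^ t := by positivity
  have hq : (0:ℝ) < (2 * D : ℝ) ^ l := by positivity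
  rw [div_lt_div_iff₀ hp hq] at ht
  linarith

theorem finrank_restrict (l R : ℕ) :
    Module.finrank ℝ (MvPolynomial.restrictTotalDegree (Fin l) ℝ R) ≤ (expo l R).card := by
  let b : Module.Basis _ ℝ (MvPolynomial.restrictTotalDegree (Fin l) ℝ R) :=
    MvPolynomial.basisRestrictSupport ℝ _
  rw [Module.finrank_eq_nat_card_basis b]
  have : Nat.card (expo l R) = (expo l R).card := by simp
  rw [← this]
  apply Nat.card_le_card_of_injective (fun e => ⟨fun i => e.1 i, by
    rw [mem_expo]
    have := e.2
    simp only [Set.mem_ofPred_eq] at this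
    refine le_trans (le_of_eq ?_) this
    rw [Finsupp.sum_fintype _ _ (by simp)]⟩)
  intro e e' h
  simp only [Subtype.mk.injEq] at h
  exact Subtype.ext (DFunLike.coe_injective h)

theorem alg_rel {l : ℕ} (P : Fin l → MvPolynomial (Fin l) ℝ) (d : Fin l → ℕ) (hd : ∀ i, 1 ≤ d i)
    (hP : ∀ i, (P i).totalDegree ≤ d i) (u : MvPolynomial (Fin l) ℝ) (hu : u.totalDegree ≤ 1) :
    ∃ R : Polynomial (MvPolynomial (Fin l) ℝ), R ≠ 0 ∧ R.natDegree ≤ ∏ i, d i ∧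
      ∀ x, (R.map (MvPolynomial.eval fun i => MvPolynomial.eval x (P i))).eval
        (MvPolynomial.eval x u) = 0 := by
  classical
  set D := ∏ i, d i with hDdef
  have hD : 1 ≤ D := Finset.one_le_prod' fun i _ => hd i
  obtain ⟨R, hR⟩ := growth l D hD
  have hcard : (expo l (R + D)).card < (D + 1) * (wexpo d R).card := by
    have h1 := card_wexpo d hd R
    by_contra! h
    have h2 := Nat.mul_le_mul_left D h
    have h3 := Nat.mul_le_mul_left (D+1) h1
    rw [← hDdef] at h3
    nlinarith
  let ι := Fin (D + 1) × wexpo d R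
  let f : ι → MvPolynomial.restrictTotalDegree (Fin l) ℝ (R + D) := fun p =>
    ⟨u ^ p.1.1 * ∏ i, P i ^ (p.2.1 i), by
      rw [MvPolynomial.mem_restrictTotalDegree]
      refine (MvPolynomial.totalDegree_mul _ _).trans ?_
      rw [add_comm]
      have hb := p.2.2
      simp only [wexpo, Finset.mem_filter] at hb
      gcongr
      · refine (MvPolynomial.totalDegree_finsetProd _ _).trans (le_trans ?_ hb.2)
        refine Finset.sum_le_sum fun i _ => ?_
        refine (MvPolynomial.totalDegree_pow _ _).trans ?_
        rw [mul_comm]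
        exact Nat.mul_le_mul_right _ (hP i)
      · refine (MvPolynomial.totalDegree_pow _ _).trans ?_
        have := p.1.2
        nlinarith⟩
  have hnot : ¬ LinearIndependent ℝ f := by
    intro h
    have h1 := h.fintype_card_le_finrank
    have h2 := finrank_restrict l (R + D)
    simp only [ι, Fintype.card_prod, Fintype.card_fin, Fintype.card_coe] at h1
    omega
  rw [Fintype.not_linearIndependent_iff] at hnot
  obtain ⟨g, hg, ⟨p0, hp0⟩⟩ := hnot
  have hg' : ∑ p, MvPolynomial.C (g p) * (u ^ p.1.1 * ∏ i, P i ^ (p.2.1 i)) = 0 := by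
    have := congrArg Subtype.val hg
    simpa [f, MvPolynomial.smul_eq_C_mul] using this
  let tof : (Fin l → ℕ) → (Fin l →₀ ℕ) := Finsupp.equivFunOnFinite.symm
  refine ⟨∑ p : ι, Polynomial.monomial p.1.1 (MvPolynomial.monomial (tof p.2.1) (g p)), ?_, ?_, ?_⟩
  · intro h
    have h1 := congrArg (fun q => MvPolynomial.coeff (tof p0.2.1) (Polynomial.coeff q p0.1.1)) h
    simp only [Polynomial.finsetSum_coeff, Polynomial.coeff_monomial, MvPolynomial.coeff_sum, Polynomial.coeff_zero,
      MvPolynomial.coeff_zero] at h1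
    rw [Finset.sum_eq_single p0] at h1
    · simp at h1; exact hp0 h1
    · intro p _ hp
      split_ifs with h2
      · rw [MvPolynomial.coeff_monomial, if_neg]
        intro h3
        apply hp
        refine Prod.ext (Fin.ext h2) (Subtype.ext (Finsupp.equivFunOnFinite.symm.injective h3))
      · simp
    · simp
  · refine Polynomial.natDegree_sum_le_of_forall_le _ _ fun p _ => ?_
    exact (Polynomial.natDegree_monomial_le _).trans (Nat.lt_succ_iff.1 p.1.2)
  · intro x
    have := congrArg (MvPolynomial.eval x) hg'
    simp only [map_sum, map_mul, MvPolynomial.eval_C, map_pow, map_prod, map_zero] at this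
    rw [Polynomial.map_sum, Polynomial.eval_finsetSum, ← this]
    refine Finset.sum_congr rfl fun p _ => ?_
    rw [Polynomial.map_monomial, Polynomial.eval_monomial, MvPolynomial.eval_monomial,
      Finsupp.prod_fintype _ _ (by simp)]
    simp only [tof, Finsupp.equivFunOnFinite_symm_apply_apply]
    ring

end PartPA

section PartPA2
open scoped ContDiff Topology
open MeasureTheory

theorem contDiff_mvPoly {l : ℕ} (p : MvPolynomial (Fin l) ℝ) :
    ContDiff ℝ ∞ (fun x : Fin l → ℝ => MvPolynomial.eval x p) := by
  induction p using MvPolynomial.induction_on with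
  | C a => simpa using contDiff_const
  | add p q hp hq => simpa using hp.add hq
  | mul_X p i hp => simpa using hp.mul (contDiff_apply ℝ ℝ i)

theorem mvPoly_eq_zero_of_eventually {l : ℕ} (p : MvPolynomial (Fin l) ℝ) (v : Fin l → ℝ)
    (h : ∀ᶠ w in 𝓝 v, MvPolynomial.eval w p = 0) : p = 0 := by
  obtain ⟨ε, hε, hb⟩ := Metric.eventually_nhds_iff_ball.1 h
  apply MvPolynomial.funext_set (s := fun i => Metric.ball (v i) ε)
  · intro i
    rw [Real.ball_eq_Ioo]
    exact Set.Ioo_infinite (by linarith)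
  · intro x hx
    rw [map_zero]
    apply hb
    rw [Metric.mem_ball, dist_pi_lt_iff hε]
    intro i
    exact hx i (Set.mem_univ i)

theorem bezout_regular {l : ℕ} (P : Fin l → MvPolynomial (Fin l) ℝ) (d : Fin l → ℕ)
    (hd : ∀ i, 1 ≤ d i) (hP : ∀ i, (P i).totalDegree ≤ d i) (v0 : Fin l → ℝ)
    (T : Finset (Fin l → ℝ))
    (hT : ∀ x ∈ T, (∀ i, MvPolynomial.eval x (P i) = v0 i) ∧
      (jac (fun i x => MvPolynomial.eval x (P i)) x).det ≠ 0) :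
    T.card ≤ ∏ i, d i := by
  classical
  by_contra! hcard
  obtain ⟨L, hL⟩ := Module.exists_dual_forall_apply_ne_zero (K := ℝ) (M := Fin l → ℝ)
    (ι := {p : T × T // p.1 ≠ p.2}) (fun p => p.1.1.1 - p.1.2.1)
    (fun p h => p.2 (Subtype.ext (sub_eq_zero.1 h)))
  let u : MvPolynomial (Fin l) ℝ := ∑ i, MvPolynomial.C (L (Pi.single i 1)) * MvPolynomial.X i
  have hu : u.totalDegree ≤ 1 := by
    refine MvPolynomial.totalDegree_finsetSum_le fun i _ => ?_
    refine (MvPolynomial.totalDegree_mul _ _).trans ?_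
    simp
  have hue : ∀ x, MvPolynomial.eval x u = L x := by
    intro x
    simp only [u, map_sum, map_mul, MvPolynomial.eval_C, MvPolynomial.eval_X]
    conv_rhs => rw [← Finset.univ_sum_single x]
    rw [map_sum]
    refine Finset.sum_congr rfl fun m _ => ?_
    have : (Pi.single m (x m) : Fin l → ℝ) = x m • Pi.single m 1 := by
      rw [← Pi.single_smul]; simp
    rw [this, map_smul, smul_eq_mul, mul_comm]
  have hLc : Continuous L := LinearMap.continuous_of_finiteDimensional L
  obtain ⟨R, hR0, hRd, hR⟩ := alg_rel P d hd hP u hu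
  have hloc : ∀ x : T, ∃ s : (Fin l → ℝ) → (Fin l → ℝ), ContinuousAt s v0 ∧ s v0 = x.1 ∧
      ∀ᶠ v in 𝓝 v0, ∀ i, MvPolynomial.eval (s v) (P i) = v i := by
    rintro ⟨x, hx⟩
    obtain ⟨e, he, hee⟩ := loc_inv Set.univ isOpen_univ (fun i x => MvPolynomial.eval x (P i))
      (fun i => (contDiff_mvPoly (P i)).contDiffOn) x (Set.mem_univ _) (hT x hx).2
    have hex : e x = v0 := by rw [hee]; exact funext (hT x hx).1
    refine ⟨e.symm, ?_, ?_, ?_⟩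
    · rw [← hex]; exact e.continuousAt_symm (e.map_source he)
    · rw [← hex]; exact e.left_inv he
    · have : ∀ᶠ v in 𝓝 v0, v ∈ e.target :=
        e.open_target.mem_nhds (by rw [← hex]; exact e.map_source he)
      filter_upwards [this] with v hv i
      have := e.right_inv hv
      rw [hee] at this
      exact congrFun this i
  choose s hs1 hs2 hs3 using hloc
  have hinj : ∀ᶠ v in 𝓝 v0, ∀ p : {p : T × T // p.1 ≠ p.2}, L (s p.1.1 v) ≠ L (s p.1.2 v) := by
    rw [Filter.eventually_all]
    intro p
    have h1 : ContinuousAt (fun v => L (s p.1.1 v) - L (s p.1.2 v)) v0 :=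
      (hLc.continuousAt.comp (hs1 p.1.1)).sub (hLc.continuousAt.comp (hs1 p.1.2))
    have h2 := h1.eventually_ne (y := 0) (by
      rw [hs2, hs2, ← map_sub]; exact hL p)
    filter_upwards [h2] with v hv
    exact sub_ne_zero.1 hv
  have hall : ∀ᶠ v in 𝓝 v0, ∀ x : T, ∀ i, MvPolynomial.eval (s x v) (P i) = v i :=
    Filter.eventually_all.2 hs3
  apply hR0
  ext1 m
  rw [Polynomial.coeff_zero]
  apply mvPoly_eq_zero_of_eventually _ v0
  filter_upwards [hinj, hall] with v hv1 hv2
  have hz : R.map (MvPolynomial.eval v) = 0 := by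
    refine Polynomial.eq_zero_of_natDegree_lt_card_of_eval_eq_zero (ι := T) _ (f := fun x => L (s x v)) ?_ ?_ ?_
    · intro x y hxy
      by_contra hne
      exact hv1 ⟨(x, y), hne⟩ hxy
    · intro x
      have := hR (s x v)
      rw [hue, show (fun i => MvPolynomial.eval (s x v) (P i)) = v from funext (hv2 x)] at this
      exact this
    · rw [Fintype.card_coe]
      exact (Polynomial.natDegree_map_le.trans hRd).trans_lt hcard
  have := congrArg (fun q => Polynomial.coeff q m) hz
  simpa using this

theorem bezout_CB {l : ℕ} (Δ : Set (Fin l → ℝ)) (G : Fin l → (Fin l → ℝ) → ℝ)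
    (P : Fin l → MvPolynomial (Fin l) ℝ) (d : Fin l → ℕ) (hd : ∀ i, 1 ≤ d i)
    (hP : ∀ i, (P i).totalDegree ≤ d i)
    (hG : ∀ i, ∀ x ∈ Δ, G i x = MvPolynomial.eval x (P i)) :
    CB Δ G (∏ i, (d i : ℝ)) := by
  have := sard Set.univ isOpen_univ (fun i x => MvPolynomial.eval x (P i))
      (fun i => (contDiff_mvPoly (P i)).contDiffOn)
  filter_upwards [this] with v hv T hT
  have h := bezout_regular P d hd hP v T (fun x hx => by
    have h1 : ∀ i, MvPolynomial.eval x (P i) = v i := fun i => by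
      rw [← hG i x (hT x hx).1]; exact (hT x hx).2 i
    exact ⟨h1, hv x (Set.mem_univ _) h1⟩)
  exact_mod_cast h

end PartPA2

section PartPB1
open scoped ContDiff Topology ENNReal
open MeasureTheory

theorem diffAt_of {l : ℕ} {Δ : Set (Fin l → ℝ)} (hΔ : IsOpen Δ) {f : (Fin l → ℝ) → ℝ}
    (h : ContDiffOn ℝ ∞ f Δ) {x : Fin l → ℝ} (hx : x ∈ Δ) : DifferentiableAt ℝ f x :=
  (h.contDiffAt (hΔ.mem_nhds hx)).differentiableAt (by simp)

theorem contOn_jac {l : ℕ} (Δ : Set (Fin l → ℝ)) (hΔ : IsOpen Δ) (G : Fin l → (Fin l → ℝ) → ℝ)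
    (hG : ∀ i, ContDiffOn ℝ ∞ (G i) Δ) : ContDiffOn ℝ ∞ (fun x => (jac G x).det) Δ := by
  simp only [Matrix.det_apply]
  refine ContDiffOn.sum fun σ _ => ?_
  refine ContDiffOn.const_smul _ ?_
  refine contDiffOn_prod fun i _ => ?_
  simp only [jac, Matrix.of_apply]
  exact ((hG (σ i)).fderiv_of_isOpen hΔ (m := ∞) (by simp)).clm_apply contDiffOn_const

theorem area_ineq {l : ℕ} (Δ : Set (Fin l → ℝ)) (hΔ : IsOpen Δ) (G : Fin l → (Fin l → ℝ) → ℝ)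
    (hG : ∀ i, ContDiffOn ℝ ∞ (G i) Δ) (B : ℝ) (hB : CB Δ G B)
    (w : (Fin l → ℝ) → ℝ≥0∞) (hw : Measurable w) :
    ∫⁻ x in Δ, ENNReal.ofReal |(jac G x).det| * w (fun i => G i x) ≤ ENNReal.ofReal B * ∫⁻ v, w v := by
  classical
  set Φ : (Fin l → ℝ) → (Fin l → ℝ) := fun x i => G i x with hΦ
  have hd : ∀ x ∈ Δ, HasFDerivAt Φ (fderiv ℝ Φ x) x := fun x hx =>
    (differentiableAt_pi.2 fun i => diffAt_of hΔ (hG i) hx).hasFDerivAt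
  have hdet : ∀ x ∈ Δ, (fderiv ℝ Φ x).det = (jac G x).det := fun x hx =>
    fderiv_det_jac G x fun i => diffAt_of hΔ (hG i) hx
  have hcont : ContinuousOn (fun x => (jac G x).det) Δ := (contOn_jac Δ hΔ G hG).continuousOn
  set R : Set (Fin l → ℝ) := {x | x ∈ Δ ∧ (jac G x).det ≠ 0} with hR
  have hRo : IsOpen R := hcont.isOpen_inter_preimage hΔ isOpen_compl_singleton
  have hloc : ∀ x : R, ∃ U : Set (Fin l → ℝ), IsOpen U ∧ x.1 ∈ U ∧ U ⊆ R ∧ Set.InjOn Φ U := by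
    rintro ⟨x, hx⟩
    obtain ⟨e, he, hee⟩ := loc_inv Δ hΔ G hG x hx.1 hx.2
    refine ⟨e.source ∩ R, e.open_source.inter hRo, ⟨he, hx⟩, Set.inter_subset_right, ?_⟩
    have := e.injOn
    rw [hee] at this
    exact this.mono Set.inter_subset_left
  choose U hU1 hU2 hU3 hU4 using hloc
  obtain ⟨T, hTc, hT⟩ := TopologicalSpace.isOpen_iUnion_countable U hU1
  have hRU : R = ⋃ i ∈ T, U i := by
    rw [hT]
    apply Set.Subset.antisymm
    · intro x hx; exact Set.mem_iUnion.2 ⟨⟨x, hx⟩, hU2 _⟩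
    · exact Set.iUnion_subset hU3
  have step1 : ∫⁻ x in Δ, ENNReal.ofReal |(jac G x).det| * w (Φ x)
      = ∫⁻ x in R, ENNReal.ofReal |(jac G x).det| * w (Φ x) := by
    rw [← lintegral_indicator hΔ.measurableSet, ← lintegral_indicator hRo.measurableSet]
    congr 1
    funext x
    by_cases hx : x ∈ R
    · rw [Set.indicator_of_mem hx, Set.indicator_of_mem hx.1]
    · rw [Set.indicator_of_notMem hx]
      by_cases hx' : x ∈ Δ
      · rw [Set.indicator_of_mem hx']
        have : (jac G x).det = 0 := by
          by_contra h; exact hx ⟨hx', h⟩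
        simp [this]
      · rw [Set.indicator_of_notMem hx']
  rw [step1]
  by_cases hRe : R = ∅
  · rw [hRe]; simp
  have hTne : T.Nonempty := by
    by_contra h
    rw [Set.not_nonempty_iff_eq_empty] at h
    rw [h] at hRU; simp at hRU; exact hRe hRU
  obtain ⟨f, hf⟩ := hTc.exists_eq_range hTne
  have hRU' : R = ⋃ k, U (f k) := by rw [hRU, hf, Set.biUnion_range]
  set A : ℕ → Set (Fin l → ℝ) := disjointed fun k => U (f k) with hA
  have hAm : ∀ k, MeasurableSet (A k) := fun k =>
    MeasurableSet.disjointed (fun k => (hU1 _).measurableSet) k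
  have hAU : ∀ k, A k ⊆ U (f k) := fun k => disjointed_le _ k
  have hAR : ∀ k, A k ⊆ R := fun k => (hAU k).trans (hU3 _)
  have hAd : Pairwise (Function.onFun Disjoint A) := disjoint_disjointed _
  have hRA : R = ⋃ k, A k := by rw [hRU', hA, iUnion_disjointed]
  have hinj : ∀ k, Set.InjOn Φ (A k) := fun k => (hU4 _).mono (hAU k)
  have hfd : ∀ k, ∀ x ∈ A k, HasFDerivWithinAt Φ (fderiv ℝ Φ x) (A k) x := fun k x hx =>
    (hd x (hAR k hx).1).hasFDerivWithinAt
  have himg : ∀ k, MeasurableSet (Φ '' A k) := fun k =>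
    measurable_image_of_fderivWithin (hAm k) (hfd k) (hinj k)
  have step2 : ∫⁻ x in R, ENNReal.ofReal |(jac G x).det| * w (Φ x)
      = ∑' k, ∫⁻ v, (Φ '' A k).indicator w v := by
    rw [hRA, lintegral_iUnion hAm hAd]
    congr 1
    funext k
    rw [lintegral_indicator (himg k), lintegral_image_eq_lintegral_abs_det_fderiv_mul volume (hAm k) (hfd k) (hinj k)]
    apply setLIntegral_congr_fun (hAm k)
    intro x hx
    simp only
    rw [hdet x (hAR k hx).1]
  rw [step2, ← lintegral_tsum (fun k => (hw.indicator (himg k)).aemeasurable),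
    ← lintegral_const_mul _ hw]
  apply lintegral_mono_ae
  filter_upwards [hB] with v hv
  rw [ENNReal.tsum_eq_iSup_sum]
  apply iSup_le
  intro s
  have h1 : ∑ k ∈ s, (Φ '' A k).indicator w v = ((s.filter fun k => v ∈ Φ '' A k).card : ℝ≥0∞) * w v := by
    simp only [Set.indicator_apply]
    rw [← Finset.sum_filter, Finset.sum_const, nsmul_eq_mul]
  rw [h1]
  gcongr
  have h2 : ∀ k : (s.filter fun k => v ∈ Φ '' A k), ∃ x ∈ A k, Φ x = v := fun k =>
    (Finset.mem_filter.1 k.2).2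
  choose g hg1 hg2 using h2
  have hginj : Function.Injective g := by
    intro k k' h
    by_contra hne
    have := hAd (fun h' => hne (Subtype.ext h') : k.1 ≠ k'.1)
    exact Set.disjoint_left.1 this (hg1 k) (h ▸ hg1 k')
  have h3 := hv (Finset.univ.image g) (by
    intro x hx
    obtain ⟨k, _, rfl⟩ := Finset.mem_image.1 hx
    exact ⟨(hAR _ (hg1 k)).1, fun i => congrFun (hg2 k) i⟩)
  rw [Finset.card_image_of_injective _ hginj] at h3
  simp only [Finset.card_univ, Fintype.card_coe] at h3
  rw [← ENNReal.ofReal_natCast]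
  exact ENNReal.ofReal_le_ofReal h3

end PartPB1

section PartPB2
open scoped ContDiff Topology ENNReal
open MeasureTheory

noncomputable def detCM (l : ℕ) : ContinuousMultilinearMap ℝ (fun _ : Fin l => Fin l → ℝ) ℝ :=
  ⟨(Matrix.detRowAlternating (n := Fin l) (R := ℝ)).toMultilinearMap, by
    show Continuous fun M : Fin l → Fin l → ℝ => Matrix.det (Matrix.of M)
    exact Continuous.matrix_det continuous_id⟩

theorem detCM_apply {l : ℕ} (M : Fin l → Fin l → ℝ) : detCM l M = Matrix.det (Matrix.of M) := rfl

noncomputable def grow {l : ℕ} (f : (Fin l → ℝ) → ℝ) (x : Fin l → ℝ) : Fin l → ℝ :=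
  fun m => fderiv ℝ f x (Pi.single m 1)

noncomputable def cof {l : ℕ} (H : Fin l → (Fin l → ℝ) → ℝ) (i0 m : Fin l) (x : Fin l → ℝ) : ℝ :=
  detCM l (Function.update (fun i => grow (H i) x) i0 (Pi.single m 1))

theorem vec_eq_sum {l : ℕ} (v : Fin l → ℝ) : v = ∑ m, v m • (Pi.single m 1 : Fin l → ℝ) := by
  conv_lhs => rw [← Finset.univ_sum_single v]
  refine Finset.sum_congr rfl fun m _ => ?_
  rw [← Pi.single_smul]; simp

theorem det_update_sum {l : ℕ} (r : Fin l → Fin l → ℝ) (i : Fin l) (v : Fin l → ℝ) :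
    detCM l (Function.update r i v) = ∑ m, v m * detCM l (Function.update r i (Pi.single m 1)) := by
  conv_lhs => rw [vec_eq_sum v]
  have := (detCM l).toMultilinearMap.map_update_sum (t := Finset.univ) (i := i)
    (g := fun m => v m • (Pi.single m 1 : Fin l → ℝ)) (m := r)
  refine this.trans (Finset.sum_congr rfl fun m _ => ?_)
  exact (detCM l).toMultilinearMap.map_update_smul r i (v m) _

theorem det_jac_update {l : ℕ} (H : Fin l → (Fin l → ℝ) → ℝ) (i0 : Fin l) (w : (Fin l → ℝ) → ℝ)
    (x : Fin l → ℝ) : (jac (Function.update H i0 w) x).det =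
      detCM l (Function.update (fun i => grow (H i) x) i0 (grow w x)) := by
  rw [detCM_apply]
  congr 1
  ext i m
  by_cases h : i = i0
  · subst h; simp [jac, grow]
  · simp [jac, grow, Function.update_of_ne h]

theorem contDiffOn_grow {l : ℕ} {Δ : Set (Fin l → ℝ)} (hΔ : IsOpen Δ) {f : (Fin l → ℝ) → ℝ}
    (hf : ContDiffOn ℝ ∞ f Δ) : ContDiffOn ℝ ∞ (grow f) Δ := by
  rw [contDiffOn_pi]
  intro m
  exact (hf.fderiv_of_isOpen hΔ (m := ∞) (by simp)).clm_apply contDiffOn_const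

theorem hasFDerivAt_cof {l : ℕ} {Δ : Set (Fin l → ℝ)} (hΔ : IsOpen Δ) (H : Fin l → (Fin l → ℝ) → ℝ)
    (hH : ∀ i, ContDiffOn ℝ ∞ (H i) Δ) (i0 m : Fin l) (x : Fin l → ℝ) (hx : x ∈ Δ) :
    ∃ C : (Fin l → ℝ) →L[ℝ] ℝ, HasFDerivAt (cof H i0 m) C x ∧ ∀ v, C v =
      ∑ i ∈ Finset.univ.erase i0, detCM l (Function.update (Function.update (fun i => grow (H i) x) i0 (Pi.single m 1)) i
        (fderiv ℝ (grow (H i)) x v)) := by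
  have hg : ∀ i, HasFDerivAt (fun y => Function.update (fun i => grow (H i) y) i0 (Pi.single m 1) i)
      (if i = i0 then 0 else fderiv ℝ (grow (H i)) x) x := by
    intro i
    by_cases h : i = i0
    · subst h
      simp only [Function.update_self, if_true]
      exact hasFDerivAt_const _ _
    · simp only [Function.update_of_ne h, if_neg h]
      exact (((contDiffOn_grow hΔ (hH i)).contDiffAt (hΔ.mem_nhds hx)).differentiableAt
        (by simp)).hasFDerivAt
  refine ⟨_, HasFDerivAt.multilinear_comp (detCM l) hg, ?_⟩
  intro v
  rw [_root_.sum_apply]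
  rw [← Finset.add_sum_erase _ _ (Finset.mem_univ i0)]
  simp only [if_true]
  have h0 : ((detCM l).toContinuousLinearMap
    (fun j => Function.update (fun i => grow (H i) x) i0 (Pi.single m 1) j) i0 ∘L (0 : (Fin l → ℝ) →L[ℝ] (Fin l → ℝ))) v = 0 := by
    rw [ContinuousLinearMap.comp_zero]; rfl
  rw [h0, zero_add]
  refine Finset.sum_congr rfl fun i hi => ?_
  rw [if_neg (Finset.ne_of_mem_erase hi)]
  rfl

theorem piola {l : ℕ} {Δ : Set (Fin l → ℝ)} (hΔ : IsOpen Δ) (H : Fin l → (Fin l → ℝ) → ℝ)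
    (hH : ∀ i, ContDiffOn ℝ ∞ (H i) Δ) (i0 : Fin l) (x : Fin l → ℝ) (hx : x ∈ Δ) :
    ∑ m, fderiv ℝ (cof H i0 m) x (Pi.single m 1) = 0 := by
  have h1 : ∀ m, fderiv ℝ (cof H i0 m) x (Pi.single m 1) =
      ∑ i ∈ Finset.univ.erase i0, ∑ p, fderiv ℝ (grow (H i)) x (Pi.single m 1) p *
        detCM l (Function.update (Function.update (fun i => grow (H i) x) i0 (Pi.single m 1)) i
        (Pi.single p 1)) := by
    intro m
    obtain ⟨C, hC, hCv⟩ := hasFDerivAt_cof hΔ H hH i0 m x hx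
    rw [hC.fderiv, hCv]
    refine Finset.sum_congr rfl fun i _ => ?_
    rw [det_update_sum]
  simp only [h1]
  rw [Finset.sum_comm]
  refine Finset.sum_eq_zero fun i hi => ?_
  have hne : i ≠ i0 := Finset.ne_of_mem_erase hi
  have hsym : ∀ m p : Fin l, fderiv ℝ (grow (H i)) x (Pi.single m 1) p
      = fderiv ℝ (grow (H i)) x (Pi.single p 1) m := by
    have hc : ContDiffAt ℝ ∞ (H i) x := (hH i).contDiffAt (hΔ.mem_nhds hx)
    have hs := hc.isSymmSndFDerivAt (by simp only [minSmoothness_of_isRCLikeNormedField]; exact ENat.LEInfty.out)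
    have hdd : DifferentiableAt ℝ (fderiv ℝ (H i)) x :=
      (hc.fderiv_right (m := ∞) (by simp)).differentiableAt (by simp)
    have key : ∀ m p : Fin l, fderiv ℝ (grow (H i)) x (Pi.single m 1) p
      = fderiv ℝ (fderiv ℝ (H i)) x (Pi.single m 1) (Pi.single p 1) := by
      intro m p
      have : ∀ q, DifferentiableAt ℝ (fun y => fderiv ℝ (H i) y (Pi.single q 1)) x := fun q =>
        hdd.clm_apply (differentiableAt_const _)
      unfold grow
      rw [fderiv_pi this]
      simp only [ContinuousLinearMap.coe_pi']
      rw [fderiv_clm_apply hdd (differentiableAt_const _)]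
      simp
    intro m p
    rw [key, key]
    exact hs _ _
  have hanti : ∀ m p : Fin l,
      detCM l (Function.update (Function.update (fun i => grow (H i) x) i0 (Pi.single m 1)) i (Pi.single p 1))
      = - detCM l (Function.update (Function.update (fun i => grow (H i) x) i0 (Pi.single p 1)) i (Pi.single m 1)) := by
    intro m p
    have := (Matrix.detRowAlternating (n := Fin l) (R := ℝ)).map_swap
      (Function.update (Function.update (fun i => grow (H i) x) i0 (Pi.single p 1)) i (Pi.single m 1)) hne
    refine Eq.trans ?_ this
    show _ = Matrix.detRowAlternating _
    refine congrArg (fun M => Matrix.detRowAlternating M) ?_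
    funext j
    simp only [Function.comp]
    by_cases hj : j = i
    · subst hj
      simp [Function.update_of_ne hne.symm]
    · by_cases hj0 : j = i0
      · subst hj0
        simp [Function.update_of_ne hj]
      · simp [Equiv.swap_apply_of_ne_of_ne hj hj0, Function.update_of_ne hj, Function.update_of_ne hj0]
  have : ∀ s : ℝ, s = -s → s = 0 := fun s h => by linarith
  apply this
  conv_lhs => rw [Finset.sum_comm]
  rw [← Finset.sum_neg_distrib]
  refine Finset.sum_congr rfl fun m _ => ?_
  rw [← Finset.sum_neg_distrib]
  refine Finset.sum_congr rfl fun p _ => ?_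
  rw [hsym p m, hanti p m]; ring

theorem integral_fderiv_zero {l : ℕ} (V : (Fin l → ℝ) → ℝ) (hV : ContDiff ℝ 1 V)
    (hc : HasCompactSupport V) (v : Fin l → ℝ) : ∫ x, fderiv ℝ V x v = 0 := by
  have h1 : Integrable (fun x => fderiv ℝ V x v) := by
    apply Continuous.integrable_of_hasCompactSupport
    · exact (hV.continuous_fderiv (by simp)).clm_apply continuous_const
    · exact hc.fderiv_apply ℝ v
  have := integral_mul_fderiv_eq_neg_fderiv_mul_of_integrable (μ := volume) (𝕜 := ℝ)
    (f := fun _ : Fin l → ℝ => (1:ℝ)) (g := V) (v := v)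
    (by simp) (by simpa using h1) (by simpa using hV.continuous.integrable_of_hasCompactSupport hc)
    (fun x _ => differentiableAt_const _) (fun x _ => hV.differentiable (by simp) x)
  simpa using this

theorem stokes {l : ℕ} {Δ : Set (Fin l → ℝ)} (hΔ : IsOpen Δ) (H : Fin l → (Fin l → ℝ) → ℝ)
    (hH : ∀ i, ContDiffOn ℝ ∞ (H i) Δ) (i0 : Fin l) (w : (Fin l → ℝ) → ℝ) (hw : ContDiffOn ℝ ∞ w Δ)
    (K : Set (Fin l → ℝ)) (hK : IsCompact K) (hKΔ : K ⊆ Δ) (hwK : ∀ x, x ∉ K → w x = 0) :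
    ∫ x in Δ, (jac (Function.update H i0 w) x).det = 0 := by
  have hwe : ∀ x, x ∉ K → w =ᶠ[𝓝 x] fun _ => 0 := by
    intro x hx
    filter_upwards [hK.isClosed.isOpen_compl.mem_nhds hx] with y hy
    exact hwK y hy
  let V : Fin l → (Fin l → ℝ) → ℝ := fun m x => w x * cof H i0 m x
  have hcofd : ∀ m, ∀ x ∈ Δ, ContDiffAt ℝ 1 (cof H i0 m) x := by
    intro m x hx
    have : ContDiffAt ℝ ∞ (fun x => detCM l (Function.update (fun i => grow (H i) x) i0 (Pi.single m 1))) x := by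
      apply (detCM l).contDiff.contDiffAt.comp
      rw [contDiffAt_pi]
      intro i
      by_cases h : i = i0
      · subst h
        simp only [Function.update_self]
        exact contDiffAt_const
      · simp only [Function.update_of_ne h]
        exact (contDiffOn_grow hΔ (hH i)).contDiffAt (hΔ.mem_nhds hx)
    exact this.of_le (by norm_cast)
  have hwd : ∀ x ∈ Δ, ContDiffAt ℝ 1 w x := fun x hx =>
    (hw.contDiffAt (hΔ.mem_nhds hx)).of_le (by norm_cast)
  have hV : ∀ m, ContDiff ℝ 1 (V m) := by
    intro m
    rw [contDiff_iff_contDiffAt]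
    intro x
    by_cases hx : x ∈ K
    · exact (hwd x (hKΔ hx)).mul (hcofd m x (hKΔ hx))
    · have : V m =ᶠ[𝓝 x] fun _ => 0 := by
        filter_upwards [hwe x hx] with y hy
        simp [V, hy]
      exact contDiffAt_const.congr_of_eventuallyEq this
  have hVc : ∀ m, HasCompactSupport (V m) := by
    intro m
    apply HasCompactSupport.intro hK
    intro x hx
    simp [V, hwK x hx]
  have hsum : ∀ x ∈ Δ, (jac (Function.update H i0 w) x).det = ∑ m, fderiv ℝ (V m) x (Pi.single m 1) := by
    intro x hx
    have h1 : ∀ m, fderiv ℝ (V m) x (Pi.single m 1) =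
      w x * fderiv ℝ (cof H i0 m) x (Pi.single m 1) + grow w x m * cof H i0 m x := by
      intro m
      have := fderiv_mul ((hwd x hx).differentiableAt (by simp)) ((hcofd m x hx).differentiableAt (by simp))
      show fderiv ℝ (w * cof H i0 m) x _ = _
      rw [this]
      simp [grow, mul_comm]
    simp only [h1]
    rw [Finset.sum_add_distrib, ← Finset.mul_sum, piola hΔ H hH i0 x hx, mul_zero, zero_add,
      det_jac_update, det_update_sum]
    rfl
  have h2 : ∫ x in Δ, (jac (Function.update H i0 w) x).det = ∫ x, ∑ m, fderiv ℝ (V m) x (Pi.single m 1) := by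
    rw [setIntegral_congr_fun hΔ.measurableSet hsum]
    apply setIntegral_eq_integral_of_forall_compl_eq_zero
    intro x hx
    refine Finset.sum_eq_zero fun m _ => ?_
    have : V m =ᶠ[𝓝 x] fun _ => 0 := by
        filter_upwards [hwe x (fun h => hx (hKΔ h))] with y hy
        simp [V, hy]
    rw [this.fderiv_eq]; simp
  rw [h2, integral_finsetSum]
  · exact Finset.sum_eq_zero fun m _ => integral_fderiv_zero _ (hV m) (hVc m) _
  · intro m _
    apply Continuous.integrable_of_hasCompactSupport
    · exact ((hV m).continuous_fderiv (by simp)).clm_apply continuous_const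
    · exact (hVc m).fderiv_apply ℝ _

end PartPB2

section PartPB3
open scoped ContDiff Topology ENNReal
open MeasureTheory

theorem bump_exists (η : ℝ) (hη : 0 < η) : ∃ b h : ℝ → ℝ, ContDiff ℝ ∞ b ∧ ContDiff ℝ ∞ h ∧
    (∀ s, HasDerivAt h (b s) s) ∧ (∀ s, 0 ≤ b s) ∧ (∀ s, η ≤ |s| → b s = 0) ∧ Integrable b ∧ ∫ s, b s = 1 ∧
    (∀ s, |h s| ≤ 1 / 2) ∧ (∀ s, s ≤ -η → h s = -(1/2)) ∧ (∀ s, η ≤ s → h s = 1/2) := by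
  let f : ContDiffBump (0 : ℝ) := ⟨η / 2, η, by positivity, by linarith⟩
  let b := f.normed volume
  have hbc : ContDiff ℝ ∞ b := f.contDiff_normed
  have hb0 : ∀ s, 0 ≤ b s := fun s => f.nonneg_normed s
  have hbz : ∀ s, η ≤ |s| → b s = 0 := by
    intro s hs
    have : s ∉ Function.support b := by
      rw [f.support_normed_eq]
      simp only [Metric.mem_ball, dist_zero_right, not_lt, Real.norm_eq_abs]
      exact hs
    simpa using this
  have hbi : ∫ s, b s = 1 := f.integral_normed
  have hbint : Integrable b := by
    by_contra h
    rw [integral_undef h] at hbi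
    exact zero_ne_one hbi
  let h : ℝ → ℝ := fun s => (∫ t in (-η)..s, b t) - 1/2
  have hder : ∀ s, HasDerivAt h (b s) s := fun s =>
    (hbc.continuous.integral_hasStrictDerivAt (-η) s).hasDerivAt.sub_const _
  have hhc : ContDiff ℝ ∞ h := by
    rw [contDiff_infty_iff_deriv]
    refine ⟨fun s => (hder s).differentiableAt, ?_⟩
    rw [show deriv h = b from funext fun s => (hder s).deriv]
    exact hbc
  have hlow : ∀ s, s ≤ -η → h s = -(1/2) := by
    intro s hs
    have : ∫ t in (-η)..s, b t = 0 := by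
      rw [intervalIntegral.integral_symm]
      rw [intervalIntegral.integral_zero_ae, neg_zero]
      refine Filter.Eventually.of_forall fun t ht => ?_
      rw [Set.uIoc_of_le hs] at ht
      apply hbz
      rw [abs_of_nonpos (by linarith [ht.2])]
      linarith [ht.2]
    simp only [h, this]; ring
  have hhigh : ∀ s, η ≤ s → h s = 1/2 := by
    intro s hs
    have : ∫ t in (-η)..s, b t = 1 := by
      rw [intervalIntegral.integral_of_le (by linarith), ← hbi]
      apply setIntegral_eq_integral_of_forall_compl_eq_zero
      intro t ht
      apply hbz
      by_contra hlt
      push Not at hlt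
      rw [abs_lt] at hlt
      exact ht ⟨hlt.1, by linarith⟩
    simp only [h, this]; ring
  have hmono : Monotone h := monotone_of_deriv_nonneg (fun s => (hder s).differentiableAt) (fun s => by
    rw [(hder s).deriv]; exact hb0 s)
  refine ⟨b, h, hbc, hhc, hder, hb0, hbz, hbint, hbi, ?_, hlow, hhigh⟩
  intro s
  rw [abs_le]
  constructor
  · have := hmono (min_le_left s (-η))
    rw [hlow _ (min_le_right s (-η))] at this
    linarith
  · have := hmono (le_max_left s η)
    rw [hhigh _ (le_max_right s η)] at this
    linarith

theorem step_exists (η : ℝ) (hη : 0 < η) : ∃ d s : ℝ → ℝ, ContDiff ℝ ∞ d ∧ ContDiff ℝ ∞ s ∧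
    (∀ t, HasDerivAt s (d t) t) ∧ (∀ t, 0 ≤ d t) ∧ (∀ t, t ≤ 0 → d t = 0) ∧ Integrable d ∧ ∫ t, d t = 1 ∧
    (∀ t, 0 ≤ s t ∧ s t ≤ 1) ∧ (∀ t, t ≤ 0 → s t = 0) ∧ (∀ t, η ≤ t → s t = 1) := by
  obtain ⟨b, h, hb, hh, hd, h0, hz, hi, hi1, ha, hl, hr⟩ := bump_exists (η/2) (by positivity)
  refine ⟨fun t => b (t - η/2), fun t => h (t - η/2) + 1/2, ?_, ?_, ?_, ?_, ?_, ?_, ?_, ?_, ?_, ?_⟩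
  · exact hb.comp (contDiff_id.sub contDiff_const)
  · exact (hh.comp (contDiff_id.sub contDiff_const)).add contDiff_const
  · intro t; exact ((hd (t - η/2)).comp_sub_const t (η/2)).add_const _
  · intro t; exact h0 _
  · intro t ht; apply hz; rw [abs_of_nonpos (by linarith)]; linarith
  · exact hi.comp_sub_right (η/2)
  · rw [integral_sub_right_eq_self (fun t => b t)]; exact hi1
  · intro t; have := abs_le.1 (ha (t - η/2)); constructor <;> linarith
  · intro t ht; simp only; rw [hl _ (by linarith)]; ring
  · intro t ht; simp only; rw [hr _ (by linarith)]; ring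

theorem theta_exists (η : ℝ) (hη : 0 < η) (α β : ℝ) (hα : 0 ≤ α) (hα1 : α ≤ 1) (hβ : 0 ≤ β) (hβ1 : β ≤ 1) :
    ∃ d s : ℝ → ℝ, ContDiff ℝ ∞ d ∧ ContDiff ℝ ∞ s ∧
    (∀ t, HasDerivAt s (d t) t) ∧ (∀ t, 0 ≤ d t) ∧ Integrable d ∧ ∫ t, d t = α + β ∧
    (∀ t, |s t| ≤ 1) ∧ (∀ t, 0 ≤ s t * t) ∧ (∀ t, η ≤ t → s t = β) ∧ (∀ t, t ≤ -η → s t = -α) := by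
  obtain ⟨d, s, hd, hs, hds, h0, hz, hi, hi1, h01, hl, hr⟩ := step_exists η hη
  refine ⟨fun t => β * d t + α * d (-t), fun t => β * s t - α * s (-t), ?_, ?_, ?_, ?_, ?_, ?_, ?_, ?_, ?_, ?_⟩
  · exact (contDiff_const.mul hd).add (contDiff_const.mul (hd.comp contDiff_neg))
  · exact (contDiff_const.mul hs).sub (contDiff_const.mul (hs.comp contDiff_neg))
  · intro t
    have h1 : HasDerivAt (fun t => s (-t)) (-(d (-t))) t := by
      have := (hds (-t)).comp t (hasDerivAt_neg t)
      rw [mul_neg_one] at this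
      exact this
    convert! ((hds t).const_mul β).sub (h1.const_mul α) using 1
    ring
  · intro t; exact add_nonneg (mul_nonneg hβ (h0 _)) (mul_nonneg hα (h0 _))
  · exact (hi.const_mul β).add (hi.comp_neg.const_mul α)
  · rw [integral_add (hi.const_mul β) (hi.comp_neg.const_mul α), integral_const_mul, integral_const_mul,
      integral_neg_eq_self (fun t => d t), hi1]; ring
  · intro t
    have h1 := h01 t
    have h2 := h01 (-t)
    rw [abs_le]
    constructor <;> nlinarith
  · intro t
    simp only
    rcases le_total t 0 with ht | ht
    · rw [hl t ht]
      nlinarith [mul_nonneg hα (h01 (-t)).1]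
    · rw [hl (-t) (by linarith)]
      have := mul_nonneg hβ (h01 t).1
      simp only [mul_zero, sub_zero]
      positivity
  · intro t ht
    simp only; rw [hr t ht, hl (-t) (by linarith)]; ring
  · intro t ht
    simp only; rw [hl t (by linarith), hr (-t) (by linarith)]; ring

theorem area_prod {l : ℕ} (Δ : Set (Fin l → ℝ)) (hΔ : IsOpen Δ) (G : Fin l → (Fin l → ℝ) → ℝ)
    (hG : ∀ i, ContDiffOn ℝ ∞ (G i) Δ) (B : ℝ) (hB0 : 0 ≤ B) (hB : CB Δ G B)
    (f : Fin l → ℝ → ℝ) (hf : ∀ i, Continuous (f i)) (hf0 : ∀ i s, 0 ≤ f i s) (hfi : ∀ i, Integrable (f i))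
    (t : (Fin l → ℝ) → ℝ) (ht : ∀ x ∈ Δ, |t x| ≤ |(jac G x).det| * (1/2 * ∏ i, f i (G i x))) :
    |∫ x in Δ, t x| ≤ 1/2 * B * ∏ i, ∫ s, f i s := by
  let W : (Fin l → ℝ) → ℝ := fun v => 1/2 * ∏ i, f i (v i)
  have hW0 : ∀ v, 0 ≤ W v := fun v => mul_nonneg (by norm_num) (Finset.prod_nonneg fun i _ => hf0 i _)
  have hWc : Continuous W := continuous_const.mul (continuous_finsetProd _ fun i _ => (hf i).comp (continuous_apply i))
  have hWi : Integrable W := (Integrable.fintype_prod (fun i => hfi i)).const_mul _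
  have hWint : ∫ v, W v = 1/2 * ∏ i, ∫ s, f i s := by
    simp only [W]
    rw [integral_const_mul, integral_fintype_prod_volume_eq_prod]
  have h1 := area_ineq Δ hΔ G hG B hB (fun v => ENNReal.ofReal (W v)) (by fun_prop)
  rw [← ofReal_integral_eq_lintegral_ofReal hWi (Filter.Eventually.of_forall hW0), ← ENNReal.ofReal_mul hB0, hWint] at h1
  have h2 : ‖∫ x in Δ, t x‖ₑ ≤ ENNReal.ofReal (B * (1/2 * ∏ i, ∫ s, f i s)) := by
    refine (enorm_integral_le_lintegral_enorm _).trans (le_trans ?_ h1)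
    apply setLIntegral_mono_ae' hΔ.measurableSet
    refine Filter.Eventually.of_forall fun x hx => ?_
    rw [← ENNReal.ofReal_mul (abs_nonneg _), ← ofReal_norm, Real.norm_eq_abs]
    exact ENNReal.ofReal_le_ofReal (ht x hx)
  rw [← ofReal_norm, Real.norm_eq_abs] at h2
  have hnn : 0 ≤ B * (1/2 * ∏ i, ∫ s, f i s) :=
    mul_nonneg hB0 (mul_nonneg (by norm_num) (Finset.prod_nonneg fun i _ => integral_nonneg (hf0 i)))
  have := (ENNReal.ofReal_le_ofReal_iff hnn).1 h2
  linarith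

theorem CB_nonneg {l : ℕ} {Δ : Set (Fin l → ℝ)} {G : Fin l → (Fin l → ℝ) → ℝ} {B : ℝ} (h : CB Δ G B) : 0 ≤ B := by
  obtain ⟨v, hv⟩ := h.exists
  simpa using hv ∅ (by simp)

theorem det_smul_update {l : ℕ} (c : Fin l → ℝ) (r : Fin l → Fin l → ℝ) (i0 : Fin l) (u : Fin l → ℝ) :
    detCM l (Function.update (fun i => c i • r i) i0 u) =
      (∏ i ∈ Finset.univ.erase i0, c i) * detCM l (Function.update r i0 u) := by
  have h1 : Function.update (fun i => c i • r i) i0 u =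
      fun i => (Function.update c i0 1 i) • (Function.update r i0 u i) := by
    funext i
    by_cases h : i = i0
    · subst h; simp
    · simp [Function.update_of_ne h]
  rw [h1, ContinuousMultilinearMap.map_smul_univ, smul_eq_mul]
  congr 1
  rw [← Finset.mul_prod_erase _ _ (Finset.mem_univ i0)]
  simp only [Function.update_self, one_mul]
  refine Finset.prod_congr rfl fun i hi => ?_
  rw [Function.update_of_ne (Finset.ne_of_mem_erase hi)]

theorem det_update_lin {l : ℕ} (r : Fin l → Fin l → ℝ) (i0 : Fin l) (a b c : ℝ) (u v w : Fin l → ℝ) :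
    detCM l (Function.update r i0 (a • u + b • v + c • w)) =
      a * detCM l (Function.update r i0 u) + b * detCM l (Function.update r i0 v)
      + c * detCM l (Function.update r i0 w) := by
  rw [ContinuousMultilinearMap.map_update_add, ContinuousMultilinearMap.map_update_add,
    ContinuousMultilinearMap.map_update_smul, ContinuousMultilinearMap.map_update_smul,
    ContinuousMultilinearMap.map_update_smul]
  rfl

end PartPB3

section PartPB4
open scoped ContDiff Topology ENNReal
open MeasureTheory

theorem integrableOn_of_compact {l : ℕ} {Δ K : Set (Fin l → ℝ)} (hΔ : IsOpen Δ) (hK : IsCompact K)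
    (hKΔ : K ⊆ Δ) (f : (Fin l → ℝ) → ℝ) (hf : ContinuousOn f Δ) (hz : ∀ x ∈ Δ, x ∉ K → f x = 0) :
    IntegrableOn f Δ := by
  have h1 : IntegrableOn f K := (hf.mono hKΔ).integrableOn_compact hK
  exact h1.of_forall_sdiff_eq_zero hΔ.measurableSet (fun x hx => hz x hx.1 hx.2)

theorem grow_comp {l : ℕ} (f : (Fin l → ℝ) → ℝ) (h : ℝ → ℝ) (h' : ℝ) (v : ℝ) (x : Fin l → ℝ)
    (hf : DifferentiableAt ℝ f x) (hh : HasDerivAt h h' (f x - v)) :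
    HasFDerivAt (fun y => h (f y - v)) (h' • fderiv ℝ f x) x ∧ grow (fun y => h (f y - v)) x = h' • grow f x := by
  have h1 : HasFDerivAt (fun y => h (f y - v)) (h' • fderiv ℝ f x) x :=
    hh.comp_hasFDerivAt x (hf.hasFDerivAt.sub_const v)
  refine ⟨h1, ?_⟩
  funext m
  simp only [grow, h1.fderiv]
  rfl

set_option maxHeartbeats 1000000 in
theorem rolle {l : ℕ} {Δ : Set (Fin l → ℝ)} (hΔ : IsOpen Δ) (G : Fin l → (Fin l → ℝ) → ℝ)
    (hG : ∀ i, ContDiffOn ℝ ∞ (G i) Δ) (i0 : Fin l) (q : (Fin l → ℝ) → ℝ) (hq : ContDiffOn ℝ ∞ q Δ)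
    (hq0 : ∀ x ∈ Δ, 0 < q x) (hqc : ∀ ε, 0 < ε → IsCompact {x | x ∈ Δ ∧ ε ≤ q x})
    (J : (Fin l → ℝ) → ℝ) (hJ : ContDiffOn ℝ ∞ J Δ) (κ : (Fin l → ℝ) → ℝ) (hκ : ∀ x ∈ Δ, 0 < κ x)
    (hJκ : ∀ x ∈ Δ, J x = κ x * (jac G x).det) (B1 B2 : ℝ)
    (hB1 : CB Δ (Function.update G i0 J) B1) (hB2 : CB Δ (Function.update G i0 q) B2)
    (α β : ℝ) (hα : 0 ≤ α) (hα1 : α ≤ 1) (hβ : 0 ≤ β) (hβ1 : β ≤ 1) :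
    ∀ᵐ v : Fin l → ℝ, ∀ T : Finset (Fin l → ℝ), (∀ x ∈ T, x ∈ Δ ∧ ∀ i, G i x = v i) →
      ∑ x ∈ T, (if 0 < J x then β else α) ≤ (α + β) / 2 * B1 + B2 / 2 := by
  classical
  filter_upwards [sard Δ hΔ G hG] with v hv T hT
  have hdet : ∀ x ∈ T, (jac G x).det ≠ 0 := fun x hx => hv x (hT x hx).1 (hT x hx).2
  have hJ0 : ∀ x ∈ T, 0 < |J x| := fun x hx => by
    rw [hJκ x (hT x hx).1]
    exact abs_pos.2 (mul_ne_zero (hκ x (hT x hx).1).ne' (hdet x hx))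
  -- choose δ and ε
  obtain ⟨δ, hδT, hδ⟩ : ∃ δ : ℝ, (∀ x ∈ T, δ < |J x|) ∧ 0 < δ := by
    have : ∀ᶠ δ in 𝓝[>] (0:ℝ), ∀ x ∈ T, δ < |J x| := by
      rw [Filter.eventually_all_finset]
      intro x hx
      exact eventually_nhdsWithin_of_eventually_nhds (eventually_lt_nhds (hJ0 x hx))
    obtain ⟨δ, h1, h2⟩ := (this.and self_mem_nhdsWithin).exists
    exact ⟨δ, h1, h2⟩
  obtain ⟨ε, hεT, hε⟩ : ∃ δ : ℝ, (∀ x ∈ T, 2 * δ < q x) ∧ 0 < δ := by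
    have : ∀ᶠ δ in 𝓝[>] (0:ℝ), ∀ x ∈ T, δ < q x / 2 := by
      rw [Filter.eventually_all_finset]
      intro x hx
      exact eventually_nhdsWithin_of_eventually_nhds (eventually_lt_nhds (half_pos (hq0 x (hT x hx).1)))
    obtain ⟨δ, h1, h2⟩ := (this.and self_mem_nhdsWithin).exists
    exact ⟨δ, fun x hx => by linarith [h1 x hx], h2⟩
  set Φ : (Fin l → ℝ) → (Fin l → ℝ) := fun x i => G i x with hΦ
  -- neighborhoods
  obtain ⟨U, hU, hUd⟩ := T.finite_toSet.t2_separation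
  have hO : ∀ x : T, ∃ O : Set (Fin l → ℝ), IsOpen O ∧ x.1 ∈ O ∧ O ⊆ Δ ∧ O ⊆ U x ∧ Set.InjOn Φ O ∧
      IsOpen (Φ '' O) ∧ ∀ y ∈ O, 2 * ε < q y ∧ δ < |J y| ∧ 0 < J y * J x := by
    rintro ⟨x, hx⟩
    have hxΔ := (hT x hx).1
    obtain ⟨e, he, hee⟩ := loc_inv Δ hΔ G hG x hxΔ (hdet x hx)
    have hqO : IsOpen (Δ ∩ q ⁻¹' Set.Ioi (2 * ε)) := hq.continuousOn.isOpen_inter_preimage hΔ isOpen_Ioi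
    have hJO : IsOpen (Δ ∩ (fun y => |J y|) ⁻¹' Set.Ioi δ) :=
      hJ.continuousOn.abs.isOpen_inter_preimage hΔ isOpen_Ioi
    have hJO' : IsOpen (Δ ∩ (fun y => J y * J x) ⁻¹' Set.Ioi 0) :=
      (hJ.continuousOn.mul continuousOn_const).isOpen_inter_preimage hΔ isOpen_Ioi
    let O := e.source ∩ U x ∩ (Δ ∩ q ⁻¹' Set.Ioi (2 * ε)) ∩ (Δ ∩ (fun y => |J y|) ⁻¹' Set.Ioi δ)
      ∩ (Δ ∩ (fun y => J y * J x) ⁻¹' Set.Ioi 0)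
    have hOo : IsOpen O := (((e.open_source.inter (hU x).2).inter hqO).inter hJO).inter hJO'
    have hOe : O ⊆ e.source := fun y hy => hy.1.1.1.1
    refine ⟨O, hOo, ⟨⟨⟨⟨he, (hU x).1⟩, hxΔ, hεT x hx⟩, hxΔ, hδT x hx⟩, hxΔ, ?_⟩, fun y hy => hy.2.1,
      fun y hy => hy.1.1.1.2, ?_, ?_, fun y hy => ⟨hy.1.1.2.2, hy.1.2.2, hy.2.2⟩⟩
    · exact mul_self_pos.2 (abs_pos.1 (hJ0 x hx))
    · have := e.injOn.mono hOe
      rwa [hee] at this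
    · have := e.isOpen_image_of_subset_source hOo hOe
      rwa [hee] at this
  choose O hO1 hO2 hO3 hO4 hO5 hO6 hO7 using hO
  obtain ⟨η, hηT, hη⟩ : ∃ η : ℝ, (∀ x : T, Metric.ball v η ⊆ Φ '' O x) ∧ 0 < η := by
    have : ∀ᶠ η in 𝓝[>] (0:ℝ), ∀ x : T, Metric.ball v η ⊆ Φ '' O x := by
      rw [Filter.eventually_all]
      intro x
      have hmem : v ∈ Φ '' O x := ⟨x.1, hO2 x, funext (hT x.1 x.2).2⟩
      obtain ⟨r, hr, hrs⟩ := Metric.isOpen_iff.1 (hO6 x) v hmem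
      have h1 : ∀ᶠ η in 𝓝[>] (0:ℝ), η < r := eventually_nhdsWithin_of_eventually_nhds (eventually_lt_nhds hr)
      filter_upwards [h1] with η hη
      exact (Metric.ball_subset_ball hη.le).trans hrs
    obtain ⟨δ, h1, h2⟩ := (this.and self_mem_nhdsWithin).exists
    exact ⟨δ, h1, h2⟩
  -- gadgets
  obtain ⟨b, h, hbc, hhc, hder, hb0, hbz, hbint, hbi, hhabs, -, -⟩ := bump_exists η hη
  obtain ⟨θ', θ, hθ'c, hθc, hθd, hθ'0, hθ'i, hθ'int, hθabs, hθs, hθr, hθl⟩ :=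
    theta_exists δ hδ α β hα hα1 hβ hβ1
  obtain ⟨χ', χ0, hχ'c, hχc, hχd, hχ'0, hχ'z, hχ'i, hχ'int, hχ01, hχl, hχr⟩ := step_exists ε hε
  set K : Set (Fin l → ℝ) := {x | x ∈ Δ ∧ ε ≤ q x} with hKdef
  have hK : IsCompact K := hqc ε hε
  have hKΔ : K ⊆ Δ := fun x hx => hx.1
  let H : Fin l → (Fin l → ℝ) → ℝ := fun i y => h (G i y - v i)
  let w0 : (Fin l → ℝ) → ℝ := fun y => θ (J y - 0) * h (G i0 y - v i0) * χ0 (q y - ε)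
  let w : (Fin l → ℝ) → ℝ := Δ.indicator w0
  have hHs : ∀ i, ContDiffOn ℝ ∞ (H i) Δ := fun i =>
    hhc.comp_contDiffOn ((hG i).sub contDiffOn_const)
  have hw0s : ContDiffOn ℝ ∞ w0 Δ :=
    ((hθc.comp_contDiffOn (hJ.sub contDiffOn_const)).mul (hHs i0)).mul
      (hχc.comp_contDiffOn (hq.sub contDiffOn_const))
  have hws : ContDiffOn ℝ ∞ w Δ := hw0s.congr fun x hx => Set.indicator_of_mem hx _
  have hwK : ∀ x, x ∉ K → w x = 0 := by
    intro x hx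
    by_cases hxΔ : x ∈ Δ
    · simp only [w, Set.indicator_of_mem hxΔ, w0]
      rw [hχl (q x - ε)]
      · ring
      · by_contra hlt
        push Not at hlt
        exact hx ⟨hxΔ, by linarith⟩
    · exact Set.indicator_of_notMem hxΔ _
  have hst := stokes hΔ H hHs i0 w hws K hK hKΔ hwK
  let Pe : (Fin l → ℝ) → ℝ := fun x => ∏ i ∈ Finset.univ.erase i0, b (G i x - v i)
  let t1 : (Fin l → ℝ) → ℝ := fun x => Pe x * (θ' (J x) * h (G i0 x - v i0) * χ0 (q x - ε)) *
    (jac (Function.update G i0 J) x).det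
  let t2 : (Fin l → ℝ) → ℝ := fun x => Pe x * (θ (J x) * b (G i0 x - v i0) * χ0 (q x - ε)) *
    (jac G x).det
  let t3 : (Fin l → ℝ) → ℝ := fun x => Pe x * (θ (J x) * h (G i0 x - v i0) * χ' (q x - ε)) *
    (jac (Function.update G i0 q) x).det
  have hexp : ∀ x ∈ Δ, (jac (Function.update H i0 w) x).det = t1 x + t2 x + t3 x := by
    intro x hx
    rw [det_jac_update]
    have hgH : (fun i => grow (H i) x) = fun i => b (G i x - v i) • grow (G i) x := by
      funext i
      exact (grow_comp (G i) h _ (v i) x (diffAt_of hΔ (hG i) hx) (hder _)).2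
    have hgw : grow w x = (θ' (J x) * h (G i0 x - v i0) * χ0 (q x - ε)) • grow J x +
        (θ (J x) * b (G i0 x - v i0) * χ0 (q x - ε)) • grow (G i0) x +
        (θ (J x) * h (G i0 x - v i0) * χ' (q x - ε)) • grow q x := by
      have e1 := (grow_comp J θ _ 0 x (diffAt_of hΔ hJ hx) (hθd _)).1
      have e2 := (grow_comp (G i0) h _ (v i0) x (diffAt_of hΔ (hG i0) hx) (hder _)).1
      have e3 := (grow_comp q χ0 _ ε x (diffAt_of hΔ hq hx) (hχd _)).1
      have e4 : HasFDerivAt w0 _ x := (e1.mul e2).mul e3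
      have e5 : w =ᶠ[𝓝 x] w0 := by
        filter_upwards [hΔ.mem_nhds hx] with y hy
        exact Set.indicator_of_mem hy _
      have e6 := e4.congr_of_eventuallyEq e5
      funext m
      simp only [grow, e6.fderiv, sub_zero]
      simp [grow]
      ring
    rw [hgH, hgw, det_smul_update, det_update_lin]
    have hG0 : detCM l (Function.update (fun i => grow (G i) x) i0 (grow (G i0) x)) = (jac G x).det := by
      rw [← det_jac_update, Function.update_eq_self]
    rw [hG0, ← det_jac_update, ← det_jac_update]
    simp only [t1, t2, t3, Pe]
    ring
  -- continuity
  have hPec : ContinuousOn Pe Δ := continuousOn_finsetProd _ fun i _ =>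
    hbc.continuous.comp_continuousOn ((hG i).continuousOn.sub continuousOn_const)
  have chi : ContinuousOn (fun x => h (G i0 x - v i0)) Δ := (hHs i0).continuousOn
  have cbi : ContinuousOn (fun x => b (G i0 x - v i0)) Δ :=
    hbc.continuous.comp_continuousOn ((hG i0).continuousOn.sub continuousOn_const)
  have cθ : ContinuousOn (fun x => θ (J x)) Δ := hθc.continuous.comp_continuousOn hJ.continuousOn
  have cθ' : ContinuousOn (fun x => θ' (J x)) Δ := hθ'c.continuous.comp_continuousOn hJ.continuousOn
  have cχ : ContinuousOn (fun x => χ0 (q x - ε)) Δ :=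
    hχc.continuous.comp_continuousOn (hq.continuousOn.sub continuousOn_const)
  have cχ' : ContinuousOn (fun x => χ' (q x - ε)) Δ :=
    hχ'c.continuous.comp_continuousOn (hq.continuousOn.sub continuousOn_const)
  have hupd : ∀ f : (Fin l → ℝ) → ℝ, ContDiffOn ℝ ∞ f Δ → ∀ i, ContDiffOn ℝ ∞ (Function.update G i0 f i) Δ := by
    intro f hf i
    by_cases hi : i = i0
    · subst hi; simpa using hf
    · simpa [Function.update_of_ne hi] using hG i
  have cd : ContinuousOn (fun x => (jac G x).det) Δ := (contOn_jac Δ hΔ G hG).continuousOn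
  have cdJ := (contOn_jac Δ hΔ _ (hupd J hJ)).continuousOn
  have cdq := (contOn_jac Δ hΔ _ (hupd q hq)).continuousOn
  have hzχ : ∀ x ∈ Δ, x ∉ K → χ0 (q x - ε) = 0 ∧ χ' (q x - ε) = 0 := by
    intro x hx hxK
    have : q x - ε ≤ 0 := by
      by_contra hlt
      push Not at hlt
      exact hxK ⟨hx, by linarith⟩
    exact ⟨hχl _ this, hχ'z _ this⟩
  have i1 : IntegrableOn t1 Δ := integrableOn_of_compact hΔ hK hKΔ t1
    ((hPec.mul ((cθ'.mul chi).mul cχ)).mul cdJ) (fun x hx hxK => by simp only [t1, (hzχ x hx hxK).1]; ring)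
  have i2 : IntegrableOn t2 Δ := integrableOn_of_compact hΔ hK hKΔ t2
    ((hPec.mul ((cθ.mul cbi).mul cχ)).mul cd) (fun x hx hxK => by simp only [t2, (hzχ x hx hxK).1]; ring)
  have i3 : IntegrableOn t3 Δ := integrableOn_of_compact hΔ hK hKΔ t3
    ((hPec.mul ((cθ.mul chi).mul cχ')).mul cdq) (fun x hx hxK => by simp only [t3, (hzχ x hx hxK).2]; ring)
  rw [setIntegral_congr_fun hΔ.measurableSet hexp] at hst
  have hst' : (∫ x in Δ, t1 x) + (∫ x in Δ, t2 x) + (∫ x in Δ, t3 x) = 0 := by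
    rw [← hst]
    have a1 : ∫ x in Δ, (t1 x + t2 x) = (∫ x in Δ, t1 x) + (∫ x in Δ, t2 x) := integral_add i1 i2
    have a2 : ∫ x in Δ, (t1 x + t2 x + t3 x) = (∫ x in Δ, (t1 x + t2 x)) + (∫ x in Δ, t3 x) :=
      integral_add (i1.add i2) i3
    rw [a2, a1]
  have hPe0 : ∀ x, 0 ≤ Pe x := fun x => Finset.prod_nonneg fun i _ => hb0 _
  -- upper bounds
  have bnd : ∀ (F : (Fin l → ℝ) → ℝ) (hF : ContDiffOn ℝ ∞ F Δ) (B : ℝ) (hB : CB Δ (Function.update G i0 F) B)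
      (d : ℝ → ℝ) (hdc : Continuous d) (hd0 : ∀ s, 0 ≤ d s) (hdi : Integrable d)
      (t : (Fin l → ℝ) → ℝ) (ht : ∀ x ∈ Δ, |t x| ≤ |(jac (Function.update G i0 F) x).det| * (1/2 * (Pe x * d (F x)))),
      |∫ x in Δ, t x| ≤ 1/2 * B * ∫ s, d s := by
    intro F hF B hB d hdc hd0 hdi t ht
    have := area_prod Δ hΔ (Function.update G i0 F) (hupd F hF) B (CB_nonneg hB) hB
      (Function.update (fun i s => b (s - v i)) i0 d) ?_ ?_ ?_ t ?_
    · refine this.trans (le_of_eq ?_)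
      rw [← Finset.mul_prod_erase _ _ (Finset.mem_univ i0)]
      simp only [Function.update_self]
      rw [Finset.prod_eq_one, mul_one]
      intro i hi
      rw [Function.update_of_ne (Finset.ne_of_mem_erase hi), integral_sub_right_eq_self (fun s => b s), hbi]
    · intro i
      by_cases hi : i = i0
      · subst hi; simpa using hdc
      · rw [Function.update_of_ne hi]
        exact hbc.continuous.comp (continuous_id.sub continuous_const)
    · intro i s
      by_cases hi : i = i0
      · subst hi; simpa using hd0 s
      · rw [Function.update_of_ne hi]; exact hb0 _
    · intro i
      by_cases hi : i = i0
      · subst hi; simpa using hdi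
      · rw [Function.update_of_ne hi]
        exact hbint.comp_sub_right (v i)
    · intro x hx
      refine (ht x hx).trans (le_of_eq ?_)
      rw [← Finset.mul_prod_erase _ _ (Finset.mem_univ i0)]
      simp only [Function.update_self]
      congr 2
      rw [mul_comm]
      congr 1
      refine Finset.prod_congr rfl fun i hi => ?_
      rw [Function.update_of_ne (Finset.ne_of_mem_erase hi), Function.update_of_ne (Finset.ne_of_mem_erase hi)]
  have u1 := bnd J hJ B1 hB1 θ' hθ'c.continuous hθ'0 hθ'i t1 (by
    intro x hx
    simp only [t1]
    rw [abs_mul, abs_mul, abs_mul, abs_mul, abs_of_nonneg (hPe0 x), abs_of_nonneg (hθ'0 _),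
      abs_of_nonneg (hχ01 _).1, mul_comm]
    apply mul_le_mul_of_nonneg_left _ (abs_nonneg _)
    have e1 : |h (G i0 x - v i0)| * χ0 (q x - ε) ≤ 1/2 * 1 :=
      mul_le_mul (hhabs _) (hχ01 _).2 (hχ01 _).1 (by norm_num)
    have e2 : 0 ≤ Pe x * θ' (J x) := mul_nonneg (hPe0 x) (hθ'0 _)
    nlinarith)
  have u3 := bnd q hq B2 hB2 (fun s => χ' (s - ε)) (hχ'c.continuous.comp (continuous_id.sub continuous_const))
    (fun s => hχ'0 _) (hχ'i.comp_sub_right ε) t3 (by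
    intro x hx
    simp only [t3]
    rw [abs_mul, abs_mul, abs_mul, abs_mul, abs_of_nonneg (hPe0 x), abs_of_nonneg (hχ'0 _), mul_comm]
    apply mul_le_mul_of_nonneg_left _ (abs_nonneg _)
    have e1 : |θ (J x)| * |h (G i0 x - v i0)| ≤ 1 * (1/2) :=
      mul_le_mul (hθabs _) (hhabs _) (abs_nonneg _) (by norm_num)
    have e2 : 0 ≤ Pe x * χ' (q x - ε) := mul_nonneg (hPe0 x) (hχ'0 _)
    nlinarith)
  rw [hθ'int] at u1
  rw [integral_sub_right_eq_self (fun s => χ' s), hχ'int] at u3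
  -- lower bound
  have ht2 : ∀ x ∈ Δ, 0 ≤ t2 x := by
    intro x hx
    have e1 : 0 ≤ θ (J x) * (jac G x).det := by
      have := hθs (J x)
      rw [hJκ x hx] at this ⊢
      have hk := hκ x hx
      by_contra hneg
      push Not at hneg
      nlinarith
    have e2 : 0 ≤ Pe x * b (G i0 x - v i0) * χ0 (q x - ε) :=
      mul_nonneg (mul_nonneg (hPe0 x) (hb0 _)) (hχ01 _).1
    have : t2 x = (θ (J x) * (jac G x).det) * (Pe x * b (G i0 x - v i0) * χ0 (q x - ε)) := by
      simp only [t2]; ring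
    rw [this]; exact mul_nonneg e1 e2
  have low : ∑ x : T, ∫ y in O x, t2 y ≤ ∫ x in Δ, t2 x := by
    have hdis : Pairwise (Function.onFun Disjoint O) := by
      intro x y hxy
      exact (hUd x.2 y.2 (fun h' => hxy (Subtype.ext h'))).mono (hO4 x) (hO4 y)
    have e1 := integral_iUnion_fintype (μ := volume) (f := t2) (s := O) (fun x => (hO1 x).measurableSet) hdis
      (fun x => i2.mono_set (hO3 x))
    rw [← e1]
    apply setIntegral_mono_set i2
    · exact (ae_restrict_iff' hΔ.measurableSet).2 (Filter.Eventually.of_forall ht2)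
    · exact (Set.iUnion_subset hO3).eventuallyLE
  have each : ∀ x : T, ∫ y in O x, t2 y = if 0 < J x then β else α := by
    intro x
    let Om : (Fin l → ℝ) → ℝ := fun u => ∏ i, b (u i - v i)
    have hOmint : ∫ u, Om u = 1 := by
      simp only [Om]
      rw [integral_fintype_prod_volume_eq_prod (fun i s => b (s - v i))]
      refine Finset.prod_eq_one fun i _ => ?_
      rw [integral_sub_right_eq_self (fun s => b s), hbi]
    have hcv := integral_image_eq_integral_abs_det_fderiv_smul volume (hO1 x).measurableSet
      (f := Φ) (f' := fun y => fderiv ℝ Φ y) (fun y hy => (differentiableAt_pi.2 fun i =>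
        diffAt_of hΔ (hG i) (hO3 x hy)).hasFDerivAt.hasFDerivWithinAt) (hO5 x) Om
    rw [setIntegral_eq_integral_of_forall_compl_eq_zero, hOmint] at hcv
    · have : ∫ y in O x, t2 y = (if 0 < J x then β else α) * ∫ y in O x, |(fderiv ℝ Φ y).det| • Om (Φ y) := by
        rw [← integral_const_mul]
        apply setIntegral_congr_fun (hO1 x).measurableSet
        intro y hy
        obtain ⟨y1, y2, y3⟩ := hO7 x y hy
        have hyΔ := hO3 x hy
        simp only [smul_eq_mul]
        rw [hΦ, fderiv_det_jac G y (fun i => diffAt_of hΔ (hG i) hyΔ)]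
        have eχ : χ0 (q y - ε) = 1 := hχr _ (by linarith)
        have eOm : Om (fun i => G i y) = b (G i0 y - v i0) * Pe y := by
          simp only [Om, Pe]
          rw [← Finset.mul_prod_erase _ _ (Finset.mem_univ i0)]
        have hky := hκ y hyΔ
        have hJy := hJκ y hyΔ
        simp only [t2]
        rw [eχ, eOm]
        split_ifs with hpos
        · have hJypos : 0 < J y := by
            by_contra hn
            push Not at hn
            nlinarith
          have hdp : 0 < (jac G y).det := by
            rw [hJy] at hJypos
            exact pos_of_mul_pos_right hJypos hky.le
          rw [abs_of_pos hJypos] at y2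
          rw [hθr _ y2.le, abs_of_pos hdp]; ring
        · have hxn : J x < 0 := lt_of_le_of_ne (not_lt.1 hpos) (abs_pos.1 (hJ0 x.1 x.2))
          have hJyneg : J y < 0 := by
            by_contra hn
            push Not at hn
            nlinarith
          have hdn : (jac G y).det < 0 := by
            by_contra hn
            push Not at hn
            have := mul_nonneg hky.le hn
            linarith
          rw [abs_of_neg hJyneg] at y2
          rw [hθl _ (by linarith), abs_of_neg hdn]; ring
      rw [this, ← hcv, mul_one]
    · intro u hu
      have : u ∉ Metric.ball v η := fun h' => hu (hηT x h')
      rw [Metric.mem_ball, dist_pi_lt_iff hη] at this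
      push Not at this
      obtain ⟨i, hi⟩ := this
      exact Finset.prod_eq_zero (Finset.mem_univ i) (hbz _ (by rwa [Real.dist_eq] at hi))
  have hsum : ∑ x ∈ T, (if 0 < J x then β else α) = ∑ x : T, (if 0 < J x then β else α) :=
    (Finset.sum_coe_sort T (fun x => if 0 < J x then β else α)).symm
  rw [hsum, ← Finset.sum_congr rfl fun x _ => each x]
  refine low.trans ?_
  have n1 := abs_le.1 u1
  have n3 := abs_le.1 u3
  linarith [n1.1, n3.1]

end PartPB4

section PartPC1
open scoped ContDiff Topology ENNReal
open MeasureTheory MvPolynomial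

theorem fderiv_mvPoly {l : ℕ} (p : MvPolynomial (Fin l) ℝ) (x : Fin l → ℝ) (m : Fin l) :
    fderiv ℝ (fun x : Fin l → ℝ => eval x p) x (Pi.single m 1) = eval x (pderiv m p) := by
  have hd : ∀ p : MvPolynomial (Fin l) ℝ, DifferentiableAt ℝ (fun x : Fin l → ℝ => eval x p) x := fun p =>
    (contDiff_mvPoly p).contDiffAt.differentiableAt (by simp)
  induction p using MvPolynomial.induction_on with
  | C a => simp
  | add p q hp hq =>
    simp only [map_add]
    rw [fderiv_fun_add (hd p) (hd q), ← hp, ← hq]; rfl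
  | mul_X p i hp =>
    simp only [map_mul, eval_X, Derivation.leibniz, pderiv_X, smul_eq_mul, map_add]
    rw [fderiv_fun_mul (hd p) (differentiableAt_apply i x)]
    rw [show fderiv ℝ (fun x : Fin l → ℝ => x i) x = ContinuousLinearMap.proj i from
      (ContinuousLinearMap.proj (R := ℝ) (φ := fun _ : Fin l => ℝ) i).fderiv]
    simp only [add_apply, smul_apply, ContinuousLinearMap.proj_apply,
      smul_eq_mul, hp]
    by_cases h : i = m
    · subst h; simp
    · simp [Pi.single_apply, h]

theorem totalDegree_pderiv_le {l : ℕ} (p : MvPolynomial (Fin l) ℝ) (m : Fin l) (d : ℕ)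
    (h : p.totalDegree ≤ d + 1) : (pderiv m p).totalDegree ≤ d := by
  rw [p.as_sum, map_sum]
  refine totalDegree_finsetSum_le fun s hs => ?_
  rw [pderiv_monomial]
  have h1 := (le_totalDegree hs).trans h
  by_cases h0 : s m = 0
  · simp [h0]
  refine (totalDegree_monomial_le _ _).trans ?_
  have hle : Finsupp.single m 1 ≤ s := by
    rw [Finsupp.single_le_iff]; omega
  have h2 : s = (s - Finsupp.single m 1) + Finsupp.single m 1 := (tsub_add_cancel_of_le hle).symm
  rw [h2, Finsupp.sum_add_index' (by simp) (by simp)] at h1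
  simp only [Finsupp.sum_single_index] at h1
  simp only [Finsupp.sum] at h1 ⊢
  first | omega | (simp [Finsupp.degree_apply, Finsupp.sum] at *; omega)

theorem totalDegree_det_le {l : ℕ} (M : Matrix (Fin l) (Fin l) (MvPolynomial (Fin l) ℝ)) (e : Fin l → ℕ)
    (h : ∀ i m, (M i m).totalDegree ≤ e i) : M.det.totalDegree ≤ ∑ i, e i := by
  rw [← Matrix.det_transpose, Matrix.det_apply]
  refine totalDegree_finsetSum_le fun σ _ => ?_
  refine (totalDegree_smul_le _ _).trans ?_
  refine (totalDegree_finsetProd _ _).trans ?_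
  exact Finset.sum_le_sum fun i _ => h _ _

noncomputable def rowf {ι : Type*} [Fintype ι] {l : ℕ} (p : ι → MvPolynomial (Fin l) ℝ)
    (P : MvPolynomial (Fin l) ℝ) (β : ι → ℝ) : (Fin l → ℝ) → ℝ :=
  fun x => eval x P + ∑ j, β j * Real.log (eval x (p j))

def Dlt {ι : Type*} {l : ℕ} (p : ι → MvPolynomial (Fin l) ℝ) : Set (Fin l → ℝ) :=
  {x | ∀ j, 0 < eval x (p j)}

theorem isOpen_Dlt {ι : Type*} [Fintype ι] {l : ℕ} (p : ι → MvPolynomial (Fin l) ℝ) : IsOpen (Dlt p) := by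
  have : Dlt p = ⋂ j, {x | 0 < eval x (p j)} := by ext; simp [Dlt]
  rw [this]
  exact isOpen_iInter_of_finite fun j => isOpen_lt continuous_const (contDiff_mvPoly (p j)).continuous

theorem contDiffOn_rowf {ι : Type*} [Fintype ι] {l : ℕ} (p : ι → MvPolynomial (Fin l) ℝ)
    (P : MvPolynomial (Fin l) ℝ) (β : ι → ℝ) : ContDiffOn ℝ ∞ (rowf p P β) (Dlt p) := by
  unfold rowf
  refine (contDiff_mvPoly P).contDiffOn.add (ContDiffOn.sum fun j _ => contDiffOn_const.mul ?_)
  exact (contDiff_mvPoly (p j)).contDiffOn.log fun x hx => (hx j).ne'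

theorem grow_rowf {ι : Type*} [Fintype ι] {l : ℕ} (p : ι → MvPolynomial (Fin l) ℝ)
    (P : MvPolynomial (Fin l) ℝ) (β : ι → ℝ) (x : Fin l → ℝ) (hx : x ∈ Dlt p) :
    grow (rowf p P β) x = (fun m => eval x (pderiv m P)) +
      ∑ j, (β j / eval x (p j)) • (fun m => eval x (pderiv m (p j))) := by
  have hd : ∀ p : MvPolynomial (Fin l) ℝ, DifferentiableAt ℝ (fun x : Fin l → ℝ => eval x p) x := fun p =>
    (contDiff_mvPoly p).contDiffAt.differentiableAt (by simp)
  ext m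
  simp only [grow]
  unfold rowf
  rw [fderiv_fun_add (hd P) (DifferentiableAt.fun_sum fun j _ => ((hd (p j)).log (hx j).ne').const_mul _)]
  rw [fderiv_fun_sum (fun j _ => ((hd (p j)).log (hx j).ne').const_mul _)]
  simp only [Pi.add_apply, Finset.sum_apply, Pi.smul_apply, smul_eq_mul, add_apply, sum_apply, fderiv_mvPoly]
  congr 1
  refine Finset.sum_congr rfl fun j _ => ?_
  rw [fderiv_const_mul ((hd (p j)).log (hx j).ne'), fderiv.log (hd (p j)) (hx j).ne']
  simp only [smul_apply, smul_eq_mul, fderiv_mvPoly]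
  ring

theorem jac_det_eq {l : ℕ} (G : Fin l → (Fin l → ℝ) → ℝ) (x : Fin l → ℝ) :
    (jac G x).det = detCM l (fun i => grow (G i) x) := rfl

theorem deg_lemma {ι : Type*} [Fintype ι] {l : ℕ} (p : ι → MvPolynomial (Fin l) ℝ)
    (hp : ∀ j, (p j).totalDegree ≤ 1) (P : Fin l → MvPolynomial (Fin l) ℝ) (β : Fin l → ι → ℝ)
    (A : Finset (Fin l)) (hA : ∀ i ∈ A, P i = 0) (hA' : ∀ i ∉ A, β i = 0) (d : Fin l → ℕ)
    (hd : ∀ i ∉ A, 1 ≤ d i) (hP : ∀ i ∉ A, (P i).totalDegree ≤ d i) (m : ℕ)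
    (hcard : Fintype.card ι = m + l) :
    ∃ D : MvPolynomial (Fin l) ℝ, D.totalDegree ≤ m + ∑ i ∈ Aᶜ, d i ∧ ∀ x ∈ Dlt p,
      eval x D = eval x (∏ j, p j) * (jac (fun i => rowf p (P i) (β i)) x).det := by
  classical
  let cf : Fin l → Option ι → (Fin l → ℝ) → ℝ := fun i o x => o.elim 1 (fun j => β i j / eval x (p j))
  let pv : Fin l → Option ι → MvPolynomial (Fin l) ℝ := fun i o => o.elim (P i) p
  let po : Option ι → MvPolynomial (Fin l) ℝ := fun o => o.elim 1 p
  have key : ∀ r : Fin l → Option ι, ∃ D : MvPolynomial (Fin l) ℝ, D.totalDegree ≤ m + ∑ i ∈ Aᶜ, d i ∧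
      ∀ x ∈ Dlt p, eval x D = eval x (∏ j, p j) * ((∏ i, cf i (r i) x) *
        detCM l (fun i m => eval x (pderiv m (pv i (r i))))) := by
    intro r
    by_cases h1 : ∃ i ∈ A, r i = none
    · obtain ⟨i, hi, hr⟩ := h1
      refine ⟨0, by simp, fun x hx => ?_⟩
      have : detCM l (fun i m => eval x (pderiv m (pv i (r i)))) = 0 := by
        apply (detCM l).map_coord_zero i
        ext m
        simp [pv, hr, hA i hi]
      rw [this]; simp
    push Not at h1
    by_cases h2 : ∃ i ∉ A, r i ≠ none
    · obtain ⟨i, hi, hr⟩ := h2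
      refine ⟨0, by simp, fun x hx => ?_⟩
      obtain ⟨j, hj⟩ := Option.ne_none_iff_exists'.1 hr
      have : ∏ i, cf i (r i) x = 0 := Finset.prod_eq_zero (Finset.mem_univ i) (by simp [cf, hj, hA' i hi])
      rw [this]; simp
    push Not at h2
    by_cases h3 : Set.InjOn r A
    swap
    · rw [Set.InjOn] at h3
      push Not at h3
      obtain ⟨i, hi, i', hi', hr, hne⟩ := h3
      refine ⟨0, by simp, fun x hx => ?_⟩
      have : detCM l (fun i m => eval x (pderiv m (pv i (r i)))) = 0 := by
        rw [detCM_apply]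
        apply Matrix.det_zero_of_row_eq hne
        ext m
        have := h1 i hi
        obtain ⟨j, hj⟩ := Option.ne_none_iff_exists'.1 this
        simp [pv, hj, ← hr]
      rw [this]; simp
    -- main case
    let D : MvPolynomial (Fin l) ℝ := C (∏ i ∈ A, (r i).elim 1 (β i)) * (∏ o ∈ (A.image r)ᶜ, po o) *
      Matrix.det (Matrix.of fun i m => pderiv m (pv i (r i)))
    refine ⟨D, ?_, fun x hx => ?_⟩
    · have e1 : (∏ o ∈ (A.image r)ᶜ, po o).totalDegree ≤ ∑ o ∈ (A.image r)ᶜ, o.elim 0 (fun _ => 1) := by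
        refine (totalDegree_finsetProd _ _).trans (Finset.sum_le_sum fun o _ => ?_)
        cases o with
        | none => simp [po]
        | some j => exact hp j
      have e2 : ∑ o ∈ (A.image r)ᶜ, o.elim 0 (fun _ => 1) + A.card = m + l := by
        have : A.card = ∑ o ∈ (A.image r), o.elim 0 (fun _ => 1) := by
          rw [Finset.sum_image h3, Finset.card_eq_sum_ones]
          refine Finset.sum_congr rfl fun i hi => ?_
          obtain ⟨j, hj⟩ := Option.ne_none_iff_exists'.1 (h1 i hi)
          simp [hj]
        rw [this, Finset.sum_compl_add_sum, Fintype.sum_option]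
        simp [hcard]
      have e3 : (Matrix.det (Matrix.of fun i m => pderiv m (pv i (r i)))).totalDegree ≤
          ∑ i, (if i ∈ A then 0 else d i - 1) := by
        apply totalDegree_det_le
        intro i m
        rw [Matrix.of_apply]
        apply totalDegree_pderiv_le
        split_ifs with hi
        · obtain ⟨j, hj⟩ := Option.ne_none_iff_exists'.1 (h1 i hi)
          simpa [pv, hj] using hp j
        · have := hP i hi
          have := hd i hi
          simp only [pv, h2 i hi, Option.elim]
          omega
      have e4 : ∑ i, (if i ∈ A then 0 else d i - 1) + Aᶜ.card = ∑ i ∈ Aᶜ, d i := by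
        rw [← Finset.sum_compl_add_sum A (fun i => if i ∈ A then 0 else d i - 1)]
        rw [Finset.sum_congr rfl (fun i hi => if_pos hi), Finset.sum_const_zero, add_zero,
          Finset.card_eq_sum_ones, ← Finset.sum_add_distrib]
        refine Finset.sum_congr rfl fun i hi => ?_
        rw [Finset.mem_compl] at hi
        have := hd i hi
        simp [hi]; omega
      have e5 := Finset.card_add_card_compl A
      rw [Fintype.card_fin] at e5
      refine (totalDegree_mul _ _).trans ?_
      refine (add_le_add_left (totalDegree_mul _ _) _).trans ?_
      rw [totalDegree_C]
      omega
    · have f1 : eval x (∏ j, p j) = (∏ o ∈ (A.image r)ᶜ, eval x (po o)) * ∏ i ∈ A, eval x (po (r i)) := by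
        rw [← Finset.prod_image (f := fun o => eval x (po o)) h3, Finset.prod_compl_mul_prod,
          Fintype.prod_option, map_prod]
        simp [po]
      have f2 : ∏ i, cf i (r i) x = ∏ i ∈ A, (((r i).elim 1 (β i)) / eval x (po (r i))) := by
        rw [← Finset.prod_compl_mul_prod A]
        rw [Finset.prod_eq_one, one_mul]
        · refine Finset.prod_congr rfl fun i hi => ?_
          obtain ⟨j, hj⟩ := Option.ne_none_iff_exists'.1 (h1 i hi)
          simp [cf, hj, po]
        · intro i hi
          rw [Finset.mem_compl] at hi
          simp [cf, h2 i hi]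
      have f3 : eval x (Matrix.det (Matrix.of fun i m => pderiv m (pv i (r i)))) =
          detCM l (fun i m => eval x (pderiv m (pv i (r i)))) := by
        rw [RingHom.map_det, detCM_apply]; rfl
      have f4 : ∏ i ∈ A, eval x (po (r i)) ≠ 0 := by
        refine Finset.prod_ne_zero_iff.2 fun i hi => ?_
        obtain ⟨j, hj⟩ := Option.ne_none_iff_exists'.1 (h1 i hi)
        simpa [po, hj] using (hx j).ne'
      rw [f1, f2]
      simp only [D, map_mul, eval_C, map_prod (eval x), f3]
      rw [Finset.prod_div_distrib]
      field_simp
  choose D hD1 hD2 using key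
  refine ⟨∑ r, D r, totalDegree_finsetSum_le fun r _ => hD1 r, fun x hx => ?_⟩
  rw [map_sum, Finset.sum_congr rfl (fun r _ => hD2 r x hx), ← Finset.mul_sum]
  congr 1
  rw [jac_det_eq]
  have : (fun i => grow (rowf p (P i) (β i)) x) =
      fun i => ∑ o : Option ι, cf i o x • (fun m => eval x (pderiv m (pv i o))) := by
    ext1 i
    rw [grow_rowf p (P i) (β i) x hx, Fintype.sum_option]
    simp [cf, pv]
  rw [this, ContinuousMultilinearMap.map_sum]
  refine Finset.sum_congr rfl fun r _ => ?_
  rw [ContinuousMultilinearMap.map_smul_univ, smul_eq_mul]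

end PartPC1

section PartPC2
open scoped ContDiff Topology ENNReal
open MeasureTheory MvPolynomial

theorem CB_mono {l : ℕ} {Δ : Set (Fin l → ℝ)} {G : Fin l → (Fin l → ℝ) → ℝ} {B B' : ℝ} (h : CB Δ G B)
    (hB : B ≤ B') : CB Δ G B' := by
  filter_upwards [h] with v hv T hT
  exact (hv T hT).trans hB

structure Sys {ι : Type*} [Fintype ι] {l : ℕ}
    (P : Fin l → MvPolynomial (Fin l) ℝ) (β : Fin l → ι → ℝ) (A : Finset (Fin l)) (d : Fin l → ℕ) : Prop where
  hA : ∀ i ∈ A, P i = 0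
  hA' : ∀ i ∉ A, β i = 0
  hd : ∀ i ∉ A, 1 ≤ d i
  hP : ∀ i ∉ A, (P i).totalDegree ≤ d i

theorem Sys.update {ι : Type*} [Fintype ι] {l : ℕ}
    {P : Fin l → MvPolynomial (Fin l) ℝ} {β : Fin l → ι → ℝ} {A : Finset (Fin l)} {d : Fin l → ℕ}
    (h : Sys P β A d) (a : Fin l) (ha : a ∈ A) (D : MvPolynomial (Fin l) ℝ) (e : ℕ) (he : 1 ≤ e)
    (hD : D.totalDegree ≤ e) :
    Sys (Function.update P a D) (Function.update β a 0) (A.erase a) (Function.update d a e) := by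
  constructor
  · intro i hi
    rw [Finset.mem_erase] at hi
    rw [Function.update_of_ne hi.1]; exact h.hA i hi.2
  all_goals
    intro i hi
    by_cases hia : i = a
    · subst hia; simp [he, hD]
    · have hiA : i ∉ A := fun hh => hi (Finset.mem_erase.2 ⟨hia, hh⟩)
      simp only [Function.update_of_ne hia]
      first | exact h.hA' i hiA | exact h.hd i hiA | exact h.hP i hiA

theorem rowf_update {ι : Type*} [Fintype ι] {l : ℕ} (p : ι → MvPolynomial (Fin l) ℝ)
    (P : Fin l → MvPolynomial (Fin l) ℝ) (β : Fin l → ι → ℝ) (a : Fin l) (D : MvPolynomial (Fin l) ℝ) :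
    (fun i => rowf p (Function.update P a D i) (Function.update β a 0 i)) =
      Function.update (fun i => rowf p (P i) (β i)) a (fun x => eval x D) := by
  ext1 i
  by_cases hia : i = a
  · subst hia
    ext x; simp [rowf]
  · simp [Function.update_of_ne hia]

noncomputable def FF (σ : ℝ) (r : ℕ) : ℝ := ∏ t ∈ Finset.range r, (2 ^ t * σ)

theorem FF_succ (σ : ℝ) (r : ℕ) : FF σ (r + 1) = σ * FF (2 * σ) r := by
  unfold FF
  rw [Finset.prod_range_succ', pow_zero, one_mul, mul_comm]
  congr 1
  refine Finset.prod_congr rfl fun t _ => ?_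
  ring

theorem compact_q {ι : Type*} [Fintype ι] {l : ℕ} (p : ι → MvPolynomial (Fin l) ℝ)
    (hK : IsCompact {x : Fin l → ℝ | ∀ j, 0 ≤ eval x (p j)}) (ε : ℝ) (hε : 0 < ε) :
    IsCompact {x | x ∈ Dlt p ∧ ε ≤ eval x (∏ j, p j)} := by
  have : {x | x ∈ Dlt p ∧ ε ≤ eval x (∏ j, p j)} = {x : Fin l → ℝ | ∀ j, 0 ≤ eval x (p j)} ∩
      {x | ε ≤ eval x (∏ j, p j)} := by
    ext x
    constructor
    · rintro ⟨h1, h2⟩; exact ⟨fun j => (h1 j).le, h2⟩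
    · rintro ⟨h1, h2⟩
      refine ⟨fun j => lt_of_le_of_ne (h1 j) fun h0 => ?_, h2⟩
      have h2' : ε ≤ eval x (∏ j, p j) := h2
      rw [map_prod, Finset.prod_eq_zero (Finset.mem_univ j) h0.symm] at h2'
      linarith
  rw [this]
  exact hK.inter_right (isClosed_le continuous_const (contDiff_mvPoly _).continuous)

theorem totalDegree_prod_p {ι : Type*} [Fintype ι] {l : ℕ} (p : ι → MvPolynomial (Fin l) ℝ)
    (hp : ∀ j, (p j).totalDegree ≤ 1) : (∏ j, p j).totalDegree ≤ Fintype.card ι := by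
  refine (totalDegree_finsetProd _ _).trans ?_
  refine (Finset.sum_le_sum fun j _ => hp j).trans ?_
  simp

theorem grow_q {ι : Type*} [Fintype ι] {l : ℕ} (p : ι → MvPolynomial (Fin l) ℝ) (x : Fin l → ℝ)
    (hx : x ∈ Dlt p) :
    grow (rowf p (∏ j, p j) 0) x = eval x (∏ j, p j) • grow (rowf p 0 1) x := by
  classical
  rw [grow_rowf p _ _ x hx, grow_rowf p _ _ x hx]
  ext m
  simp only [Pi.add_apply, Finset.sum_apply, Pi.smul_apply, smul_eq_mul, Pi.zero_apply, zero_div, zero_mul,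
    Finset.sum_const_zero, add_zero, map_zero, zero_add, Pi.one_apply, Finset.mul_sum]
  generalize (Finset.univ : Finset ι) = s
  induction s using Finset.induction_on with
  | empty => simp
  | insert a s has ih =>
    have := (hx a).ne'
    rw [Finset.prod_insert has, Derivation.leibniz, map_add, smul_eq_mul, smul_eq_mul, map_mul, map_mul, ih,
      Finset.sum_insert has, Finset.mul_sum, add_comm]
    simp only [map_mul]
    congr 1
    · field_simp
    · refine Finset.sum_congr rfl fun j _ => ?_
      ring

theorem prod_upd {l : ℕ} (d : Fin l → ℕ) (a : Fin l) (e : ℕ) (s : Finset (Fin l)) (h : a ∉ s) :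
    ∏ i ∈ s, ((Function.update d a e i : ℕ) : ℝ) = ∏ i ∈ s, (d i : ℝ) := by
  refine Finset.prod_congr rfl fun i hi => ?_
  rw [Function.update_of_ne]
  rintro rfl
  exact h hi

theorem Tq {ι : Type*} [Fintype ι] {l : ℕ} (p : ι → MvPolynomial (Fin l) ℝ)
    (hp : ∀ j, (p j).totalDegree ≤ 1) (hK : IsCompact {x : Fin l → ℝ | ∀ j, 0 ≤ eval x (p j)})
    (m : ℕ) (hm : 1 ≤ m) (hcard : Fintype.card ι = m + l) (r : ℕ) :
    ∀ (P : Fin l → MvPolynomial (Fin l) ℝ) (β : Fin l → ι → ℝ) (A : Finset (Fin l)) (d : Fin l → ℕ)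
      (j0 : Fin l), Sys P β A d → A.card = r → j0 ∉ A → P j0 = ∏ j, p j → d j0 = m + l →
      CB (Dlt p) (fun i => rowf p (P i) (β i))
        (((m + l : ℕ) : ℝ) * (∏ i ∈ (insert j0 A)ᶜ, (d i : ℝ)) * FF ((m + ∑ i ∈ (insert j0 A)ᶜ, d i : ℕ) : ℝ) r) := by
  classical
  induction r with
  | zero =>
    intro P β A d j0 hS hr hj hPj hdj
    rw [Finset.card_eq_zero] at hr
    subst hr
    have hb := bezout_CB (Dlt p) (fun i => rowf p (P i) (β i)) P d (fun i => hS.hd i (by simp))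
      (fun i => hS.hP i (by simp)) (fun i x hx => by simp [rowf, hS.hA' i (by simp)])
    refine CB_mono hb (le_of_eq ?_)
    rw [← Finset.prod_compl_mul_prod (insert j0 ∅)]
    simp [FF, hdj, mul_comm]
  | succ r ih =>
    intro P β A d j0 hS hr hj hPj hdj
    obtain ⟨a, ha⟩ : A.Nonempty := by rw [← Finset.card_pos]; omega
    have haj : a ≠ j0 := fun h => hj (h ▸ ha)
    set G : Fin l → (Fin l → ℝ) → ℝ := fun i => rowf p (P i) (β i) with hG
    -- the Jacobian polynomial
    obtain ⟨D, hD1, hD2⟩ := deg_lemma p hp (Function.update P j0 0) (Function.update β j0 1) (insert j0 A)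
      (by
        intro i hi
        by_cases hij : i = j0
        · subst hij; simp
        · rw [Function.update_of_ne hij]; exact hS.hA i ((Finset.mem_insert.1 hi).resolve_left hij))
      (by
        intro i hi
        rw [Finset.mem_insert, not_or] at hi
        rw [Function.update_of_ne hi.1]; exact hS.hA' i hi.2) d
      (fun i hi => hS.hd i (fun h => hi (Finset.mem_insert_of_mem h)))
      (by
        intro i hi
        rw [Finset.mem_insert, not_or] at hi
        rw [Function.update_of_ne hi.1]; exact hS.hP i hi.2) m hcard
    set σ : ℕ := m + ∑ i ∈ (insert j0 A)ᶜ, d i with hσ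
    have hdet : ∀ x ∈ Dlt p, eval x D = 1 * (jac G x).det := by
      intro x hx
      rw [hD2 x hx, one_mul, jac_det_eq, jac_det_eq]
      have e1 : (fun i => grow (rowf p (Function.update P j0 0 i) (Function.update β j0 1 i)) x) =
          Function.update (fun i => grow (G i) x) j0 (grow (rowf p 0 1) x) := by
        ext1 i
        by_cases hij : i = j0
        · subst hij; simp
        · simp [Function.update_of_ne hij, hG]
      rw [e1, ← smul_eq_mul, ← ContinuousMultilinearMap.map_update_smul, ← grow_q p x hx]
      congr 1
      have : G j0 = rowf p (∏ j, p j) 0 := by simp [hG, hPj, hS.hA' j0 hj]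
      rw [← this, Function.update_eq_self_iff]
    have hσ1 : 1 ≤ σ := by omega
    have hS' := hS.update a ha D σ hσ1 hD1
    have hB1 := ih _ _ _ _ j0 hS' (by rw [Finset.card_erase_of_mem ha]; omega)
      (fun h => hj (Finset.mem_of_mem_erase h)) (by rw [Function.update_of_ne haj.symm, hPj])
      (by rw [Function.update_of_ne haj.symm, hdj])
    rw [rowf_update] at hB1
    have hins : (insert j0 (A.erase a))ᶜ = insert a (insert j0 A)ᶜ := by
      ext i
      simp only [Finset.mem_compl, Finset.mem_insert, Finset.mem_erase]
      by_cases h1 : i = a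
      · subst h1; simp [haj]
      · simp [h1]
    have hna : a ∉ (insert j0 A)ᶜ := by simp [ha]
    rw [hins, Finset.prod_insert hna, Finset.sum_insert hna, Function.update_self,
      prod_upd d a σ _ hna, Finset.sum_update_of_notMem hna] at hB1
    have hB2 : CB (Dlt p) (Function.update G a (fun x => eval x (∏ j, p j))) 0 := by
      have : ∀ᵐ v : Fin l → ℝ, v a ≠ v j0 := by
        have := (Measure.addHaar_submodule (volume : Measure (Fin l → ℝ))
          (LinearMap.ker ((LinearMap.proj a : (Fin l → ℝ) →ₗ[ℝ] ℝ) - LinearMap.proj j0)) ?_)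
        · rw [ae_iff]
          convert! this using 2
          ext v; simp [sub_eq_zero]
        · intro h
          have h2 : (Pi.single a 1 : Fin l → ℝ) ∈ LinearMap.ker ((LinearMap.proj a : (Fin l → ℝ) →ₗ[ℝ] ℝ) - LinearMap.proj j0) := by
            rw [h]; trivial
          simp [haj.symm, Pi.single_apply] at h2
      filter_upwards [this] with v hv T hT
      have : T = ∅ := by
        by_contra hne
        obtain ⟨x, hx⟩ := Finset.nonempty_iff_ne_empty.2 hne
        have h1 := (hT x hx).2 a
        have h2 := (hT x hx).2 j0
        rw [Function.update_self] at h1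
        rw [Function.update_of_ne haj.symm] at h2
        simp only [hG, hPj, hS.hA' j0 hj, rowf] at h2
        simp only [Pi.zero_apply, zero_mul, Finset.sum_const_zero, add_zero] at h2
        exact hv (h1.symm.trans h2)
      simp [this]
    have := rolle (isOpen_Dlt p) G (fun i => contDiffOn_rowf p _ _) a (fun x => eval x (∏ j, p j))
      (contDiff_mvPoly _).contDiffOn (fun x hx => by rw [map_prod]; exact Finset.prod_pos fun j _ => hx j)
      (compact_q p hK) (fun x => eval x D) (contDiff_mvPoly _).contDiffOn (fun _ => 1) (fun _ _ => one_pos)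
      hdet _ _ hB1 hB2 1 1 zero_le_one le_rfl zero_le_one le_rfl
    filter_upwards [this] with v hv T hT
    have h := hv T hT
    simp only [ite_self, Finset.sum_const, nsmul_eq_mul, mul_one] at h
    refine h.trans (le_of_eq ?_)
    rw [FF_succ]
    have : ((m + (σ + ∑ i ∈ (insert j0 A)ᶜ, d i) : ℕ) : ℝ) = 2 * (σ : ℝ) := by
      have : m + (σ + ∑ i ∈ (insert j0 A)ᶜ, d i) = 2 * σ := by omega
      rw [this]; push_cast; ring
    rw [this]
    ring

theorem Tw {ι : Type*} [Fintype ι] {l : ℕ} (p : ι → MvPolynomial (Fin l) ℝ)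
    (hp : ∀ j, (p j).totalDegree ≤ 1) (hK : IsCompact {x : Fin l → ℝ | ∀ j, 0 ≤ eval x (p j)})
    (m : ℕ) (hm : 1 ≤ m) (hcard : Fintype.card ι = m + l) (r : ℕ)
    (ih : ∀ (P : Fin l → MvPolynomial (Fin l) ℝ) (β : Fin l → ι → ℝ) (A : Finset (Fin l)) (d : Fin l → ℕ),
      Sys P β A d → A.card = r → CB (Dlt p) (fun i => rowf p (P i) (β i))
        ((∏ i ∈ Aᶜ, (d i : ℝ)) * FF ((m + ∑ i ∈ Aᶜ, d i : ℕ) : ℝ) r +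
          (r : ℝ) / 2 * (((m + l : ℕ) : ℝ) * (∏ i ∈ Aᶜ, (d i : ℝ)) * FF ((m + ∑ i ∈ Aᶜ, d i : ℕ) : ℝ) (r - 1))))
    (P : Fin l → MvPolynomial (Fin l) ℝ) (β : Fin l → ι → ℝ) (A : Finset (Fin l)) (d : Fin l → ℕ)
    (hS : Sys P β A d) (hr : A.card = r + 1)
    (α γ : ℝ) (hα : 0 ≤ α) (hα1 : α ≤ 1) (hγ : 0 ≤ γ) (hγ1 : γ ≤ 1) :
    ∀ᵐ v : Fin l → ℝ, ∀ T : Finset (Fin l → ℝ), (∀ x ∈ T, x ∈ Dlt p ∧ ∀ i, rowf p (P i) (β i) x = v i) →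
      ∑ x ∈ T, (if 0 < (jac (fun i => rowf p (P i) (β i)) x).det then γ else α) ≤ 
        (α + γ) / 2 * ((∏ i ∈ Aᶜ, (d i : ℝ)) * FF ((m + ∑ i ∈ Aᶜ, d i : ℕ) : ℝ) (r + 1) +
          (r : ℝ) / 2 * (((m + l : ℕ) : ℝ) * (∏ i ∈ Aᶜ, (d i : ℝ)) * FF ((m + ∑ i ∈ Aᶜ, d i : ℕ) : ℝ) r))
        + (((m + l : ℕ) : ℝ) * (∏ i ∈ Aᶜ, (d i : ℝ)) * FF ((m + ∑ i ∈ Aᶜ, d i : ℕ) : ℝ) r) / 2 := by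
  classical
  obtain ⟨a, ha⟩ : A.Nonempty := by rw [← Finset.card_pos]; omega
  set G : Fin l → (Fin l → ℝ) → ℝ := fun i => rowf p (P i) (β i) with hG
  obtain ⟨D, hD1, hD2⟩ := deg_lemma p hp P β A hS.hA hS.hA' d hS.hd hS.hP m hcard
  set σ : ℕ := m + ∑ i ∈ Aᶜ, d i with hσ
  have hσ1 : 1 ≤ σ := by omega
  have hcr : (A.erase a).card = r := by rw [Finset.card_erase_of_mem ha]; omega
  have hB1 := ih _ _ _ _ (hS.update a ha D σ hσ1 hD1) hcr
  rw [rowf_update] at hB1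
  have hins : (A.erase a)ᶜ = insert a Aᶜ := Finset.compl_erase
  have hna : a ∉ Aᶜ := by simp [ha]
  rw [hins, Finset.prod_insert hna, Finset.sum_insert hna, Function.update_self,
    prod_upd d a σ _ hna, Finset.sum_update_of_notMem hna] at hB1
  have hB2 := Tq p hp hK m hm hcard r _ _ _ _ a
    (hS.update a ha (∏ j, p j) (m + l) (by omega) (hcard ▸ totalDegree_prod_p p hp)) hcr
    (by simp) (by simp) (by simp)
  rw [rowf_update, Finset.insert_erase ha, prod_upd d a (m + l) _ hna, Finset.sum_update_of_notMem hna] at hB2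
  have hq0 : ∀ x ∈ Dlt p, 0 < eval x (∏ j, p j) := 
    fun x hx => by rw [map_prod]; exact Finset.prod_pos fun j _ => hx j
  have := rolle (isOpen_Dlt p) G (fun i => contDiffOn_rowf p _ _) a (fun x => eval x (∏ j, p j))
      (contDiff_mvPoly _).contDiffOn hq0
      (compact_q p hK) (fun x => eval x D) (contDiff_mvPoly _).contDiffOn (fun x => eval x (∏ j, p j)) hq0
      hD2 _ _ hB1 hB2 α γ hα hα1 hγ hγ1
  filter_upwards [this] with v hv T hT
  have h := hv T hT
  have e1 : ∑ x ∈ T, (if 0 < (jac G x).det then γ else α) = ∑ x ∈ T, (if 0 < eval x D then γ else α) := by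
    refine Finset.sum_congr rfl fun x hx => ?_
    rw [hD2 x (hT x hx).1]
    have hq := hq0 x (hT x hx).1
    exact if_congr (mul_pos_iff_of_pos_left hq).symm rfl rfl
  rw [e1]
  refine h.trans (le_of_eq ?_)
  have : ((m + (σ + ∑ i ∈ Aᶜ, d i) : ℕ) : ℝ) = 2 * (σ : ℝ) := by
    have : m + (σ + ∑ i ∈ Aᶜ, d i) = 2 * σ := by omega
    rw [this]; push_cast; ring
  rw [this, FF_succ (σ : ℝ) r]
  rcases r with _ | r
  · simp only [FF, Finset.range_zero, Finset.prod_empty, Nat.cast_zero, zero_div, zero_mul, add_zero, mul_one]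
    ring
  · rw [FF_succ (σ : ℝ) r, Nat.add_sub_cancel]
    push_cast
    ring

theorem TT {ι : Type*} [Fintype ι] {l : ℕ} (p : ι → MvPolynomial (Fin l) ℝ)
    (hp : ∀ j, (p j).totalDegree ≤ 1) (hK : IsCompact {x : Fin l → ℝ | ∀ j, 0 ≤ eval x (p j)})
    (m : ℕ) (hm : 1 ≤ m) (hcard : Fintype.card ι = m + l) (r : ℕ) :
    ∀ (P : Fin l → MvPolynomial (Fin l) ℝ) (β : Fin l → ι → ℝ) (A : Finset (Fin l)) (d : Fin l → ℕ),
      Sys P β A d → A.card = r → CB (Dlt p) (fun i => rowf p (P i) (β i))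
        ((∏ i ∈ Aᶜ, (d i : ℝ)) * FF ((m + ∑ i ∈ Aᶜ, d i : ℕ) : ℝ) r +
          (r : ℝ) / 2 * (((m + l : ℕ) : ℝ) * (∏ i ∈ Aᶜ, (d i : ℝ)) * FF ((m + ∑ i ∈ Aᶜ, d i : ℕ) : ℝ) (r - 1))) := by
  induction r with
  | zero =>
    intro P β A d hS hr
    rw [Finset.card_eq_zero] at hr
    subst hr
    have hb := bezout_CB (Dlt p) (fun i => rowf p (P i) (β i)) P d (fun i => hS.hd i (by simp))
      (fun i => hS.hP i (by simp)) (fun i x hx => by simp [rowf, hS.hA' i (by simp)])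
    refine CB_mono hb (le_of_eq ?_)
    simp [FF]
  | succ r ih =>
    intro P β A d hS hr
    have := Tw p hp hK m hm hcard r ih P β A d hS hr 1 1 zero_le_one le_rfl zero_le_one le_rfl
    filter_upwards [this] with v hv T hT
    have h := hv T hT
    simp only [ite_self, Finset.sum_const, nsmul_eq_mul, mul_one] at h
    refine h.trans (le_of_eq ?_)
    rw [Nat.add_sub_cancel]
    push_cast
    ring

/-- Bounds for Gale systems. -/
theorem gale_full {ι : Type*} [Fintype ι] {l : ℕ} (p : ι → MvPolynomial (Fin l) ℝ)
    (hp : ∀ j, (p j).totalDegree ≤ 1) (hK : IsCompact {x : Fin l → ℝ | ∀ j, 0 ≤ eval x (p j)})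
    (m : ℕ) (hm : 1 ≤ m) (hcard : Fintype.card ι = m + l) (β : Fin l → ι → ℝ) :
    CB (Dlt p) (fun i => rowf p 0 (β i)) (FF m l + (l : ℝ) / 2 * (((m + l : ℕ) : ℝ) * FF m (l - 1))) := by
  have := TT p hp hK m hm hcard l (fun _ => 0) β Finset.univ (fun _ => 1)
    ⟨by simp, by simp, by simp, by simp⟩ (by simp)
  simpa using this

theorem gale_sign {ι : Type*} [Fintype ι] {l : ℕ} (p : ι → MvPolynomial (Fin l) ℝ)
    (hp : ∀ j, (p j).totalDegree ≤ 1) (hK : IsCompact {x : Fin l → ℝ | ∀ j, 0 ≤ eval x (p j)})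
    (m : ℕ) (hm : 1 ≤ m) (hcard : Fintype.card ι = m + l) (hl : 1 ≤ l) (β : Fin l → ι → ℝ) 
    (α γ : ℝ) (hα : 0 ≤ α) (hα1 : α ≤ 1) (hγ : 0 ≤ γ) (hγ1 : γ ≤ 1) :
    ∀ᵐ v : Fin l → ℝ, ∀ T : Finset (Fin l → ℝ), (∀ x ∈ T, x ∈ Dlt p ∧ ∀ i, rowf p 0 (β i) x = v i) →
      ∑ x ∈ T, (if 0 < (jac (fun i => rowf p 0 (β i)) x).det then γ else α) ≤ 
        (α + γ) / 2 * (FF m l + ((l : ℝ) - 1) / 2 * (((m + l : ℕ) : ℝ) * FF m (l - 1)))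
        + (((m + l : ℕ) : ℝ) * FF m (l - 1)) / 2 := by
  obtain ⟨r, rfl⟩ := Nat.exists_eq_add_of_le' hl
  have := Tw p hp hK m hm hcard r (TT p hp hK m hm hcard r) (fun _ => 0) β Finset.univ (fun _ => 1)
    ⟨by simp, by simp, by simp, by simp⟩ (by simp) α γ hα hα1 hγ hγ1
  simpa using this

end PartPC2

section PartPE
open scoped ContDiff Topology ENNReal
open MeasureTheory MvPolynomial

theorem cc_bound {Z : Type*} [TopologicalSpace Z] (M : ℕ)
    (h : ∀ r (f : Z → Fin r), Continuous f → Function.Surjective f → r ≤ M) :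
    Finite (ConnectedComponents Z) ∧ Nat.card (ConnectedComponents Z) ≤ M := by
  classical
  rcases isEmpty_or_nonempty Z with hZ | ⟨⟨z0⟩⟩
  · have : IsEmpty (ConnectedComponents Z) := ⟨fun q => by
      obtain ⟨z, _⟩ := ConnectedComponents.surjective_coe q
      exact hZ.elim z⟩
    exact ⟨inferInstance, by simp⟩
  let Q : ℕ → Prop := fun r => ∃ f : Z → Fin r, Continuous f ∧ Function.Surjective f
  have hQ1 : Q 1 := ⟨fun _ => 0, continuous_const, fun i => ⟨z0, Subsingleton.elim _ _⟩⟩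
  have hM1 : 1 ≤ M := by obtain ⟨f, h1, h2⟩ := hQ1; exact h 1 f h1 h2
  set r := Nat.findGreatest Q M with hr
  obtain ⟨f, hf, hfs⟩ : Q r := Nat.findGreatest_spec hM1 hQ1
  have hmax : ¬ Q (r + 1) := by
    rintro ⟨f', h1, h2⟩
    have := h _ f' h1 h2
    have := Nat.le_findGreatest (P := Q) this (⟨f', h1, h2⟩ : Q (r + 1))
    omega
  have hrM : r ≤ M := h r f hf hfs
  have hpre : ∀ i, IsPreconnected (f ⁻¹' {i}) := by
    intro i
    rw [isPreconnected_closed_iff]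
    intro t t' ht ht' hsub hn hn'
    by_contra hcon
    have hF : IsClopen (f ⁻¹' {i}) := (isClopen_discrete {i}).preimage hf
    have hC : IsClopen (f ⁻¹' {i} ∩ t) := by
      refine ⟨hF.1.inter ht, ?_⟩
      rw [← isClosed_compl_iff]
      have : (f ⁻¹' {i} ∩ t)ᶜ = (f ⁻¹' {i})ᶜ ∪ (f ⁻¹' {i} ∩ t') := by
        ext y
        simp only [Set.mem_compl_iff, Set.mem_inter_iff, Set.mem_union, not_and]
        constructor
        · intro hy
          by_cases hyF : y ∈ f ⁻¹' {i}
          · exact Or.inr ⟨hyF, (hsub hyF).resolve_left (hy hyF)⟩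
          · exact Or.inl hyF
        · rintro (hy | hy) hyF hyt
          · exact hy hyF
          · exact hcon ⟨y, hyF, hyt, hy.2⟩
      rw [this]
      exact hF.2.isClosed_compl.union (hF.1.inter ht')
    apply hmax
    refine ⟨fun y => if y ∈ f ⁻¹' {i} ∩ t then Fin.last r else (f y).castSucc, ?_, ?_⟩
    · refine continuous_if ?_ continuous_const.continuousOn
        ((continuous_of_discreteTopology (f := Fin.castSucc)).comp hf).continuousOn
      intro y hy
      have : frontier {y | y ∈ f ⁻¹' {i} ∩ t} = ∅ := hC.frontier_eq
      rw [this] at hy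
      exact hy.elim
    · intro j
      induction j using Fin.lastCases with
      | last =>
        obtain ⟨y, hy⟩ := hn
        exact ⟨y, if_pos hy⟩
      | cast j =>
        by_cases hj : j = i
        · subst hj
          obtain ⟨y, hy⟩ := hn'
          refine ⟨y, ?_⟩
          dsimp only
          rw [if_neg]
          · rw [show f y = j from hy.1]
          · intro hh
            exact hcon ⟨y, hh.1, hh.2, hy.2⟩
        · obtain ⟨y, hy⟩ := hfs j
          refine ⟨y, ?_⟩
          dsimp only
          rw [if_neg, hy]
          intro hh
          exact hj (hy.symm.trans hh.1)
  let F : ConnectedComponents Z → Fin r := hf.connectedComponentsLift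
  have hFi : Function.Injective F := by
    intro q q' hq
    obtain ⟨y, rfl⟩ := ConnectedComponents.surjective_coe q
    obtain ⟨y', rfl⟩ := ConnectedComponents.surjective_coe q'
    have hq' : f y = f y' := hq
    rw [ConnectedComponents.coe_eq_coe']
    exact (hpre (f y')).subset_connectedComponent rfl hq'
  refine ⟨Finite.of_injective F hFi, ?_⟩
  exact (Nat.card_le_card_of_injective F hFi).trans (by simpa using hrM)

theorem exists_m {E : Type*} [NormedAddCommGroup E] [NormedSpace ℝ E] (g : E → ℝ) (hg : Continuous g)
    (s t : Set E) (hs : IsClosed s) (ht : IsClosed t) (hst : Disjoint s t) (hZ : ∀ z, g z = 0 → z ∈ s ∨ z ∈ t) :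
    ∃ (U φ : E → ℝ) (m : {y // g y ≠ 0} → ℤ), Continuous U ∧ Continuous φ ∧ Continuous m ∧
      (∀ z ∈ s, φ z = 0) ∧ (∀ z ∈ t, φ z = 1) ∧
      (∀ y : {y // g y ≠ 0}, 0 < g y → (m y : ℝ) = (U y - Real.pi * φ y) / (2 * Real.pi)) ∧
      (∀ y : {y // g y ≠ 0}, g y < 0 → (m y : ℝ) = (U y + Real.pi * φ y) / (2 * Real.pi)) := by
  obtain ⟨φ, h0, h1, -⟩ := exists_continuous_zero_one_of_isClosed hs ht hst
  have hπ := Real.pi_pos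
  have hu : Continuous (fun y => if 0 ≤ g y then Circle.exp (Real.pi * φ y) else Circle.exp (-(Real.pi * φ y))) := by
    refine Continuous.if_le (Circle.exp.continuous.comp (by fun_prop)) (Circle.exp.continuous.comp (by fun_prop))
      continuous_const hg ?_
    intro y hy
    rcases hZ y hy.symm with h | h
    · rw [h0 h]; simp
    · rw [h1 h]
      simp only [Pi.one_apply, mul_one]
      rw [Circle.exp_eq_exp]
      refine ⟨1, ?_⟩
      push_cast; ring
  obtain ⟨U, ⟨-, hU⟩, -⟩ := Circle.isCoveringMap_exp.existsUnique_continuousMap_lifts ⟨_, hu⟩ (0 : E)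
    (if 0 ≤ g 0 then Real.pi * φ 0 else -(Real.pi * φ 0)) (by
      simp only [ContinuousMap.coe_mk]
      split_ifs <;> rfl)
  have hU' : ∀ y, Circle.exp (U y) = if 0 ≤ g y then Circle.exp (Real.pi * φ y) else Circle.exp (-(Real.pi * φ y)) :=
    fun y => congrFun hU y
  have hm : ∀ y, ∃ m : ℤ, (0 ≤ g y → (m : ℝ) = (U y - Real.pi * φ y) / (2 * Real.pi)) ∧
      (g y < 0 → (m : ℝ) = (U y + Real.pi * φ y) / (2 * Real.pi)) := by
    intro y
    have h := hU' y
    split_ifs at h with hy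
    · obtain ⟨m, hm⟩ := Circle.exp_eq_exp.1 h
      refine ⟨m, fun _ => ?_, fun h' => absurd hy (not_le.2 h')⟩
      rw [hm]; field_simp; ring
    · obtain ⟨m, hm⟩ := Circle.exp_eq_exp.1 h
      refine ⟨m, fun h' => absurd h' hy, fun _ => ?_⟩
      rw [hm]; field_simp; ring
  choose m hm1 hm2 using hm
  refine ⟨U, φ, fun y => m y, U.continuous, φ.continuous, ?_, fun z hz => h0 hz, fun z hz => h1 hz,
    fun y hy => hm1 y hy.le, fun y hy => hm2 y hy⟩
  rw [Int.isClosedEmbedding_coe_real.isInducing.continuous_iff]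
  rw [continuous_iff_continuousAt]
  intro y
  rcases lt_or_gt_of_ne y.2 with hy | hy
  · have : (fun y : {y // g y ≠ 0} => (U y + Real.pi * φ y) / (2 * Real.pi)) =ᶠ[𝓝 y]
        ((fun m : ℤ => (m : ℝ)) ∘ fun y : {y // g y ≠ 0} => m y) := by
      have : ∀ᶠ y' : {y // g y ≠ 0} in 𝓝 y, g y' < 0 :=
        (hg.comp continuous_subtype_val).continuousAt.eventually (eventually_lt_nhds hy)
      filter_upwards [this] with y' hy'
      exact (hm2 y' hy').symm
    refine ContinuousAt.congr ?_ this
    exact Continuous.continuousAt (by fun_prop)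
  · have : (fun y : {y // g y ≠ 0} => (U y - Real.pi * φ y) / (2 * Real.pi)) =ᶠ[𝓝 y]
        ((fun m : ℤ => (m : ℝ)) ∘ fun y : {y // g y ≠ 0} => m y) := by
      have : ∀ᶠ y' : {y // g y ≠ 0} in 𝓝 y, 0 < g y' :=
        (hg.comp continuous_subtype_val).continuousAt.eventually (eventually_gt_nhds hy)
      filter_upwards [this] with y' hy'
      exact (hm1 y' hy'.le).symm
    refine ContinuousAt.congr ?_ this
    exact Continuous.continuousAt (by fun_prop)

theorem topo {E : Type*} [NormedAddCommGroup E] [NormedSpace ℝ E] (g : E → ℝ) (hg : Continuous g)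
    (hpos : ∀ z, g z = 0 → z ∈ closure {y | 0 < g y}) (hneg : ∀ z, g z = 0 → z ∈ closure {y | g y < 0})
    (M : ℕ) (hfin : Finite (ConnectedComponents {y // g y ≠ 0}))
    (hM : Nat.card (ConnectedComponents {y // g y ≠ 0}) ≤ M + 1) :
    Finite (ConnectedComponents {y // g y = 0}) ∧ Nat.card (ConnectedComponents {y // g y = 0}) ≤ M := by
  classical
  apply cc_bound
  intro r f hf hfs
  have hcl : IsClosed {y | g y = 0} := isClosed_eq hg continuous_const
  have hcle : Topology.IsClosedEmbedding (Subtype.val : {y // g y = 0} → E) := hcl.isClosedEmbedding_subtypeVal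
  have key := fun i : Fin r => exists_m g hg (Subtype.val '' (f ⁻¹' {i}ᶜ)) (Subtype.val '' (f ⁻¹' {i}))
    (hcle.isClosedMap _ ((isClosed_discrete _).preimage hf)) (hcle.isClosedMap _ ((isClosed_discrete _).preimage hf))
    (by
      rw [Set.disjoint_image_iff Subtype.val_injective]
      rw [Set.preimage_compl]; exact disjoint_compl_left)
    (by
      intro z hz
      by_cases h : f ⟨z, hz⟩ = i
      · exact Or.inr ⟨⟨z, hz⟩, h, rfl⟩
      · exact Or.inl ⟨⟨z, hz⟩, h, rfl⟩)
  choose U φ m hU hφ hm h0 h1 hmp hmn using key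
  have hπ := Real.pi_pos
  obtain ⟨y0⟩ : Nonempty {y // g y ≠ 0} := by
    by_cases h : g 0 = 0
    · obtain ⟨y, hy⟩ := closure_nonempty_iff.1 ⟨0, hpos 0 h⟩
      exact ⟨⟨y, (show 0 < g y from hy).ne'⟩⟩
    · exact ⟨⟨0, h⟩⟩
  let L : (Option (Fin r) → ℝ) →ₗ[ℝ] (ConnectedComponents {y // g y ≠ 0} → ℝ) :=
    { toFun := fun c q => c none + ∑ i, c (some i) * ((hm i).connectedComponentsLift q : ℝ)
      map_add' := by
        intro c c'; ext q; simp only [Pi.add_apply, add_mul, Finset.sum_add_distrib]; ring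
      map_smul' := by
        intro a c; ext q
        simp only [Pi.smul_apply, smul_eq_mul, RingHom.id_apply, mul_add, Finset.mul_sum, mul_assoc] }
  have hL : Function.Injective L := by
    rw [← LinearMap.ker_eq_bot, LinearMap.ker_eq_bot']
    intro c hc
    have hc' : ∀ y : {y // g y ≠ 0}, c none + ∑ i, c (some i) * (m i y : ℝ) = 0 := fun y => congrFun hc (y : ConnectedComponents {y // g y ≠ 0})
    have hs : ∀ i, c (some i) = 0 := by
      intro i
      obtain ⟨z, hz⟩ := hfs i
      have e1 : c none + ∑ i, c (some i) * ((U i z - Real.pi * φ i z) / (2 * Real.pi)) = 0 := by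
        have hclosed : IsClosed {y | c none + ∑ i, c (some i) * ((U i y - Real.pi * φ i y) / (2 * Real.pi)) = 0} :=
          isClosed_eq (by fun_prop) continuous_const
        refine hclosed.closure_subset_iff.2 ?_ (hpos z z.2)
        intro y hy
        have hy' : 0 < g y := hy
        have := hc' ⟨y, hy'.ne'⟩
        rw [Finset.sum_congr rfl (fun i _ => by rw [hmp i ⟨y, hy'.ne'⟩ hy'])] at this
        exact this
      have e2 : c none + ∑ i, c (some i) * ((U i z + Real.pi * φ i z) / (2 * Real.pi)) = 0 := by
        have hclosed : IsClosed {y | c none + ∑ i, c (some i) * ((U i y + Real.pi * φ i y) / (2 * Real.pi)) = 0} :=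
          isClosed_eq (by fun_prop) continuous_const
        refine hclosed.closure_subset_iff.2 ?_ (hneg z z.2)
        intro y hy
        have hy' : g y < 0 := hy
        have := hc' ⟨y, hy'.ne⟩
        rw [Finset.sum_congr rfl (fun i _ => by rw [hmn i ⟨y, hy'.ne⟩ hy'])] at this
        exact this
      have e3 : ∑ k, c (some k) * φ k z = 0 := by
        have : ∑ k, c (some k) * φ k z = (c none + ∑ i, c (some i) * ((U i z + Real.pi * φ i z) / (2 * Real.pi))) -
            (c none + ∑ i, c (some i) * ((U i z - Real.pi * φ i z) / (2 * Real.pi))) := by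
          rw [add_sub_add_left_eq_sub, ← Finset.sum_sub_distrib]
          refine Finset.sum_congr rfl fun k _ => ?_
          field_simp; ring
        rw [this, e1, e2, sub_zero]
      rw [Finset.sum_eq_single i] at e3
      · rwa [h1 i z ⟨z, hz, rfl⟩, mul_one] at e3
      · intro k _ hk
        rw [h0 k z ⟨z, by simpa [hz] using hk.symm, rfl⟩, mul_zero]
      · simp
    have hn : c none = 0 := by simpa [hs] using hc' y0
    ext o
    cases o with
    | none => exact hn
    | some i => exact hs i
  have := Fintype.ofFinite (ConnectedComponents {y // g y ≠ 0})
  have := LinearMap.finrank_le_finrank_of_injective hL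
  simp only [Module.finrank_fintype_fun_eq_card, Fintype.card_option, Fintype.card_fin] at this
  rw [← Nat.card_eq_fintype_card] at this
  omega

end PartPE

section PartPD1
open scoped ContDiff Topology ENNReal
open MeasureTheory MvPolynomial

/-- linear functional `y ↦ a · y`. -/
noncomputable def dotL {n : ℕ} (w : Fin n → ℝ) : (Fin n → ℝ) →ₗ[ℝ] ℝ :=
  { toFun := fun y => ∑ i, w i * y i
    map_add' := by intro x y; simp [mul_add, Finset.sum_add_distrib]
    map_smul' := by intro c x; simp only [Pi.smul_apply, smul_eq_mul, RingHom.id_apply, Finset.mul_sum]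
                    exact Finset.sum_congr rfl fun i _ => by ring }

theorem dotL_apply {n : ℕ} (w y : Fin n → ℝ) : dotL w y = ∑ i, w i * y i := rfl

theorem dotL_comm {n : ℕ} (w y : Fin n → ℝ) : dotL w y = dotL y w := by
  simp [dotL_apply, mul_comm]

theorem dotL_ne_zero {n : ℕ} (w : Fin n → ℝ) (hw : w ≠ 0) : dotL w ≠ 0 := by
  intro h
  apply hw
  ext i
  have := congrArg (fun f => f (Pi.single i 1)) h
  simpa [dotL_apply, Pi.single_apply] using this

theorem exists_dotL {n : ℕ} (f : (Fin n → ℝ) →ₗ[ℝ] ℝ) : ∃ w, f = dotL w := by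
  refine ⟨fun i => f (Pi.single i 1), ?_⟩
  ext i
  simp [dotL_apply, Pi.single_apply]

theorem affDim_range {n N : ℕ} (a : Fin N → Fin n → ℝ) (ha : NotAllInAffineHyperplane a) :
    (affineSpan ℝ (Set.range a)).direction = ⊤ := by
  by_contra h
  obtain ⟨f, hf, hker⟩ := Submodule.exists_le_ker_of_lt_top _ (lt_top_iff_ne_top.2 h)
  obtain ⟨w, rfl⟩ := exists_dotL f
  apply ha
  have hw : w ≠ 0 := by
    rintro rfl
    apply hf
    ext; simp [dotL_apply]
  rcases isEmpty_or_nonempty (Fin N) with he | ⟨⟨j0⟩⟩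
  · exact ⟨w, 0, hw, fun j => he.elim j⟩
  · refine ⟨w, dotL w (a j0), hw, fun j => ?_⟩
    have : a j - a j0 ∈ (affineSpan ℝ (Set.range a)).direction := by
      rw [direction_affineSpan]
      exact vsub_mem_vectorSpan ℝ (Set.mem_range_self j) (Set.mem_range_self j0)
    have := hker this
    rw [LinearMap.mem_ker, map_sub, sub_eq_zero] at this
    exact this

theorem mem_faceIdx {n N : ℕ} (a : Fin N → Fin n → ℝ) (w : Fin n → ℝ) (j : Fin N) :
    j ∈ faceIdx a w ↔ ∀ i, dotL (a i) w ≤ dotL (a j) w := by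
  simp [faceIdx, dotL_apply]

theorem face_proper {n N : ℕ} (a : Fin N → Fin n → ℝ) (ha : NotAllInAffineHyperplane a) (w : Fin n → ℝ)
    (hw : w ≠ 0) : affDim (facePts a w) < affDim (Set.range a) := by
  unfold affDim
  rw [affDim_range a ha, finrank_top]
  apply Submodule.finrank_lt
  intro h
  have hle : (affineSpan ℝ (facePts a w)).direction ≤ LinearMap.ker (dotL w) := by
    rw [direction_affineSpan, vectorSpan_def, Submodule.span_le]
    rintro _ ⟨_, ⟨i, hi, rfl⟩, _, ⟨j, hj, rfl⟩, rfl⟩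
    rw [Finset.mem_coe, mem_faceIdx] at hi hj
    simp only [vsub_eq_sub, SetLike.mem_coe, LinearMap.mem_ker, map_sub]
    rw [dotL_comm w, dotL_comm w]
    linarith [hi j, hj i]
  rw [h, top_le_iff, LinearMap.ker_eq_top] at hle
  exact dotL_ne_zero w hw hle

theorem face_indep {n N : ℕ} (a : Fin N → Fin n → ℝ) (ha : NotAllInAffineHyperplane a) (hcs : CombSimplicial a)
    (w : Fin n → ℝ) (hw : w ≠ 0) : AffineIndependent ℝ (fun j : faceIdx a w => a j) := by
  have h1 := hcs w (face_proper a ha w hw)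
  rw [affineIndependent_iff_finrank_vectorSpan_eq ℝ _ (n := affDim (facePts a w)) (by rw [Fintype.card_coe, h1, add_comm])]
  have : Set.range (fun j : faceIdx a w => a j) = facePts a w := by
    ext x
    simp [facePts]
  rw [affDim, direction_affineSpan, this]

theorem face_zero {n N : ℕ} (a : Fin N → Fin n → ℝ) (ha : NotAllInAffineHyperplane a) (hcs : CombSimplicial a)
    (w : Fin n → ℝ) (hw : w ≠ 0) (ξ : Fin N → ℝ) (hs : ∀ j ∉ faceIdx a w, ξ j = 0) (h0 : ∑ j, ξ j = 0)
    (h1 : ∀ i, ∑ j, ξ j * a j i = 0) : ξ = 0 := by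
  have h := affineIndependent_iff.1 (face_indep a ha hcs w hw) Finset.univ (fun j => ξ j) ?_ ?_
  · ext j
    by_cases hj : j ∈ faceIdx a w
    · exact h ⟨j, hj⟩ (Finset.mem_univ _)
    · exact hs j hj
  · rw [Finset.sum_coe_sort (faceIdx a w) ξ, ← h0]
    exact Finset.sum_subset (Finset.subset_univ _) fun j _ hj => hs j hj
  · rw [Finset.sum_coe_sort (faceIdx a w) (fun j => ξ j • a j)]
    ext i
    rw [Finset.sum_apply, Pi.zero_apply, ← h1 i]
    exact Finset.sum_subset (Finset.subset_univ _) fun j _ hj => by simp [hs j hj]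

theorem face_dir {n N : ℕ} (a : Fin N → Fin n → ℝ) (ha : NotAllInAffineHyperplane a) (hcs : CombSimplicial a)
    (w : Fin n → ℝ) (hw : w ≠ 0) (i : Fin N) (hi : i ∈ faceIdx a w) :
    ∃ v : Fin n → ℝ, ∀ j ∈ faceIdx a w, j ≠ i → dotL (a j) v - dotL (a i) v = -1 := by
  have h := (affineIndependent_iff_linearIndependent_vsub ℝ _ (⟨i, hi⟩ : faceIdx a w)).1 (face_indep a ha hcs w hw)
  obtain ⟨f, hf⟩ : ∃ f : (Fin n → ℝ) →ₗ[ℝ] ℝ, ∀ j : {x : faceIdx a w // x ≠ ⟨i, hi⟩}, f (a j - a i) = -1 := by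
    let b := Module.Basis.extend h.linearIndepOn_id
    refine ⟨b.constr ℝ (fun _ => (-1 : ℝ)), fun j => ?_⟩
    have hmem : (a j - a i) ∈ Set.range (fun j : {x : faceIdx a w // x ≠ ⟨i, hi⟩} => (a j -ᵥ a i : Fin n → ℝ)) := ⟨j, rfl⟩
    have := b.constr_basis ℝ (fun _ => (-1 : ℝ)) ⟨_, h.linearIndepOn_id.subset_extend _ hmem⟩
    rwa [Module.Basis.extend_apply_self] at this
  obtain ⟨v, rfl⟩ := exists_dotL f
  refine ⟨v, fun j hj hji => ?_⟩
  have := hf ⟨⟨j, hj⟩, fun h => hji (congrArg Subtype.val h)⟩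
  rw [map_sub] at this
  rw [dotL_comm, dotL_comm (a i)]
  exact this

end PartPD1

section PartPD2
open scoped ContDiff Topology ENNReal
open MeasureTheory MvPolynomial Filter

noncomputable def ev {n N : ℕ} (a : Fin N → Fin n → ℝ) (y : Fin n → ℝ) (j : Fin N) : ℝ := Real.exp (dotL (a j) y)

noncomputable def tot {n N : ℕ} (a : Fin N → Fin n → ℝ) (y : Fin n → ℝ) : ℝ := ∑ j, ev a y j

noncomputable def xi {n N : ℕ} (a : Fin N → Fin n → ℝ) (y : Fin n → ℝ) (j : Fin N) : ℝ := ev a y j / tot a y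

theorem continuous_dotL {n : ℕ} (w : Fin n → ℝ) : Continuous (dotL w) := by
  simp only [dotL, LinearMap.coe_mk, AddHom.coe_mk]; fun_prop

theorem ev_pos {n N : ℕ} (a : Fin N → Fin n → ℝ) (y : Fin n → ℝ) (j : Fin N) : 0 < ev a y j := Real.exp_pos _

theorem tot_pos {n N : ℕ} [Nonempty (Fin N)] (a : Fin N → Fin n → ℝ) (y : Fin n → ℝ) : 0 < tot a y :=
  Finset.sum_pos (fun j _ => ev_pos a y j) Finset.univ_nonempty

theorem xi_pos {n N : ℕ} [Nonempty (Fin N)] (a : Fin N → Fin n → ℝ) (y : Fin n → ℝ) (j : Fin N) : 0 < xi a y j :=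
  div_pos (ev_pos a y j) (tot_pos a y)

theorem xi_sum {n N : ℕ} [Nonempty (Fin N)] (a : Fin N → Fin n → ℝ) (y : Fin n → ℝ) : ∑ j, xi a y j = 1 := by
  simp only [xi]
  rw [← Finset.sum_div]
  exact div_self (tot_pos a y).ne'

theorem xi_le_one {n N : ℕ} [Nonempty (Fin N)] (a : Fin N → Fin n → ℝ) (y : Fin n → ℝ) (j : Fin N) : xi a y j ≤ 1 := by
  rw [← xi_sum a y]
  exact Finset.single_le_sum (fun i _ => (xi_pos a y i).le) (Finset.mem_univ j)

theorem continuous_ev {n N : ℕ} (a : Fin N → Fin n → ℝ) (j : Fin N) : Continuous (fun y => ev a y j) :=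
  Real.continuous_exp.comp (continuous_dotL _)

theorem continuous_tot {n N : ℕ} (a : Fin N → Fin n → ℝ) : Continuous (tot a) :=
  continuous_finsetSum _ fun j _ => continuous_ev a j

theorem continuous_xi {n N : ℕ} [Nonempty (Fin N)] (a : Fin N → Fin n → ℝ) : Continuous (xi a) :=
  continuous_pi fun j => (continuous_ev a j).div (continuous_tot a) fun y => (tot_pos a y).ne'

theorem compact_xi {n N : ℕ} [Nonempty (Fin N)] (a : Fin N → Fin n → ℝ) : IsCompact (closure (Set.range (xi a))) := by
  refine Bornology.IsBounded.isCompact_closure ?_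
  refine (Metric.isBounded_closedBall (x := (0 : Fin N → ℝ)) (r := 1)).subset ?_
  rintro _ ⟨y, rfl⟩
  rw [mem_closedBall_zero_iff, pi_norm_le_iff_of_nonneg zero_le_one]
  intro j
  rw [Real.norm_of_nonneg (xi_pos a y j).le]
  exact xi_le_one a y j

theorem infinity_lim {n N : ℕ} [Nonempty (Fin N)] (a : Fin N → Fin n → ℝ) (u : ℕ → Fin n → ℝ)
    (hu : Tendsto (fun k => ‖u k‖) atTop atTop) :
    ∃ φ : ℕ → ℕ, StrictMono φ ∧ ∃ (w : Fin n → ℝ) (ξ : Fin N → ℝ), w ≠ 0 ∧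
      Tendsto (fun k => xi a (u (φ k))) atTop (𝓝 ξ) ∧ (∀ j ∉ faceIdx a w, ξ j = 0) ∧ (∀ j, 0 ≤ ξ j) ∧ ∑ j, ξ j = 1 := by
  obtain ⟨w, hw, φ, hφ, hlim⟩ := tendsto_subseq_of_bounded (Metric.isBounded_closedBall (x := (0 : Fin n → ℝ)) (r := 1))
    (x := fun k => ‖u k‖⁻¹ • u k) (fun k => by
      rw [mem_closedBall_zero_iff, norm_smul, norm_inv, norm_norm]
      exact inv_mul_le_one)
  obtain ⟨ξ, hξ, ψ, hψ, hlim2⟩ := (compact_xi a).tendsto_subseq (x := fun k => xi a (u (φ k)))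
    (fun k => subset_closure ⟨_, rfl⟩)
  have hu' : Tendsto (fun k => ‖u (φ (ψ k))‖) atTop atTop := hu.comp (hφ.tendsto_atTop.comp hψ.tendsto_atTop)
  have hlim' : Tendsto (fun k => ‖u (φ (ψ k))‖⁻¹ • u (φ (ψ k))) atTop (𝓝 w) := hlim.comp hψ.tendsto_atTop
  have hpt : ∀ j, Tendsto (fun k => xi a (u (φ (ψ k))) j) atTop (𝓝 (ξ j)) := fun j => (tendsto_pi_nhds.1 hlim2) j
  refine ⟨φ ∘ ψ, hφ.comp hψ, w, ξ, ?_, hlim2, ?_, ?_, ?_⟩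
  · have h1 : Tendsto (fun k => ‖‖u (φ (ψ k))‖⁻¹ • u (φ (ψ k))‖) atTop (𝓝 ‖w‖) := hlim'.norm
    have h2 : (fun k => ‖‖u (φ (ψ k))‖⁻¹ • u (φ (ψ k))‖) =ᶠ[atTop] fun _ => (1 : ℝ) := by
      filter_upwards [hu'.eventually_gt_atTop 0] with k hk
      rw [norm_smul, norm_inv, norm_norm, inv_mul_cancel₀ hk.ne']
    have := tendsto_nhds_unique (h1.congr' h2) tendsto_const_nhds
    intro h0
    rw [h0, norm_zero] at this
    exact zero_ne_one this
  · intro j hj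
    rw [mem_faceIdx] at hj
    push Not at hj
    obtain ⟨i, hi⟩ := hj
    refine tendsto_nhds_unique (hpt j) ?_
    have hexp : Tendsto (fun k => dotL (a j) (u (φ (ψ k))) - dotL (a i) (u (φ (ψ k)))) atTop atBot := by
      have h1 : Tendsto (fun k => dotL (a j) (‖u (φ (ψ k))‖⁻¹ • u (φ (ψ k))) - dotL (a i) (‖u (φ (ψ k))‖⁻¹ • u (φ (ψ k)))) atTop
          (𝓝 (dotL (a j) w - dotL (a i) w)) :=
        (((continuous_dotL (a j)).tendsto w).comp hlim').sub (((continuous_dotL (a i)).tendsto w).comp hlim')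
      have h2 := hu'.atTop_mul_neg (sub_neg.2 hi) h1
      refine h2.congr' ?_
      filter_upwards [hu'.eventually_gt_atTop 0] with k hk
      simp only [map_smul, smul_eq_mul]
      field_simp
    have h3 := Real.tendsto_exp_atBot.comp hexp
    refine squeeze_zero (fun k => (xi_pos a _ j).le) (fun k => ?_) h3
    simp only [Function.comp_apply, xi, Real.exp_sub]
    exact div_le_div_of_nonneg_left (ev_pos a _ j).le (ev_pos a _ i)
      (Finset.single_le_sum (f := fun i => ev a (u (φ (ψ k))) i) (fun i _ => (ev_pos a _ i).le) (Finset.mem_univ i))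
  · intro j
    exact ge_of_tendsto' (hpt j) fun k => (xi_pos a _ j).le
  · have h1 : Tendsto (fun k => ∑ j, xi a (u (φ (ψ k))) j) atTop (𝓝 (∑ j, ξ j)) := tendsto_finsetSum _ fun j _ => hpt j
    simp only [xi_sum] at h1
    exact (tendsto_nhds_unique h1 tendsto_const_nhds)

def UU {n N : ℕ} (a : Fin N → Fin n → ℝ) : Set (Fin N → ℝ) :=
  {c | (∀ j, c j ≠ 0) ∧ ∀ ξ ∈ closure (Set.range (xi a)), ((∑ j, c j * ξ j, fun i => ∑ j, c j * ξ j * a j i) : ℝ × (Fin n → ℝ)) ≠ 0}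

theorem isOpen_UU {n N : ℕ} [Nonempty (Fin N)] (a : Fin N → Fin n → ℝ) : IsOpen (UU a) := by
  rw [isOpen_iff_eventually]
  rintro c ⟨h1, h2⟩
  have e1 : ∀ᶠ c' in 𝓝 c, ∀ j, c' j ≠ 0 := by
    rw [eventually_all]
    intro j
    exact (continuous_apply j).continuousAt.eventually_ne (h1 j)
  have e2 := IsCompact.eventually_forall_of_forall_eventually (x₀ := c) (compact_xi a)
    (P := fun c ξ => ((∑ j, c j * ξ j, fun i => ∑ j, c j * ξ j * a j i) : ℝ × (Fin n → ℝ)) ≠ 0) (by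
      intro ξ hξ
      have hc : Continuous (fun z : (Fin N → ℝ) × (Fin N → ℝ) =>
        ((∑ j, z.1 j * z.2 j, fun i => ∑ j, z.1 j * z.2 j * a j i) : ℝ × (Fin n → ℝ))) := by fun_prop
      exact hc.continuousAt.eventually_ne (h2 ξ hξ))
  filter_upwards [e1, e2] with c' h1 h2
  exact ⟨h1, h2⟩

noncomputable def TL {n N : ℕ} (a : Fin N → Fin n → ℝ) : (Fin N → ℝ) →ₗ[ℝ] (ℝ × (Fin n → ℝ)) :=
  { toFun := fun d => (∑ j, d j, fun i => ∑ j, d j * a j i)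
    map_add' := by
      intro x y
      ext <;> simp [add_mul, Finset.sum_add_distrib]
    map_smul' := by
      intro c x
      ext <;> simp [Finset.mul_sum, mul_assoc] }

theorem TL_surj {n N : ℕ} [Nonempty (Fin N)] (a : Fin N → Fin n → ℝ) (ha : NotAllInAffineHyperplane a) :
    LinearMap.range (TL a) = ⊤ := by
  by_contra h
  obtain ⟨f, hf, hker⟩ := Submodule.exists_le_ker_of_lt_top _ (lt_top_iff_ne_top.2 h)
  obtain ⟨w, hw⟩ := exists_dotL (f.comp (LinearMap.inr ℝ ℝ (Fin n → ℝ)))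
  have hfe : ∀ t y, f (t, y) = t * f (1, 0) + dotL w y := by
    intro t y
    have h1 : f (0, y) = dotL w y := by rw [← hw]; simp
    have h2 : ((t, y) : ℝ × (Fin n → ℝ)) = t • ((1, 0) : ℝ × (Fin n → ℝ)) + (0, y) := by ext <;> simp
    rw [h2, map_add, map_smul, h1, smul_eq_mul]
  have hj : ∀ j, f (1, 0) + dotL w (a j) = 0 := by
    intro j
    have : TL a (Pi.single j 1) = (1, a j) := by
      ext <;> simp [TL, Pi.single_apply]
    have h1 : f (1, a j) = 0 := by
      rw [← this]; exact hker ⟨_, rfl⟩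
    rw [hfe] at h1; simpa using h1
  by_cases hw0 : w = 0
  · obtain ⟨j⟩ := ‹Nonempty (Fin N)›
    have h1 : f (1, 0) = 0 := by simpa [hw0, dotL_apply] using hj j
    apply hf
    refine LinearMap.ext fun z => ?_
    obtain ⟨t, y⟩ := z
    rw [hfe, h1, hw0]; simp [dotL_apply]
  · exact ha ⟨w, - f (1, 0), hw0, fun j => by have := hj j; rw [dotL_apply] at this; linarith⟩

theorem dense_UU {n N : ℕ} [Nonempty (Fin N)] (a : Fin N → Fin n → ℝ) (ha : NotAllInAffineHyperplane a)
    (hcs : CombSimplicial a) : Dense (UU a) := by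
  let K0 := LinearMap.ker (TL a)
  let Ψ : (Fin n → ℝ) × K0 → (Fin N → ℝ) := fun z j => (z.2 : Fin N → ℝ) j * Real.exp (- dotL (a j) z.1)
  have hΨ : ContDiff ℝ 1 Ψ := by
    rw [contDiff_pi]
    intro j
    refine ContDiff.mul ?_ ?_
    · exact (contDiff_apply ℝ ℝ j).comp ((K0.subtypeL.contDiff).comp contDiff_snd)
    · refine ContDiff.exp (ContDiff.neg ?_)
      simp only [dotL, LinearMap.coe_mk, AddHom.coe_mk]
      fun_prop
  have hdim : Module.finrank ℝ ((Fin n → ℝ) × K0) < Module.finrank ℝ (Fin N → ℝ) := by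
    have h1 := LinearMap.finrank_range_add_finrank_ker (TL a)
    rw [TL_surj a ha, finrank_top] at h1
    simp only [Module.finrank_prod, Module.finrank_self, Module.finrank_fin_fun] at h1 ⊢
    show n + Module.finrank ℝ (LinearMap.ker (TL a)) < N
    omega
  have hd1 := hΨ.dense_compl_range_of_finrank_lt_finrank hdim
  have hset : {c : Fin N → ℝ | ∀ j, c j ≠ 0} = Set.pi Set.univ (fun _ => ({0}ᶜ : Set ℝ)) := by
    ext c; simp
  have ho : IsOpen {c : Fin N → ℝ | ∀ j, c j ≠ 0} := by
    rw [hset]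
    exact isOpen_set_pi Set.finite_univ fun j _ => isOpen_compl_singleton
  have hd2 : Dense {c : Fin N → ℝ | ∀ j, c j ≠ 0} := by
    rw [hset]
    exact dense_pi _ fun j _ => dense_compl_singleton 0
  refine (hd2.inter_of_isOpen_left hd1 ho).mono ?_
  rintro c ⟨hc, hcr⟩
  refine ⟨hc, fun ξ hξ h0 => ?_⟩
  rw [Prod.mk_eq_zero] at h0
  obtain ⟨h0, h1⟩ := h0
  have h1 : ∀ i, ∑ j, c j * ξ j * a j i = 0 := fun i => congrFun h1 i
  obtain ⟨x, hx, hxl⟩ := mem_closure_iff_seq_limit.1 hξ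
  choose u hu using hx
  have hul : Tendsto (fun k => xi a (u k)) atTop (𝓝 ξ) := by simpa [hu] using hxl
  by_cases hb : ∃ R, ∃ᶠ k in atTop, u k ∈ Metric.closedBall (0 : Fin n → ℝ) R
  · obtain ⟨R, hR⟩ := hb
    obtain ⟨y, -, φ, hφ, hy⟩ := tendsto_subseq_of_frequently_bounded Metric.isBounded_closedBall hR
    have hξy : ξ = xi a y := tendsto_nhds_unique (hul.comp hφ.tendsto_atTop)
      (((continuous_xi a).tendsto y).comp hy)
    apply hcr
    have ht := (tot_pos a y).ne'
    have key : ∀ j, c j * ev a y j = tot a y * (c j * ξ j) := by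
      intro j; rw [hξy, xi]; field_simp
    refine ⟨(y, ⟨fun j => c j * ev a y j, ?_⟩), ?_⟩
    · rw [LinearMap.mem_ker]
      simp only [TL, LinearMap.coe_mk, AddHom.coe_mk, key, Prod.mk_eq_zero]
      constructor
      · rw [← Finset.mul_sum, h0, mul_zero]
      · ext i
        simp only [mul_assoc (tot a y)]
        rw [← Finset.mul_sum, h1, mul_zero]; rfl
    · ext j
      simp only [Ψ, ev]
      rw [mul_assoc, ← Real.exp_add]; simp
  · push Not at hb
    have hu' : Tendsto (fun k => ‖u k‖) atTop atTop := by
      rw [tendsto_atTop]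
      intro R
      have := hb R
      filter_upwards [this] with k hk
      rw [mem_closedBall_zero_iff] at hk
      exact (not_le.1 hk).le
    obtain ⟨φ, hφ, w, ξ', hw, hlim, hsupp, -, hsum⟩ := infinity_lim a u hu'
    have hξ' : ξ = ξ' := tendsto_nhds_unique (hul.comp hφ.tendsto_atTop) hlim
    subst hξ'
    have := face_zero a ha hcs w hw (fun j => c j * ξ j) (fun j hj => by simp [hsupp j hj]) h0 h1
    have hz : ∀ j, ξ j = 0 := fun j => by
      have := congrFun this j
      simpa [hc j] using this
    simp [hz] at hsum

end PartPD2

section PartPD3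
open scoped ContDiff Topology ENNReal
open MeasureTheory MvPolynomial Filter

theorem expSum_eq {n N : ℕ} (a : Fin N → Fin n → ℝ) (c : Fin N → ℝ) (y : Fin n → ℝ) :
    expSum a c y = ∑ j, c j * ev a y j := rfl

theorem continuous_expSum {n N : ℕ} (a : Fin N → Fin n → ℝ) (c : Fin N → ℝ) : Continuous (expSum a c) := by
  have : expSum a c = fun y => ∑ j, c j * ev a y j := rfl
  rw [this]
  exact continuous_finsetSum _ fun j _ => continuous_const.mul (continuous_ev a j)

def Reg {n N : ℕ} (a : Fin N → Fin n → ℝ) (c : Fin N → ℝ) (i : Fin N) : Set (Fin n → ℝ) :=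
  {y | ∑ j ∈ Finset.univ.erase i, |c j| * ev a y j < |c i| * ev a y i}

theorem Reg_convex {n N : ℕ} (a : Fin N → Fin n → ℝ) (c : Fin N → ℝ) (i : Fin N) : Convex ℝ (Reg a c i) := by
  have : Reg a c i = {y | y ∈ Set.univ ∧ ∑ j ∈ Finset.univ.erase i, |c j| * Real.exp ((dotL (a j) - dotL (a i)) y) < |c i|} := by
    ext y
    simp only [Reg, Set.mem_ofPred_eq, Set.mem_univ, true_and, LinearMap.sub_apply, Real.exp_sub]
    have hp := ev_pos a y i
    have e : ∑ j ∈ Finset.univ.erase i, |c j| * (Real.exp (dotL (a j) y) / Real.exp (dotL (a i) y)) =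
        (∑ j ∈ Finset.univ.erase i, |c j| * ev a y j) / ev a y i := by
      rw [Finset.sum_div]
      exact Finset.sum_congr rfl fun j _ => by rw [mul_div_assoc]; rfl
    rw [e, div_lt_iff₀ hp]
  rw [this]
  apply ConvexOn.convex_lt
  have h : ∀ j, ConvexOn ℝ Set.univ (fun y => |c j| * Real.exp ((dotL (a j) - dotL (a i)) y)) := by
    intro j
    have h1 := (convexOn_exp.comp_linearMap (dotL (a j) - dotL (a i))).smul (abs_nonneg (c j))
    simpa using h1
  have h2 : ∀ s : Finset (Fin N), ConvexOn ℝ Set.univ (fun y => ∑ j ∈ s, |c j| * Real.exp ((dotL (a j) - dotL (a i)) y)) := by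
    intro s
    induction s using Finset.cons_induction with
    | empty => simpa using convexOn_const (0:ℝ) convex_univ
    | cons b s hb ih =>
      simp only [Finset.sum_cons]
      exact (h b).add ih
  exact h2 _

theorem Reg_ne {n N : ℕ} (a : Fin N → Fin n → ℝ) (c : Fin N → ℝ) (i : Fin N) (y : Fin n → ℝ) (hy : y ∈ Reg a c i) :
    expSum a c y ≠ 0 := by
  intro h
  rw [expSum_eq, ← Finset.add_sum_erase _ _ (Finset.mem_univ i)] at h
  have h1 : |c i| * ev a y i = |∑ j ∈ Finset.univ.erase i, c j * ev a y j| := by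
    have e : c i * ev a y i = -∑ j ∈ Finset.univ.erase i, c j * ev a y j := by linarith
    calc |c i| * ev a y i = |c i * ev a y i| := by rw [abs_mul, abs_of_pos (ev_pos a y i)]
      _ = _ := by rw [e, abs_neg]
  have h2 : |∑ j ∈ Finset.univ.erase i, c j * ev a y j| ≤ ∑ j ∈ Finset.univ.erase i, |c j| * ev a y j := by
    refine (Finset.abs_sum_le_sum_abs _ _).trans (le_of_eq ?_)
    exact Finset.sum_congr rfl fun j _ => by rw [abs_mul, abs_of_pos (ev_pos a y j)]
  have h3 : ∑ j ∈ Finset.univ.erase i, |c j| * ev a y j < |c i| * ev a y i := hy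
  linarith

theorem bern (p t : ℝ) (hp : 1 ≤ p) (ht : 0 ≤ t) : Real.exp (-t) - Real.exp (-p * t) ≤ (p - 1) * (1 - Real.exp (-t)) := by
  have h := one_add_mul_self_le_rpow_one_add (s := Real.exp (-t) - 1) (by linarith [Real.exp_pos (-t)]) hp
  rw [add_sub_cancel, ← Real.exp_mul] at h
  have : -t * p = -p * t := by ring
  rw [this] at h
  linarith

theorem ev_add {n N : ℕ} (a : Fin N → Fin n → ℝ) (y d : Fin n → ℝ) (t : ℝ) (j : Fin N) :
    ev a (y + t • d) j = ev a y j * Real.exp (t * dotL (a j) d) := by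
  simp only [ev, map_add, map_smul, smul_eq_mul, Real.exp_add]

theorem unb_pos {n N : ℕ} [Nonempty (Fin N)] (a : Fin N → Fin n → ℝ) (ha : NotAllInAffineHyperplane a) (hcs : CombSimplicial a)
    (c : Fin N → ℝ) (hc : ∀ j, c j ≠ 0) (W : Set (Fin n → ℝ)) (hW : ¬ Bornology.IsBounded W)
    (hpos : ∀ y ∈ W, 0 < expSum a c y)
    (hmax : ∀ s : Set (Fin n → ℝ), IsPreconnected s → (s ∩ W).Nonempty → (∀ y ∈ s, expSum a c y ≠ 0) → s ⊆ W) :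
    ∃ i, (W ∩ Reg a c i).Nonempty := by
  have : ∀ k : ℕ, ∃ y ∈ W, (k : ℝ) < ‖y‖ := by
    intro k
    by_contra! h
    apply hW
    exact (Metric.isBounded_closedBall (x := (0 : Fin n → ℝ)) (r := k)).subset fun y hy => by
      rw [mem_closedBall_zero_iff]; exact h y hy
  choose u huW hu using this
  have hu' : Tendsto (fun k => ‖u k‖) atTop atTop :=
    tendsto_atTop_mono (fun k => (hu k).le) tendsto_natCast_atTop_atTop
  obtain ⟨φ, hφ, w, ξ, hw, hlim, hsupp, hξ0, hsum⟩ := infinity_lim a u hu'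
  have hpt : ∀ j, Tendsto (fun k => xi a (u (φ k)) j) atTop (𝓝 (ξ j)) := fun j => (tendsto_pi_nhds.1 hlim) j
  have hge : 0 ≤ ∑ j, c j * ξ j := by
    have h1 : Tendsto (fun k => ∑ j, c j * xi a (u (φ k)) j) atTop (𝓝 (∑ j, c j * ξ j)) :=
      tendsto_finsetSum _ fun j _ => (hpt j).const_mul _
    refine ge_of_tendsto' h1 fun k => ?_
    have h2 : ∑ j, c j * xi a (u (φ k)) j = expSum a c (u (φ k)) / tot a (u (φ k)) := by
      rw [expSum_eq, Finset.sum_div]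
      exact Finset.sum_congr rfl fun j _ => by rw [xi, mul_div_assoc]
    rw [h2]
    exact (div_pos (hpos _ (huW _)) (tot_pos a _)).le
  obtain ⟨i, hci, hξi⟩ : ∃ i, 0 < c i ∧ 0 < ξ i := by
    by_contra! hcon
    have h1 : ∀ j, c j * ξ j ≤ 0 := by
      intro j
      rcases lt_or_gt_of_ne (hc j) with h | h
      · exact mul_nonpos_of_nonpos_of_nonneg h.le (hξ0 j)
      · exact mul_nonpos_of_nonneg_of_nonpos h.le (hcon j h)
    have h2 := (Finset.sum_eq_zero_iff_of_nonpos (fun j _ => h1 j)).1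
      (le_antisymm (Finset.sum_nonpos fun j _ => h1 j) hge)
    have h3 : ∀ j, ξ j = 0 := fun j => by simpa [hc j] using h2 j (Finset.mem_univ j)
    simp [h3] at hsum
  have hif : i ∈ faceIdx a w := by
    by_contra h; rw [hsupp i h] at hξi; exact lt_irrefl _ hξi
  obtain ⟨v, hv⟩ := face_dir a ha hcs w hw i hif
  have hface0 : ∀ j ∈ faceIdx a w, dotL (a j) w = dotL (a i) w := fun j hj =>
    le_antisymm ((mem_faceIdx a w i).1 hif j) ((mem_faceIdx a w j).1 hj i)
  have hnf : ∀ j ∉ faceIdx a w, dotL (a j) w < dotL (a i) w := by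
    intro j hj
    rw [mem_faceIdx] at hj
    push Not at hj
    obtain ⟨i', hi'⟩ := hj
    exact hi'.trans_le ((mem_faceIdx a w i).1 hif i')
  -- choose R
  obtain ⟨R, hR⟩ : ∃ R : ℝ, ∀ j ∉ faceIdx a w, dotL (a j) (v + R • w) - dotL (a i) (v + R • w) ≤ -1 := by
    have : ∀ᶠ R : ℝ in atTop, ∀ j, j ∉ faceIdx a w → dotL (a j) (v + R • w) - dotL (a i) (v + R • w) ≤ -1 := by
      rw [eventually_all]
      intro j
      by_cases hj : j ∈ faceIdx a w
      · exact Eventually.of_forall fun R h => absurd hj h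
      · have h1 : Tendsto (fun R : ℝ => R * (dotL (a j) w - dotL (a i) w) + (dotL (a j) v - dotL (a i) v)) atTop atBot :=
          tendsto_atBot_add_const_right _ _ (tendsto_id.atTop_mul_const_of_neg (sub_neg.2 (hnf j hj)))
        filter_upwards [h1.eventually_le_atBot (-1)] with R hR _
        simp only [map_add, map_smul, smul_eq_mul]
        linarith
    exact this.exists
  set d := v + R • w with hd
  let s : Fin N → ℝ := fun j => dotL (a i) d - dotL (a j) d
  have hs1 : ∀ j, j ≠ i → 1 ≤ s j := by
    intro j hji
    by_cases hj : j ∈ faceIdx a w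
    · have := hv j hj hji
      simp only [s, hd, map_add, map_smul, smul_eq_mul, hface0 j hj]
      linarith
    · have := hR j hj; simp only [s]; linarith
  have hsf : ∀ j ∈ faceIdx a w, j ≠ i → s j = 1 := by
    intro j hj hji
    have := hv j hj hji
    simp only [s, hd, map_add, map_smul, smul_eq_mul, hface0 j hj]
    linarith
  -- choose k
  have hk : ∃ k, 0 < c i * xi a (u (φ k)) i - ∑ j ∈ Finset.univ.erase i, |c j| * xi a (u (φ k)) j * (s j - 1) := by
    have h1 : Tendsto (fun k => c i * xi a (u (φ k)) i - ∑ j ∈ Finset.univ.erase i, |c j| * xi a (u (φ k)) j * (s j - 1))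
        atTop (𝓝 (c i * ξ i - ∑ j ∈ Finset.univ.erase i, |c j| * ξ j * (s j - 1))) :=
      ((hpt i).const_mul _).sub (tendsto_finsetSum _ fun j _ => ((hpt j).const_mul _).mul_const _)
    have h2 : ∑ j ∈ Finset.univ.erase i, |c j| * ξ j * (s j - 1) = 0 := by
      refine Finset.sum_eq_zero fun j hj => ?_
      by_cases hjf : j ∈ faceIdx a w
      · rw [hsf j hjf (Finset.ne_of_mem_erase hj)]; ring
      · rw [hsupp j hjf]; ring
    rw [h2, sub_zero] at h1
    exact (h1.eventually (eventually_gt_nhds (mul_pos hci hξi))).exists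
  obtain ⟨k, hk⟩ := hk
  set y := u (φ k) with hy
  have hyW : y ∈ W := huW _
  have hk' : 0 < c i * ev a y i - ∑ j ∈ Finset.univ.erase i, |c j| * ev a y j * (s j - 1) := by
    have h1 : c i * ev a y i - ∑ j ∈ Finset.univ.erase i, |c j| * ev a y j * (s j - 1) =
        tot a y * (c i * xi a y i - ∑ j ∈ Finset.univ.erase i, |c j| * xi a y j * (s j - 1)) := by
      rw [mul_sub, Finset.mul_sum]
      have ht := (tot_pos a y).ne'
      have hx : ∀ j, ev a y j = tot a y * xi a y j := fun j => by rw [xi]; field_simp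
      rw [hx i]
      congr 1
      · ring
      · refine Finset.sum_congr rfl fun j _ => ?_
        rw [hx j]; ring
    rw [h1]
    exact mul_pos (tot_pos a y) hk
  have hg0 := hpos y hyW
  have hev : ∀ (t : ℝ) j, ev a (y + t • d) j = Real.exp (t * dotL (a i) d) * (ev a y j * Real.exp (- s j * t)) := by
    intro t j
    rw [ev_add]
    have : t * dotL (a j) d = t * dotL (a i) d + (- s j * t) := by simp only [s]; ring
    rw [this, Real.exp_add]; ring
  have hray : ∀ t : ℝ, 0 ≤ t → 0 < expSum a c (y + t • d) := by
    intro t ht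
    rw [expSum_eq]
    have h1 : ∑ j, c j * ev a (y + t • d) j = Real.exp (t * dotL (a i) d) * ∑ j, c j * (ev a y j * Real.exp (- s j * t)) := by
      rw [Finset.mul_sum]
      exact Finset.sum_congr rfl fun j _ => by rw [hev]; ring
    rw [h1]
    refine mul_pos (Real.exp_pos _) ?_
    have hτ0 := Real.exp_pos (-t)
    have hτ1 : Real.exp (-t) ≤ 1 := by rw [Real.exp_le_one_iff]; linarith
    set τ := Real.exp (-t) with hτ
    have hi0 : s i = 0 := by simp [s]
    rw [expSum_eq, ← Finset.add_sum_erase _ _ (Finset.mem_univ i)] at hg0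
    rw [← Finset.add_sum_erase _ _ (Finset.mem_univ i), hi0]
    have h2 : ∑ j ∈ Finset.univ.erase i, c j * (ev a y j * Real.exp (- s j * t)) ≥
        τ * ∑ j ∈ Finset.univ.erase i, c j * ev a y j - (1 - τ) * ∑ j ∈ Finset.univ.erase i, |c j| * ev a y j * (s j - 1) := by
      rw [Finset.mul_sum, Finset.mul_sum, ← Finset.sum_sub_distrib]
      refine Finset.sum_le_sum fun j hj => ?_
      have hs := hs1 j (Finset.ne_of_mem_erase hj)
      have hb := bern (s j) t hs ht
      have hb2 : Real.exp (- s j * t) ≤ τ := by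
        rw [hτ, Real.exp_le_exp]; nlinarith
      rw [← hτ] at hb
      have he := ev_pos a y j
      have h3 : c j * (τ - Real.exp (- s j * t)) ≤ |c j| * ((s j - 1) * (1 - τ)) :=
        (mul_le_mul_of_nonneg_right (le_abs_self _) (by linarith)).trans
          (mul_le_mul_of_nonneg_left hb (abs_nonneg _))
      nlinarith [mul_le_mul_of_nonneg_left h3 he.le]
    simp only [neg_zero, zero_mul, Real.exp_zero, mul_one]
    have h4 : 0 < τ * (c i * ev a y i + ∑ j ∈ Finset.univ.erase i, c j * ev a y j) := mul_pos hτ0 hg0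
    have h5 : 0 ≤ (1 - τ) * (c i * ev a y i - ∑ j ∈ Finset.univ.erase i, |c j| * ev a y j * (s j - 1)) :=
      mul_nonneg (by linarith) hk'.le
    nlinarith
  have hsub : (fun t : ℝ => y + t • d) '' Set.Ici 0 ⊆ W := by
    apply hmax
    · exact isPreconnected_Ici.image _ (by fun_prop)
    · exact ⟨y, ⟨0, Set.mem_Ici.2 le_rfl, by simp⟩, hyW⟩
    · rintro _ ⟨t, ht, rfl⟩
      exact (hray t ht).ne'
  obtain ⟨t, ht0, ht⟩ : ∃ t : ℝ, 0 ≤ t ∧ Real.exp (-t) * ∑ j ∈ Finset.univ.erase i, |c j| * ev a y j < |c i| * ev a y i := by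
    have h1 : Tendsto (fun t : ℝ => Real.exp (-t) * ∑ j ∈ Finset.univ.erase i, |c j| * ev a y j) atTop (𝓝 (0 * _)) :=
      (Real.tendsto_exp_neg_atTop_nhds_zero).mul_const _
    rw [zero_mul] at h1
    have h2 : 0 < |c i| * ev a y i := mul_pos (abs_pos.2 (hc i)) (ev_pos a y i)
    obtain ⟨t, h3, h4⟩ := ((h1.eventually (eventually_lt_nhds h2)).and (eventually_ge_atTop 0)).exists
    exact ⟨t, h4, h3⟩
  refine ⟨i, y + t • d, hsub ⟨t, ht0, rfl⟩, ?_⟩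
  show ∑ j ∈ Finset.univ.erase i, |c j| * ev a (y + t • d) j < |c i| * ev a (y + t • d) i
  have hi0 : s i = 0 := by simp [s]
  have h1 : |c i| * ev a (y + t • d) i = Real.exp (t * dotL (a i) d) * (|c i| * ev a y i) := by
    rw [hev, hi0]; simp; ring
  have h2 : ∑ j ∈ Finset.univ.erase i, |c j| * ev a (y + t • d) j ≤
      Real.exp (t * dotL (a i) d) * (Real.exp (-t) * ∑ j ∈ Finset.univ.erase i, |c j| * ev a y j) := by
    rw [Finset.mul_sum, Finset.mul_sum]
    refine Finset.sum_le_sum fun j hj => ?_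
    rw [hev]
    have hs := hs1 j (Finset.ne_of_mem_erase hj)
    have hb2 : Real.exp (- s j * t) ≤ Real.exp (-t) := by
      rw [Real.exp_le_exp]; nlinarith
    have hA : 0 ≤ Real.exp (t * dotL (a i) d) * (|c j| * ev a y j) := by
      have := ev_pos a y j; positivity
    nlinarith [mul_le_mul_of_nonneg_left hb2 hA]
  rw [h1]
  exact h2.trans_lt (mul_lt_mul_of_pos_left ht (Real.exp_pos _))

end PartPD3

section PartPD4
open scoped ContDiff Topology ENNReal
open MeasureTheory MvPolynomial Filter

def Wc {E : Type*} [TopologicalSpace E] (g : E → ℝ) (q : ConnectedComponents {y : E // g y ≠ 0}) : Set E :=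
  {y | ∃ h : g y ≠ 0, (ConnectedComponents.mk (⟨y, h⟩ : {y : E // g y ≠ 0})) = q}

theorem Wc_nonempty {E : Type*} [TopologicalSpace E] (g : E → ℝ) (q : ConnectedComponents {y : E // g y ≠ 0}) :
    (Wc g q).Nonempty := by
  obtain ⟨⟨y, h⟩, rfl⟩ := ConnectedComponents.surjective_coe q
  exact ⟨y, h, rfl⟩

theorem Wc_ne {E : Type*} [TopologicalSpace E] (g : E → ℝ) (q : ConnectedComponents {y : E // g y ≠ 0}) :
    ∀ y ∈ Wc g q, g y ≠ 0 := fun _ h => h.1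

theorem Wc_unique {E : Type*} [TopologicalSpace E] (g : E → ℝ) (q q' : ConnectedComponents {y : E // g y ≠ 0}) (y : E)
    (h : y ∈ Wc g q) (h' : y ∈ Wc g q') : q = q' := by
  obtain ⟨_, h⟩ := h
  obtain ⟨_, h'⟩ := h'
  exact h.symm.trans h'

theorem Wc_max {E : Type*} [TopologicalSpace E] (g : E → ℝ) (q : ConnectedComponents {y : E // g y ≠ 0})
    (s : Set E) (hs : IsPreconnected s) (hn : (s ∩ Wc g q).Nonempty) (hg : ∀ y ∈ s, g y ≠ 0) : s ⊆ Wc g q := by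
  obtain ⟨y0, hy0, h0, rfl⟩ := hn
  intro y hy
  refine ⟨hg y hy, ?_⟩
  rw [ConnectedComponents.coe_eq_coe']
  have e : Subtype.val '' (Subtype.val ⁻¹' s : Set {y : E // g y ≠ 0}) = s := by
    ext z; constructor
    · rintro ⟨w, hw, rfl⟩; exact hw
    · exact fun h => ⟨⟨z, hg z h⟩, h, rfl⟩
  have hp : IsPreconnected (Subtype.val ⁻¹' s : Set {y : E // g y ≠ 0}) := by
    have hi : Topology.IsInducing (Subtype.val : {y : E // g y ≠ 0} → E) := ⟨rfl⟩
    rw [← hi.isPreconnected_image, e]; exact hs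
  have hh : (⟨y, hg y hy⟩ : {y : E // g y ≠ 0}) ∈ (Subtype.val ⁻¹' s : Set {y : E // g y ≠ 0}) := hy
  exact hp.subset_connectedComponent (x := ⟨y0, h0⟩) hy0 hh

theorem Wc_preconn {E : Type*} [TopologicalSpace E] (g : E → ℝ) (q : ConnectedComponents {y : E // g y ≠ 0}) :
    IsPreconnected (Wc g q) := by
  obtain ⟨x, rfl⟩ := ConnectedComponents.surjective_coe q
  have : Wc g (ConnectedComponents.mk x) = Subtype.val '' (connectedComponent x) := by
    ext y
    constructor
    · rintro ⟨h, h'⟩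
      exact ⟨⟨y, h⟩, ConnectedComponents.coe_eq_coe'.1 h', rfl⟩
    · rintro ⟨z, hz, rfl⟩
      exact ⟨z.2, ConnectedComponents.coe_eq_coe'.2 hz⟩
  rw [this]
  exact isPreconnected_connectedComponent.image _ continuous_subtype_val.continuousOn

theorem Wc_sign {E : Type*} [TopologicalSpace E] (g : E → ℝ) (hgc : Continuous g) (q : ConnectedComponents {y : E // g y ≠ 0}) :
    (∀ y ∈ Wc g q, 0 < g y) ∨ (∀ y ∈ Wc g q, g y < 0) := by
  by_contra! h
  obtain ⟨⟨y, hy, h1⟩, z, hz, h2⟩ := h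
  have := ((Wc_preconn g q).image g hgc.continuousOn).ordConnected.out (Set.mem_image_of_mem _ hy) (Set.mem_image_of_mem _ hz)
  obtain ⟨x, hx, h0⟩ := this ⟨h1, h2⟩
  exact Wc_ne g q x hx h0

theorem Wc_nhds {n : ℕ} (g : (Fin n → ℝ) → ℝ) (hgc : Continuous g) (q : ConnectedComponents {y : Fin n → ℝ // g y ≠ 0})
    (z : Fin n → ℝ) (hz : z ∈ closure (Wc g q)) (hg : g z ≠ 0) : Wc g q ∈ 𝓝 z := by
  have ho : IsOpen {y | g y ≠ 0} := isOpen_ne.preimage hgc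
  obtain ⟨ε, hε, hb⟩ := Metric.isOpen_iff.1 ho z hg
  refine mem_of_superset (Metric.ball_mem_nhds z hε) ?_
  apply Wc_max g q _ (convex_ball z ε).isPreconnected
  · obtain ⟨y, hy, h⟩ := Metric.mem_closure_iff.1 hz ε hε
    exact ⟨y, by rw [Metric.mem_ball, dist_comm]; exact h, hy⟩
  · exact fun y hy => hb hy

theorem Reg_neg {n N : ℕ} (a : Fin N → Fin n → ℝ) (c : Fin N → ℝ) (i : Fin N) : Reg a (-c) i = Reg a c i := by
  simp [Reg]

theorem expSum_neg {n N : ℕ} (a : Fin N → Fin n → ℝ) (c : Fin N → ℝ) (y) : expSum a (-c) y = - expSum a c y := by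
  simp [expSum]

theorem unb {n N : ℕ} [Nonempty (Fin N)] (a : Fin N → Fin n → ℝ) (ha : NotAllInAffineHyperplane a) (hcs : CombSimplicial a)
    (c : Fin N → ℝ) (hc : ∀ j, c j ≠ 0) (q : ConnectedComponents {y : Fin n → ℝ // expSum a c y ≠ 0})
    (hW : ¬ Bornology.IsBounded (Wc (expSum a c) q)) : ∃ i, (Wc (expSum a c) q ∩ Reg a c i).Nonempty := by
  rcases Wc_sign _ (continuous_expSum a c) q with h | h
  · exact unb_pos a ha hcs c hc _ hW h (Wc_max _ q)
  · have := unb_pos a ha hcs (-c) (fun j => by simpa using hc j) _ hW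
      (fun y hy => by rw [expSum_neg]; linarith [h y hy])
      (fun s h1 h2 h3 => Wc_max _ q s h1 h2 fun y hy => by simpa [expSum_neg] using h3 y hy)
    simpa [Reg_neg] using this

theorem comp_count {n N : ℕ} [Nonempty (Fin N)] (a : Fin N → Fin n → ℝ) (ha : NotAllInAffineHyperplane a) (hcs : CombSimplicial a)
    (c : Fin N → ℝ) (hc : ∀ j, c j ≠ 0) (r : ℕ)
    (hr : ∀ Q : Finset (ConnectedComponents {y : Fin n → ℝ // expSum a c y ≠ 0}),
      (∀ q ∈ Q, Bornology.IsBounded (Wc (expSum a c) q)) → Q.card ≤ r) :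
    Finite (ConnectedComponents {y : Fin n → ℝ // expSum a c y ≠ 0}) ∧
      Nat.card (ConnectedComponents {y : Fin n → ℝ // expSum a c y ≠ 0}) ≤ N + r := by
  classical
  have key : ∀ Q : Finset (ConnectedComponents {y : Fin n → ℝ // expSum a c y ≠ 0}), Q.card ≤ N + r := by
    intro Q
    rw [← Finset.card_filter_add_card_filter_not (s := Q) (p := fun q => Bornology.IsBounded (Wc (expSum a c) q)), add_comm]
    refine add_le_add ?_ (hr _ fun q hq => (Finset.mem_filter.1 hq).2)
    have h1 : ∀ q ∈ Q.filter (fun q => ¬ Bornology.IsBounded (Wc (expSum a c) q)), ∃ i, (Wc (expSum a c) q ∩ Reg a c i).Nonempty :=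
      fun q hq => unb a ha hcs c hc q (Finset.mem_filter.1 hq).2
    choose! f hf using h1
    have h2 := Finset.card_le_card_of_injOn (t := (Finset.univ : Finset (Fin N))) f (fun q _ => Finset.mem_univ _) (by
      intro q hq q' hq' he
      have e1 := hf q hq
      have e2 := hf q' hq'
      rw [← he] at e2
      obtain ⟨y, hy, hyR⟩ := e1
      obtain ⟨y', hy', hyR'⟩ := e2
      have h3 : Reg a c (f q) ⊆ Wc (expSum a c) q :=
        Wc_max _ q _ (Reg_convex a c _).isPreconnected ⟨y, hyR, hy⟩ (Reg_ne a c _)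
      exact Wc_unique _ _ _ y' (h3 hyR') hy')
    simpa using h2
  have hfin : Finite (ConnectedComponents {y : Fin n → ℝ // expSum a c y ≠ 0}) := by
    by_contra h
    rw [not_finite_iff_infinite] at h
    obtain ⟨Q, hQ⟩ := Infinite.exists_subset_card_eq (ConnectedComponents {y : Fin n → ℝ // expSum a c y ≠ 0}) (N + r + 1)
    have := key Q
    omega
  refine ⟨hfin, ?_⟩
  have := Fintype.ofFinite (ConnectedComponents {y : Fin n → ℝ // expSum a c y ≠ 0})
  rw [Nat.card_eq_fintype_card]
  exact key Finset.univ

theorem sign_near {n N : ℕ} [Nonempty (Fin N)] (a : Fin N → Fin n → ℝ) (c : Fin N → ℝ) (hc : c ∈ UU a) (z : Fin n → ℝ)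
    (hz : expSum a c z = 0) : z ∈ closure {y | 0 < expSum a c y} := by
  have h0 : ∑ j, c j * xi a z j = 0 := by
    have : ∑ j, c j * xi a z j = expSum a c z / tot a z := by
      rw [expSum_eq, Finset.sum_div]
      exact Finset.sum_congr rfl fun j _ => by rw [xi, mul_div_assoc]
    rw [this, hz, zero_div]
  have h1 := hc.2 _ (subset_closure ⟨z, rfl⟩)
  have h2 : (fun i => ∑ j, c j * xi a z j * a j i) ≠ 0 := by
    intro h; apply h1; rw [h, h0]; rfl
  set d : Fin n → ℝ := fun i => ∑ j, c j * xi a z j * a j i with hd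
  have hd2 : 0 < ∑ i, d i * d i := by
    obtain ⟨i, hi⟩ := Function.ne_iff.1 h2
    exact Finset.sum_pos' (fun i _ => mul_self_nonneg _) ⟨i, Finset.mem_univ _, mul_self_pos.2 hi⟩
  have h3 : ∑ j, c j * ev a z j * dotL (a j) d = tot a z * ∑ i, d i * d i := by
    simp only [dotL_apply, Finset.mul_sum]
    rw [Finset.sum_comm]
    refine Finset.sum_congr rfl fun i _ => ?_
    have : d i = ∑ j, c j * xi a z j * a j i := rfl
    conv_rhs => rw [this]
    rw [Finset.sum_mul, Finset.mul_sum]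
    refine Finset.sum_congr rfl fun j _ => ?_
    have ht := (tot_pos a z).ne'
    have hx : ev a z j = tot a z * xi a z j := by rw [xi]; field_simp
    rw [hx]
    ring
  have hder : HasDerivAt (fun t : ℝ => expSum a c (z + t • d)) (tot a z * ∑ i, d i * d i) 0 := by
    rw [← h3]
    have : (fun t : ℝ => expSum a c (z + t • d)) = fun t => ∑ j, c j * (ev a z j * Real.exp (t * dotL (a j) d)) := by
      funext t
      rw [expSum_eq]
      exact Finset.sum_congr rfl fun j _ => by rw [ev_add]
    rw [this]
    apply HasDerivAt.fun_sum
    intro j _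
    have := ((((hasDerivAt_id (0:ℝ)).mul_const (dotL (a j) d)).exp).const_mul (ev a z j)).const_mul (c j)
    simpa [mul_assoc] using this
  have hpos := mul_pos (tot_pos a z) hd2
  have hs := hasDerivAt_iff_tendsto_slope.1 hder
  have hs' : ∀ᶠ t in 𝓝[>] (0:ℝ), 0 < expSum a c (z + t • d) := by
    have := (hs.mono_left (nhdsWithin_mono _ (fun t (ht : (0:ℝ) < t) => ht.ne'))).eventually (eventually_gt_nhds hpos)
    filter_upwards [this, self_mem_nhdsWithin] with t ht ht0
    rw [slope_def_field] at ht
    simp only [zero_smul, add_zero, hz, sub_zero] at ht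
    exact (div_pos_iff_of_pos_right ht0).1 ht
  have hlim : Tendsto (fun t : ℝ => z + t • d) (𝓝[>] 0) (𝓝 z) := by
    have : Tendsto (fun t : ℝ => z + t • d) (𝓝 0) (𝓝 (z + (0:ℝ) • d)) := by
      apply Continuous.tendsto; fun_prop
    rw [zero_smul, add_zero] at this
    exact this.mono_left nhdsWithin_le_nhds
  exact mem_closure_of_tendsto hlim hs'

theorem UU_neg {n N : ℕ} [Nonempty (Fin N)] (a : Fin N → Fin n → ℝ) (c : Fin N → ℝ) (hc : c ∈ UU a) : -c ∈ UU a := by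
  refine ⟨fun j => by simpa using hc.1 j, fun ξ hξ h => hc.2 ξ hξ ?_⟩
  have h1 := congrArg Prod.fst h
  have h2 := congrArg Prod.snd h
  ext i
  · simpa using h1
  · simpa using congrFun h2 i

theorem zero_comps {n N : ℕ} (a : Fin (N+1) → Fin n → ℝ) (ha : NotAllInAffineHyperplane a) (hcs : CombSimplicial a)
    (c : Fin (N+1) → ℝ) (hc : c ∈ UU a) (r : ℕ)
    (hr : ∀ Q : Finset (ConnectedComponents {y : Fin n → ℝ // expSum a c y ≠ 0}),
      (∀ q ∈ Q, Bornology.IsBounded (Wc (expSum a c) q)) → Q.card ≤ r) :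
    Finite (ConnectedComponents {y : Fin n → ℝ // expSum a c y = 0}) ∧
      Nat.card (ConnectedComponents {y : Fin n → ℝ // expSum a c y = 0}) ≤ N + r := by
  obtain ⟨h1, h2⟩ := comp_count a ha hcs c hc.1 r hr
  refine topo (expSum a c) (continuous_expSum a c) (sign_near a c hc) ?_ (N + r) h1 (by omega)
  intro z hz
  have := sign_near a (-c) (UU_neg a c hc) z (by rw [expSum_neg, hz, neg_zero])
  simpa [expSum_neg] using this

end PartPD4

section PartPF1
open scoped ContDiff Topology ENNReal
open MeasureTheory MvPolynomial Filter

theorem ker_basis {n M l : ℕ} [Nonempty (Fin M)] (b : Fin M → Fin n → ℝ) (hb : NotAllInAffineHyperplane b) (hM : M = n + 1 + l) :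
    ∃ κ : Fin l → Fin M → ℝ, (∀ x : Fin l → ℝ, (∀ j, ∑ i, κ i j * x i = 0) → x = 0) ∧ (∀ i, TL b (κ i) = 0) ∧
      ∀ d, TL b d = 0 → ∃ x : Fin l → ℝ, ∀ j, d j = ∑ i, κ i j * x i := by
  have hf : Module.finrank ℝ (LinearMap.ker (TL b)) = l := by
    have h1 := LinearMap.finrank_range_add_finrank_ker (TL b)
    rw [TL_surj b hb, finrank_top] at h1
    simp at h1
    omega
  let B := Module.finBasisOfFinrankEq ℝ _ hf
  refine ⟨fun i => (B i : Fin M → ℝ), ?_, fun i => (B i).2, ?_⟩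
  · intro x hx
    have h1 : ∑ i, x i • B i = 0 := by
      apply Subtype.ext
      funext j
      have := hx j
      simp only [Submodule.coe_sum, Submodule.coe_smul, Finset.sum_apply, Pi.smul_apply, smul_eq_mul, Submodule.coe_zero, Pi.zero_apply]
      rw [← this]
      exact Finset.sum_congr rfl fun i _ => mul_comm _ _
    funext i
    exact Fintype.linearIndependent_iff.1 B.linearIndependent x h1 i
  · intro d hd
    refine ⟨fun i => B.repr ⟨d, hd⟩ i, fun j => ?_⟩
    have h1 := congrArg (fun z : LinearMap.ker (TL b) => (z : Fin M → ℝ) j) (B.sum_repr ⟨d, hd⟩)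
    simp only [Submodule.coe_sum, Submodule.coe_smul, Finset.sum_apply, Pi.smul_apply, smul_eq_mul] at h1
    rw [← h1]
    exact Finset.sum_congr rfl fun i _ => mul_comm _ _

theorem orth {n M l : ℕ} (b : Fin M → Fin n → ℝ) (β : Fin l → Fin M → ℝ)
    (hβ : ∀ d, TL b d = 0 → ∃ x : Fin l → ℝ, ∀ j, d j = ∑ i, β i j * x i) (s : Fin M → ℝ) (hs : ∀ i, ∑ j, β i j * s j = 0) :
    ∃ z τ, ∀ j, s j = dotL (b j) z + τ := by
  have h1 : dotL s ∈ (LinearMap.ker (TL b)).dualAnnihilator := by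
    rw [Submodule.mem_dualAnnihilator]
    intro d hd
    obtain ⟨x, hx⟩ := hβ d hd
    rw [dotL_apply]
    simp only [hx, Finset.mul_sum]
    rw [Finset.sum_comm]
    refine Finset.sum_eq_zero fun i _ => ?_
    have := hs i
    calc ∑ j, s j * (β i j * x i) = (∑ j, β i j * s j) * x i := by
          rw [Finset.sum_mul]; exact Finset.sum_congr rfl fun j _ => by ring
      _ = 0 := by rw [this, zero_mul]
  rw [← LinearMap.range_dualMap_eq_dualAnnihilator_ker] at h1
  obtain ⟨f, hf⟩ := h1
  obtain ⟨w, hw⟩ := exists_dotL (f.comp (LinearMap.inr ℝ ℝ (Fin n → ℝ)))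
  refine ⟨w, f (1, 0), fun j => ?_⟩
  have h2 : TL b (Pi.single j 1) = (1, b j) := by ext <;> simp [TL, Pi.single_apply]
  have h3 := LinearMap.congr_fun hf (Pi.single j 1)
  have h4 : dotL s (Pi.single j 1) = s j := by simp [dotL_apply, Pi.single_apply]
  rw [h4, LinearMap.dualMap_apply, h2] at h3
  have h5 : f (0, b j) = dotL w (b j) := by rw [← hw]; simp
  have h6 : ((1, b j) : ℝ × (Fin n → ℝ)) = (1, 0) + (0, b j) := by ext <;> simp
  rw [← h3, h6, map_add, h5, dotL_comm, add_comm]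

noncomputable def mv {M l : ℕ} (β : Fin l → Fin M → ℝ) : (Fin M → ℝ) →ₗ[ℝ] (Fin l → ℝ) := Matrix.mulVecLin (Matrix.of β)

theorem mv_apply {M l : ℕ} (β : Fin l → Fin M → ℝ) (η : Fin M → ℝ) (i : Fin l) : mv β η i = ∑ j, β i j * η j := rfl

theorem mv_surj {M l : ℕ} (β : Fin l → Fin M → ℝ) (h : ∀ x : Fin l → ℝ, (∀ j, ∑ i, β i j * x i = 0) → x = 0) :
    Function.Surjective (mv β) := by
  rw [← LinearMap.range_eq_top]
  by_contra hne
  obtain ⟨f, hf, hker⟩ := Submodule.exists_le_ker_of_lt_top _ (lt_top_iff_ne_top.2 hne)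
  obtain ⟨w, rfl⟩ := exists_dotL f
  apply hf
  have : w = 0 := by
    apply h
    intro j
    have h1 : dotL w (mv β (Pi.single j 1)) = 0 := hker ⟨_, rfl⟩
    rw [dotL_apply] at h1
    rw [← h1]
    refine Finset.sum_congr rfl fun i _ => ?_
    rw [mv_apply]
    simp [Pi.single_apply, mul_comm]
  rw [this]
  ext; simp [dotL_apply]

noncomputable def pp {M l : ℕ} (u0 : Fin M → ℝ) (κ : Fin l → Fin M → ℝ) (j : Fin M) : MvPolynomial (Fin l) ℝ :=
  C (u0 j) + ∑ i, C (κ i j) * X i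

theorem eval_pp {M l : ℕ} (u0 : Fin M → ℝ) (κ : Fin l → Fin M → ℝ) (j : Fin M) (x : Fin l → ℝ) :
    eval x (pp u0 κ j) = u0 j + ∑ i, κ i j * x i := by simp [pp]

theorem pderiv_pp {M l : ℕ} (u0 : Fin M → ℝ) (κ : Fin l → Fin M → ℝ) (j : Fin M) (m : Fin l) :
    pderiv m (pp u0 κ j) = C (κ m j) := by
  simp [pp, pderiv_mul, pderiv_X, Pi.single_apply]

theorem deg_pp {M l : ℕ} (u0 : Fin M → ℝ) (κ : Fin l → Fin M → ℝ) (j : Fin M) : (pp u0 κ j).totalDegree ≤ 1 := by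
  refine (totalDegree_add _ _).trans (max_le (by simp) ?_)
  refine totalDegree_finsetSum_le fun i _ => ?_
  refine (totalDegree_mul _ _).trans ?_
  rw [totalDegree_C, totalDegree_X]

theorem compact_pp {M l : ℕ} (u0 : Fin M → ℝ) (κ : Fin l → Fin M → ℝ) (h : ∀ x : Fin l → ℝ, (∀ j, ∑ i, κ i j * x i = 0) → x = 0)
    (hu : ∑ j, u0 j = 1) (hκ : ∀ i, ∑ j, κ i j = 0) : IsCompact {x | ∀ j, 0 ≤ eval x (pp u0 κ j)} := by
  let K : (Fin l → ℝ) →ₗ[ℝ] (Fin M → ℝ) := Matrix.mulVecLin (Matrix.of fun j i => κ i j)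
  have hK : ∀ x j, K x j = ∑ i, κ i j * x i := fun x j => rfl
  have hinj : LinearMap.ker K = ⊥ := by
    rw [LinearMap.ker_eq_bot']
    intro x hx
    exact h x fun j => by rw [← hK, hx]; rfl
  have hce := LinearMap.isClosedEmbedding_of_injective hinj
  have hc : IsCompact {u : Fin M → ℝ | ∀ j, u j ∈ Set.Icc (-u0 j) (1 - u0 j)} := by
    have := isCompact_univ_pi (fun j : Fin M => isCompact_Icc (a := -u0 j) (b := 1 - u0 j))
    convert! this using 1
    ext u; exact ⟨fun h j _ => h j, fun h j => h j trivial⟩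
  have h2 := hce.isCompact_preimage hc
  refine h2.of_isClosed_subset ?_ ?_
  · have : {x | ∀ j, 0 ≤ eval x (pp u0 κ j)} = ⋂ j, {x | 0 ≤ eval x (pp u0 κ j)} := by ext; simp
    rw [this]
    exact isClosed_iInter fun j => isClosed_le continuous_const (MvPolynomial.continuous_eval _)
  · intro x hx j
    have hs : ∑ j, eval x (pp u0 κ j) = 1 := by
      simp only [eval_pp, Finset.sum_add_distrib, hu]
      rw [Finset.sum_comm]
      simp only [← Finset.sum_mul, hκ, zero_mul, Finset.sum_const_zero, add_zero]
    have h1 : eval x (pp u0 κ j) ≤ 1 := by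
      rw [← hs]
      exact Finset.single_le_sum (f := fun j => eval x (pp u0 κ j)) (fun j _ => hx j) (Finset.mem_univ j)
    have h0 := hx j
    rw [eval_pp, ← hK] at h0 h1
    exact ⟨by linarith, by linarith⟩

theorem jac_mulVec {M l : ℕ} (u0 : Fin M → ℝ) (κ β : Fin l → Fin M → ℝ) (x : Fin l → ℝ) (hx : x ∈ Dlt (pp u0 κ)) (ξ : Fin l → ℝ) (i : Fin l) :
    ((jac (fun i => rowf (pp u0 κ) 0 (β i)) x).mulVec ξ) i = ∑ j, β i j * ((∑ m, κ m j * ξ m) / eval x (pp u0 κ j)) := by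
  have h1 : ∀ m, jac (fun i => rowf (pp u0 κ) 0 (β i)) x i m = ∑ j, β i j / eval x (pp u0 κ j) * κ m j := by
    intro m
    show grow (rowf (pp u0 κ) 0 (β i)) x m = _
    rw [grow_rowf _ _ _ _ hx]
    simp [pderiv_pp]
  simp only [Matrix.mulVec, dotProduct, h1, Finset.sum_mul]
  rw [Finset.sum_comm]
  refine Finset.sum_congr rfl fun j _ => ?_
  rw [Finset.sum_div, Finset.mul_sum]
  refine Finset.sum_congr rfl fun m _ => ?_
  ring

theorem polar_zero {n M : ℕ} (b : Fin M → Fin n → ℝ) (e : Fin M → ℝ) (hs : ∀ z, 0 ≤ ∑ j, e j * (dotL (b j) z)^2)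
    (z : Fin n → ℝ) (hz : ∑ j, e j * (dotL (b j) z)^2 = 0) (w : Fin n → ℝ) : ∑ j, e j * (dotL (b j) z * dotL (b j) w) = 0 := by
  set P := ∑ j, e j * (dotL (b j) z * dotL (b j) w)
  set R := ∑ j, e j * (dotL (b j) w)^2
  have h1 : ∀ t : ℝ, 0 ≤ 2 * t * P + t^2 * R := by
    intro t
    have h2 := hs (z + t • w)
    have h3 : ∑ j, e j * (dotL (b j) (z + t • w))^2 = ∑ j, e j * (dotL (b j) z)^2 + (2 * t * P + t^2 * R) := by
      simp only [P, R, Finset.mul_sum, ← Finset.sum_add_distrib]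
      refine Finset.sum_congr rfl fun j _ => ?_
      simp only [map_add, map_smul, smul_eq_mul]; ring
    rw [h3, hz, zero_add] at h2
    exact h2
  have hR : 0 ≤ R := hs w
  by_contra hP
  have h4 := h1 (-P / (R + 1))
  have h5 : 2 * (-P / (R + 1)) * P + (-P / (R + 1))^2 * R = -(P^2 * (R + 2)) / (R+1)^2 := by
    field_simp; ring
  rw [h5] at h4
  have h6 : 0 < P^2 * (R+2) / (R+1)^2 := by positivity
  rw [neg_div] at h4
  linarith

end PartPF1

section PartPF2
open scoped ContDiff Topology ENNReal
open MeasureTheory MvPolynomial Filter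

/-- scaled configuration -/
def sc {n M : ℕ} (c : Fin M → ℝ) (b : Fin M → Fin n → ℝ) : Fin M → Fin n → ℝ := fun j i => c j * b j i

theorem sc_spans {n M : ℕ} (b : Fin M → Fin n → ℝ) (hb : NotAllInAffineHyperplane b) (c : Fin M → ℝ) (hc : ∀ j, c j ≠ 0)
    (u0 : Fin M → ℝ) (hu0 : TL (sc c b) u0 = (1, 0)) : NotAllInAffineHyperplane (sc c b) := by
  rintro ⟨w, t, hw, h⟩
  have h1 : ∑ j, u0 j = 1 := congrArg Prod.fst hu0
  have h2 : ∀ i, ∑ j, u0 j * sc c b j i = 0 := fun i => congrFun (congrArg Prod.snd hu0) i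
  have h3 : t = 0 := by
    calc t = ∑ j, u0 j * t := by rw [← Finset.sum_mul, h1, one_mul]
      _ = ∑ j, u0 j * ∑ i, w i * sc c b j i := Finset.sum_congr rfl fun j _ => by rw [h j]
      _ = ∑ i, w i * ∑ j, u0 j * sc c b j i := by
        simp only [Finset.mul_sum]
        rw [Finset.sum_comm]
        exact Finset.sum_congr rfl fun i _ => Finset.sum_congr rfl fun j _ => by ring
      _ = 0 := by simp [h2]
  refine hb ⟨w, 0, hw, fun j => ?_⟩
  have h4 := h j
  have h5 : ∑ i, w i * sc c b j i = c j * ∑ i, w i * b j i := by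
    rw [Finset.mul_sum]; exact Finset.sum_congr rfl fun i _ => by simp only [sc]; ring
  rw [h5, h3] at h4
  exact (mul_eq_zero.1 h4).resolve_left (hc j)

theorem span_zero {n M : ℕ} (b : Fin M → Fin n → ℝ) (hb : NotAllInAffineHyperplane b) (z : Fin n → ℝ) (τ : ℝ)
    (h : ∀ j, dotL (b j) z = τ) : z = 0 := by
  by_contra hz
  exact hb ⟨z, τ, hz, fun j => by rw [← h j, dotL_comm, dotL_apply]⟩

section
variable {n M l : ℕ} (b : Fin M → Fin n → ℝ) (hb : NotAllInAffineHyperplane b) (c : Fin M → ℝ)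
  (u0 : Fin M → ℝ) (hu0 : TL (sc c b) u0 = (1, 0)) (κ β : Fin l → Fin M → ℝ)
  (hκ1 : ∀ x : Fin l → ℝ, (∀ j, ∑ i, κ i j * x i = 0) → x = 0)
  (hκ2 : ∀ i, TL (sc c b) (κ i) = 0)
  (hκ3 : ∀ d, TL (sc c b) d = 0 → ∃ x : Fin l → ℝ, ∀ j, d j = ∑ i, κ i j * x i)
  (hβ1 : ∀ x : Fin l → ℝ, (∀ j, ∑ i, β i j * x i = 0) → x = 0)
  (hβ2 : ∀ i, TL b (β i) = 0)
  (hβ3 : ∀ d, TL b d = 0 → ∃ x : Fin l → ℝ, ∀ j, d j = ∑ i, β i j * x i)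

include hu0 hκ2 in
theorem TL_pp (x : Fin l → ℝ) : TL (sc c b) (fun j => eval x (pp u0 κ j)) = (1, 0) := by
  have : (fun j => eval x (pp u0 κ j)) = u0 + ∑ i, x i • κ i := by
    funext j
    rw [eval_pp]
    simp [mul_comm]
  rw [this, map_add, map_sum, hu0]
  simp [hκ2]

theorem TL_fst {n M : ℕ} (a : Fin M → Fin n → ℝ) (d : Fin M → ℝ) : (TL a d).1 = ∑ j, d j := rfl
theorem TL_snd {n M : ℕ} (a : Fin M → Fin n → ℝ) (d : Fin M → ℝ) (i : Fin n) : (TL a d).2 i = ∑ j, d j * a j i := rfl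

/-- weighted pairing -/
theorem TL_dot {n M : ℕ} (c : Fin M → ℝ) (b : Fin M → Fin n → ℝ) (d : Fin M → ℝ) (w : Fin n → ℝ) :
    dotL w ((TL (sc c b) d).2) = ∑ j, c j * d j * dotL (b j) w := by
  simp only [dotL_apply, TL_snd, sc, Finset.mul_sum]
  rw [Finset.sum_comm]
  exact Finset.sum_congr rfl fun j _ => Finset.sum_congr rfl fun i _ => by ring

include hu0 hκ1 hκ2 hβ3 in
theorem det_zero_imp (x : Fin l → ℝ) (hx : x ∈ Dlt (pp u0 κ)) (h0 : (jac (fun i => rowf (pp u0 κ) 0 (β i)) x).det = 0) :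
    ∃ z, z ≠ 0 ∧ ∑ j, c j * eval x (pp u0 κ j) * (dotL (b j) z)^2 = 0 := by
  obtain ⟨ξ, hξ, hm⟩ := Matrix.exists_mulVec_eq_zero_iff.2 h0
  have h1 : ∀ i, ∑ j, β i j * ((∑ m, κ m j * ξ m) / eval x (pp u0 κ j)) = 0 := fun i => by
    rw [← jac_mulVec u0 κ β x hx ξ i, hm]; rfl
  obtain ⟨z, τ, hz⟩ := orth b β hβ3 _ h1
  have hp := TL_pp b c u0 hu0 κ hκ2 x
  have hd : ∀ j, ∑ m, κ m j * ξ m = eval x (pp u0 κ j) * (dotL (b j) z + τ) := fun j => by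
    rw [← hz j]; have := (hx j).ne'; field_simp
  have hT : TL (sc c b) (fun j => ∑ m, κ m j * ξ m) = 0 := by
    have : (fun j => ∑ m, κ m j * ξ m) = ∑ i, ξ i • κ i := by funext j; simp [mul_comm]
    rw [this, map_sum]; simp [hκ2]
  refine ⟨z, ?_, ?_⟩
  · rintro rfl
    have h2 : ∑ j, ∑ m, κ m j * ξ m = 0 := congrArg Prod.fst hT
    have h3 : ∑ j, eval x (pp u0 κ j) = 1 := congrArg Prod.fst hp
    simp only [hd, map_zero, zero_add, ← Finset.sum_mul, h3, one_mul] at h2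
    apply hξ
    apply hκ1
    intro j
    rw [hd, h2]; simp
  · have h2 := TL_dot c b (fun j => ∑ m, κ m j * ξ m) z
    rw [hT] at h2
    have h3 := TL_dot c b (fun j => eval x (pp u0 κ j)) z
    rw [hp] at h3
    simp only [Prod.snd_zero, map_zero] at h2 h3
    simp only [hd] at h2
    have h4 : ∑ j, c j * (eval x (pp u0 κ j) * (dotL (b j) z + τ)) * dotL (b j) z =
        ∑ j, c j * eval x (pp u0 κ j) * (dotL (b j) z)^2 + τ * ∑ j, c j * eval x (pp u0 κ j) * dotL (b j) z := by
      rw [Finset.mul_sum, ← Finset.sum_add_distrib]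
      exact Finset.sum_congr rfl fun j _ => by ring
    rw [h4, ← h3] at h2
    linarith

include hb hu0 hκ2 hκ3 hβ2 in
theorem det_ne_imp (x : Fin l → ℝ) (hx : x ∈ Dlt (pp u0 κ)) (h0 : (jac (fun i => rowf (pp u0 κ) 0 (β i)) x).det ≠ 0)
    (σ : ℝ) (hσ : σ ≠ 0) (hs : ∀ z, 0 ≤ σ * ∑ j, c j * eval x (pp u0 κ j) * (dotL (b j) z)^2) (z : Fin n → ℝ) (hz : z ≠ 0) :
    0 < σ * ∑ j, c j * eval x (pp u0 κ j) * (dotL (b j) z)^2 := by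
  refine lt_of_le_of_ne (hs z) fun he => h0 ?_
  have hp := TL_pp b c u0 hu0 κ hκ2 x
  have e1 : ∀ z, σ * ∑ j, c j * eval x (pp u0 κ j) * (dotL (b j) z)^2 = ∑ j, (σ * (c j * eval x (pp u0 κ j))) * (dotL (b j) z)^2 := by
    intro z; rw [Finset.mul_sum]; exact Finset.sum_congr rfl fun j _ => by ring
  have h1 := polar_zero b (fun j => σ * (c j * eval x (pp u0 κ j))) (fun z => by rw [← e1]; exact hs z) z (by rw [← e1]; exact he.symm)
  have h2 : ∀ w, ∑ j, c j * eval x (pp u0 κ j) * dotL (b j) z * dotL (b j) w = 0 := by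
    intro w
    have h3 := h1 w
    have : ∑ j, (σ * (c j * eval x (pp u0 κ j))) * (dotL (b j) z * dotL (b j) w) =
      σ * ∑ j, c j * eval x (pp u0 κ j) * dotL (b j) z * dotL (b j) w := by
      rw [Finset.mul_sum]; exact Finset.sum_congr rfl fun j _ => by ring
    rw [this] at h3
    exact (mul_eq_zero.1 h3).resolve_left hσ
  have h3 : ∑ j, eval x (pp u0 κ j) = 1 := congrArg Prod.fst hp
  set τ := - ∑ j, eval x (pp u0 κ j) * dotL (b j) z with hτ
  have hT : TL (sc c b) (fun j => eval x (pp u0 κ j) * (dotL (b j) z + τ)) = 0 := by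
    have h5 : (TL (sc c b) (fun j => eval x (pp u0 κ j) * (dotL (b j) z + τ))).1 = 0 := by
      rw [TL_fst]
      simp only [mul_add, Finset.sum_add_distrib, ← Finset.sum_mul, h3]
      rw [hτ]; ring
    have h6 : (TL (sc c b) (fun j => eval x (pp u0 κ j) * (dotL (b j) z + τ))).2 = 0 := by
      funext i
      rw [TL_snd]
      have h7 := h2 (Pi.single i 1)
      have h8 : ∀ j, dotL (b j) (Pi.single i 1) = b j i := fun j => by simp [dotL_apply, Pi.single_apply]
      simp only [h8] at h7
      have h9 : ∑ j, eval x (pp u0 κ j) * sc c b j i = 0 := congrFun (congrArg Prod.snd hp) i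
      calc _ = ∑ j, c j * eval x (pp u0 κ j) * dotL (b j) z * b j i + τ * ∑ j, eval x (pp u0 κ j) * sc c b j i := by
            rw [Finset.mul_sum, ← Finset.sum_add_distrib]
            exact Finset.sum_congr rfl fun j _ => by simp only [sc]; ring
        _ = 0 := by rw [h7, h9]; ring
    exact Prod.ext h5 h6
  obtain ⟨ξ, hξ⟩ := hκ3 _ hT
  refine Matrix.exists_mulVec_eq_zero_iff.1 ⟨ξ, ?_, ?_⟩
  · rintro rfl
    apply hz
    refine span_zero b hb z (-τ) fun j => ?_
    have := hξ j
    simp only [Pi.zero_apply, mul_zero, Finset.sum_const_zero] at this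
    have := (mul_eq_zero.1 this).resolve_left (hx j).ne'
    linarith
  · funext i
    rw [jac_mulVec u0 κ β x hx ξ i]
    have h5 : ∀ j, (∑ m, κ m j * ξ m) / eval x (pp u0 κ j) = dotL (b j) z + τ := fun j => by
      rw [← hξ j]; have := (hx j).ne'; field_simp
    simp only [h5]
    have h6 : ∑ j, β i j = 0 := congrArg Prod.fst (hβ2 i)
    have h7 : ∀ m, ∑ j, β i j * b j m = 0 := fun m => congrFun (congrArg Prod.snd (hβ2 i)) m
    simp only [mul_add, Finset.sum_add_distrib, ← Finset.sum_mul, h6, zero_mul, add_zero]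
    simp only [dotL_apply, Finset.mul_sum]
    rw [Finset.sum_comm]
    refine Finset.sum_eq_zero fun m _ => ?_
    rw [← zero_mul (z m), ← h7 m, Finset.sum_mul]
    exact Finset.sum_congr rfl fun j _ => by ring

include hu0 hκ1 hκ2 hβ3 in
/-- the determinant has constant sign on the definite region -/
theorem det_sign (σ : ℝ) (D : Set (Fin l → ℝ)) (hD : D = {x | x ∈ Dlt (pp u0 κ) ∧ ∀ z, z ≠ 0 → 0 < σ * ∑ j, c j * eval x (pp u0 κ j) * (dotL (b j) z)^2}) :
    (∀ x ∈ D, 0 < (jac (fun i => rowf (pp u0 κ) 0 (β i)) x).det) ∨ (∀ x ∈ D, ¬ 0 < (jac (fun i => rowf (pp u0 κ) 0 (β i)) x).det) := by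
  have hconv : Convex ℝ D := by
    intro x hx x' hx' s t hs ht hst
    rw [hD] at hx hx' ⊢
    have he : ∀ j, eval (s • x + t • x') (pp u0 κ j) = s * eval x (pp u0 κ j) + t * eval x' (pp u0 κ j) := by
      intro j
      simp only [eval_pp, Pi.add_apply, Pi.smul_apply, smul_eq_mul, mul_add, Finset.sum_add_distrib, Finset.mul_sum]
      have h1 : ∑ i, κ i j * (s * x i) = ∑ i, s * (κ i j * x i) := Finset.sum_congr rfl fun i _ => by ring
      have h2 : ∑ i, κ i j * (t * x' i) = ∑ i, t * (κ i j * x' i) := Finset.sum_congr rfl fun i _ => by ring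
      have h3 : u0 j = s * u0 j + t * u0 j := by rw [← add_mul, hst, one_mul]
      rw [h1, h2]; linarith
    have hp : ∀ A B : ℝ, 0 < A → 0 < B → 0 < s * A + t * B := by
      intro A B hA hB
      rcases hs.eq_or_lt with rfl | h
      · have : t = 1 := by linarith
        subst this; simpa using hB
      · have := mul_pos h hA
        have := mul_nonneg ht hB.le
        linarith
    refine ⟨fun j => ?_, fun z hz => ?_⟩
    · rw [he]; exact hp _ _ (hx.1 j) (hx'.1 j)
    · have := hp _ _ (hx.2 z hz) (hx'.2 z hz)
      convert! this using 1
      simp only [he, Finset.mul_sum, ← Finset.sum_add_distrib]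
      exact Finset.sum_congr rfl fun j _ => by ring
  have hcont : ContinuousOn (fun x => (jac (fun i => rowf (pp u0 κ) 0 (β i)) x).det) D := by
    have hsub : D ⊆ Dlt (pp u0 κ) := by rw [hD]; exact fun x hx => hx.1
    refine ContinuousOn.mono ?_ hsub
    have : ContinuousOn (fun x => jac (fun i => rowf (pp u0 κ) 0 (β i)) x) (Dlt (pp u0 κ)) := by
      refine continuousOn_pi.2 fun i => continuousOn_pi.2 fun m => ?_
      have h1 := (contDiffOn_rowf (pp u0 κ) 0 (β i)).continuousOn_fderiv_of_isOpen (isOpen_Dlt _) (by simp)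
      exact h1.clm_apply continuousOn_const
    exact (continuous_id.matrix_det).comp_continuousOn this
  have hne : ∀ x ∈ D, (jac (fun i => rowf (pp u0 κ) 0 (β i)) x).det ≠ 0 := by
    intro x hx h
    rw [hD] at hx
    obtain ⟨z, hz, hz0⟩ := det_zero_imp b c u0 hu0 κ β hκ1 hκ2 hβ3 x hx.1 h
    have := hx.2 z hz
    rw [hz0, mul_zero] at this
    exact lt_irrefl _ this
  by_contra! hcon
  obtain ⟨⟨x, hx, h1⟩, x', hx', h2⟩ := hcon
  obtain ⟨y, hy, h0⟩ := (hconv.isPreconnected.image _ hcont).ordConnected.out (Set.mem_image_of_mem _ hx) (Set.mem_image_of_mem _ hx')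
    ⟨h1, h2.le⟩
  exact hne y hy h0

include hb hu0 hκ3 hβ2 in
theorem gale_point [Nonempty (Fin M)] (η : Fin M → ℝ) (y : Fin n → ℝ) (hy : ∀ i, ∑ j, c j * Real.exp (η j) * ev b y j * b j i = 0) :
    ∃ x s, 0 < s ∧ (∀ j, eval x (pp u0 κ j) = Real.exp (η j) * ev b y j / s) ∧ x ∈ Dlt (pp u0 κ) ∧
      ∀ i, rowf (pp u0 κ) 0 (β i) x = mv β η i := by
  have hs : 0 < ∑ j, Real.exp (η j) * ev b y j :=
    Finset.sum_pos (fun j _ => mul_pos (Real.exp_pos _) (ev_pos b y j)) Finset.univ_nonempty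
  set s := ∑ j, Real.exp (η j) * ev b y j with hsd
  have hT : TL (sc c b) (fun j => Real.exp (η j) * ev b y j / s) = (1, 0) := by
    refine Prod.ext ?_ (funext fun i => ?_)
    · rw [TL_fst, ← Finset.sum_div, ← hsd, div_self hs.ne']
    · rw [TL_snd]
      calc _ = (∑ j, c j * Real.exp (η j) * ev b y j * b j i) / s := by
            rw [Finset.sum_div]; exact Finset.sum_congr rfl fun j _ => by simp only [sc]; ring
        _ = 0 := by rw [hy, zero_div]
  obtain ⟨x, hx⟩ := hκ3 ((fun j => Real.exp (η j) * ev b y j / s) - u0) (by rw [map_sub, hT, hu0, sub_self])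
  have he : ∀ j, eval x (pp u0 κ j) = Real.exp (η j) * ev b y j / s := by
    intro j
    rw [eval_pp, ← hx j]; simp
  have hpos : ∀ j, 0 < Real.exp (η j) * ev b y j / s := fun j => div_pos (mul_pos (Real.exp_pos _) (ev_pos b y j)) hs
  refine ⟨x, s, hs, he, fun j => by rw [he]; exact hpos j, fun i => ?_⟩
  have hlog : ∀ j, Real.log (eval x (pp u0 κ j)) = η j + dotL (b j) y - Real.log s := by
    intro j
    rw [he, Real.log_div (mul_pos (Real.exp_pos _) (ev_pos b y j)).ne' hs.ne', Real.log_mul (Real.exp_pos _).ne' (ev_pos b y j).ne',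
      Real.log_exp, ev, Real.log_exp]
  simp only [rowf, hlog, map_zero, zero_add, mv_apply]
  have h6 : ∑ j, β i j = 0 := congrArg Prod.fst (hβ2 i)
  have h7 : ∀ m, ∑ j, β i j * b j m = 0 := fun m => congrFun (congrArg Prod.snd (hβ2 i)) m
  simp only [mul_add, mul_sub, Finset.sum_add_distrib, Finset.sum_sub_distrib, ← Finset.sum_mul, h6, zero_mul, sub_zero]
  have : ∑ j, β i j * dotL (b j) y = 0 := by
    simp only [dotL_apply, Finset.mul_sum]
    rw [Finset.sum_comm]
    refine Finset.sum_eq_zero fun m _ => ?_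
    rw [← zero_mul (y m), ← h7 m, Finset.sum_mul]
    exact Finset.sum_congr rfl fun j _ => by ring
  rw [this, add_zero]
end

end PartPF2

section PartPF3
open scoped ContDiff Topology ENNReal
open MeasureTheory MvPolynomial Filter

def CritH {n M : ℕ} (b : Fin M → Fin n → ℝ) (c η : Fin M → ℝ) (y : Fin n → ℝ) : Prop :=
  ∀ i, ∑ j, c j * Real.exp (η j) * ev b y j * b j i = 0

def SDH {n M : ℕ} (σ : ℝ) (b : Fin M → Fin n → ℝ) (c η : Fin M → ℝ) (y : Fin n → ℝ) : Prop :=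
  ∀ z, 0 ≤ σ * ∑ j, c j * Real.exp (η j) * ev b y j * (dotL (b j) z)^2

theorem def_count {n M : ℕ} (b : Fin M → Fin n → ℝ) (e : Fin M → ℝ) (h : ∀ z, z ≠ 0 → 0 < ∑ j, e j * (dotL (b j) z)^2) :
    n ≤ (Finset.univ.filter fun j => 0 < e j).card := by
  classical
  by_contra! hlt
  set s := Finset.univ.filter fun j => 0 < e j with hs
  let f : (Fin n → ℝ) →ₗ[ℝ] (s → ℝ) := LinearMap.pi fun j => dotL (b j)
  have h1 : LinearMap.ker f ≠ ⊥ := LinearMap.ker_ne_bot_of_finrank_lt (by simpa using hlt)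
  obtain ⟨z, hz, hz0⟩ := (Submodule.ne_bot_iff _).1 h1
  have h2 := h z hz0
  have h3 : ∑ j, e j * (dotL (b j) z)^2 ≤ 0 := by
    refine Finset.sum_nonpos fun j _ => ?_
    by_cases hj : 0 < e j
    · have hm : j ∈ s := by simp [hs, hj]
      have : dotL (b j) z = 0 := congrFun (LinearMap.mem_ker.1 hz) ⟨j, hm⟩
      rw [this]; simp
    · exact mul_nonpos_of_nonpos_of_nonneg (not_lt.1 hj) (sq_nonneg _)
  linarith

theorem crit_TL {n M : ℕ} [Nonempty (Fin M)] (b : Fin M → Fin n → ℝ) (c η : Fin M → ℝ) (y : Fin n → ℝ) (hy : CritH b c η y) :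
    ∃ u0, TL (sc c b) u0 = (1, 0) := by
  have hs : 0 < ∑ j, Real.exp (η j) * ev b y j :=
    Finset.sum_pos (fun j _ => mul_pos (Real.exp_pos _) (ev_pos b y j)) Finset.univ_nonempty
  set s := ∑ j, Real.exp (η j) * ev b y j with hsd
  refine ⟨fun j => Real.exp (η j) * ev b y j / s, ?_⟩
  refine Prod.ext ?_ (funext fun i => ?_)
  · rw [TL_fst, ← Finset.sum_div, ← hsd, div_self hs.ne']
  · rw [TL_snd]
    calc _ = (∑ j, c j * Real.exp (η j) * ev b y j * b j i) / s := by
          rw [Finset.sum_div]; exact Finset.sum_congr rfl fun j _ => by simp only [sc]; ring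
      _ = 0 := by rw [hy, zero_div]

theorem FF_nonneg (m l : ℕ) : 0 ≤ FF (m:ℝ) l := by
  unfold FF; positivity

theorem gale_bound {n M l : ℕ} [Nonempty (Fin M)] (b : Fin M → Fin n → ℝ) (hb : NotAllInAffineHyperplane b) (c : Fin M → ℝ)
    (hc : ∀ j, c j ≠ 0) (hM : M = n + 1 + l) (r : ℕ)
    (hr : ∀ᶠ η in 𝓝 (0 : Fin M → ℝ), ∃ Y : Finset (Fin n → ℝ), Y.card = r ∧ ∀ y ∈ Y, CritH b c η y ∧ (SDH 1 b c η y ∨ SDH (-1) b c η y)) :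
    (r : ℝ) ≤ FF ((n+1 : ℕ):ℝ) l + (l:ℝ)/2 * (((n+1+l:ℕ):ℝ) * FF ((n+1:ℕ):ℝ) (l-1)) ∧
    (1 ≤ l → M < 2 * n → (r : ℝ) ≤ 1/2 * (FF ((n+1:ℕ):ℝ) l + ((l:ℝ)-1)/2*(((n+1+l:ℕ):ℝ)*FF ((n+1:ℕ):ℝ) (l-1))) +
      (((n+1+l:ℕ):ℝ)*FF ((n+1:ℕ):ℝ) (l-1))/2) := by
  classical
  have hF1 := FF_nonneg (n+1) l
  have hF2 := FF_nonneg (n+1) (l-1)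
  rcases Nat.eq_zero_or_pos r with rfl | hrpos
  · refine ⟨by push_cast at *; positivity, fun hl _ => ?_⟩
    have : (0:ℝ) ≤ (l:ℝ) - 1 := by
      have : (1:ℝ) ≤ l := by exact_mod_cast hl
      linarith
    push_cast at *; positivity
  obtain ⟨u0, hu0⟩ : ∃ u0, TL (sc c b) u0 = (1, 0) := by
    obtain ⟨Y, hY, h⟩ := hr.self_of_nhds
    obtain ⟨y, hy⟩ := Finset.card_pos.1 (hY ▸ hrpos)
    exact crit_TL b c 0 y (h y hy).1
  have hsc := sc_spans b hb c hc u0 hu0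
  obtain ⟨κ, hκ1, hκ2, hκ3⟩ := ker_basis (sc c b) hsc hM
  obtain ⟨β, hβ1, hβ2, hβ3⟩ := ker_basis b hb hM
  have hK : IsCompact {x | ∀ j, 0 ≤ eval x (pp u0 κ j)} :=
    compact_pp u0 κ hκ1 (congrArg Prod.fst hu0) (fun i => congrArg Prod.fst (hκ2 i))
  have hcard : Fintype.card (Fin M) = (n + 1) + l := by simp [hM]
  have hdeg := deg_pp u0 κ
  have A1 := gale_full (pp u0 κ) hdeg hK (n+1) (by omega) hcard β
  have A2 := sard (Dlt (pp u0 κ)) (isOpen_Dlt _) (fun i => rowf (pp u0 κ) 0 (β i)) (fun i => contDiffOn_rowf _ _ _)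
  -- the neighbourhood of values
  have hopen : IsOpenMap (mv β) := by
    have := ContinuousLinearMap.isOpenMap (LinearMap.toContinuousLinearMap (mv β)) (mv_surj β hβ1)
    exact this
  have hN := hopen.image_mem_nhds hr
  -- points of the fibre
  have hpts : ∀ η : Fin M → ℝ, ∀ Y : Finset (Fin n → ℝ), (∀ y ∈ Y, CritH b c η y ∧ (SDH 1 b c η y ∨ SDH (-1) b c η y)) →
      ∃ T : Finset (Fin l → ℝ), T.card = Y.card ∧ ∀ x ∈ T, x ∈ Dlt (pp u0 κ) ∧ (∀ i, rowf (pp u0 κ) 0 (β i) x = mv β η i) ∧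
        ((∀ z, 0 ≤ (1:ℝ) * ∑ j, c j * eval x (pp u0 κ j) * (dotL (b j) z)^2) ∨
          (∀ z, 0 ≤ (-1:ℝ) * ∑ j, c j * eval x (pp u0 κ j) * (dotL (b j) z)^2)) := by
    intro η Y hY
    have h1 := fun y (hy : y ∈ Y) => gale_point b hb c u0 hu0 κ β hκ3 hβ2 η y (hY y hy).1
    choose! X s hs hX hD hv using h1
    refine ⟨Y.image X, ?_, ?_⟩
    · apply Finset.card_image_of_injOn
      intro y hy y' hy' he
      have h2 : ∀ j, dotL (b j) (y - y') = Real.log (s y / s y') := by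
        intro j
        have e1 := hX y hy j
        have e2 := hX y' hy' j
        have he' : X y = X y' := he
        rw [he', e2] at e1
        have p1 := hs y hy
        have p2 := hs y' hy'
        have p3 := Real.exp_pos (η j)
        have e3 : Real.exp (dotL (b j) y) = Real.exp (dotL (b j) y') * (s y / s y') := by
          simp only [ev] at e1
          field_simp at e1 ⊢
          linarith
        rw [map_sub]
        have e4 := congrArg Real.log e3
        rw [Real.log_exp, Real.log_mul (Real.exp_pos _).ne' (div_pos p1 p2).ne', Real.log_exp] at e4
        linarith
      exact sub_eq_zero.1 (span_zero b hb _ _ h2)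
    · intro x hx
      obtain ⟨y, hy, rfl⟩ := Finset.mem_image.1 hx
      refine ⟨hD y hy, hv y hy, ?_⟩
      have hconv : ∀ (σ : ℝ), SDH σ b c η y → ∀ z, 0 ≤ σ * ∑ j, c j * eval (X y) (pp u0 κ j) * (dotL (b j) z)^2 := by
        intro σ h z
        have h2 : σ * ∑ j, c j * eval (X y) (pp u0 κ j) * (dotL (b j) z)^2 =
            (σ * ∑ j, c j * Real.exp (η j) * ev b y j * (dotL (b j) z)^2) / s y := by
          rw [mul_div_assoc, Finset.sum_div]
          congr 1
          exact Finset.sum_congr rfl fun j _ => by rw [hX y hy]; ring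
        rw [h2]
        exact div_nonneg (h z) (hs y hy).le
      exact (hY y hy).2.imp (hconv 1) (hconv (-1))
  refine ⟨?_, fun hl h2n => ?_⟩
  · obtain ⟨v, hv1, η, hη, rfl⟩ := (Measure.dense_of_ae A1).inter_nhds_nonempty hN
    obtain ⟨Y, hYr, hY⟩ := hη
    obtain ⟨T, hT, hTx⟩ := hpts η Y hY
    have := hv1 T (fun x hx => ⟨(hTx x hx).1, (hTx x hx).2.1⟩)
    rw [hT, hYr] at this
    exact this
  · have A3 := gale_sign (pp u0 κ) hdeg hK (n+1) (by omega) hcard hl β 0 1 (by norm_num) (by norm_num) (by norm_num) (by norm_num)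
    have A4 := gale_sign (pp u0 κ) hdeg hK (n+1) (by omega) hcard hl β 1 0 (by norm_num) (by norm_num) (by norm_num) (by norm_num)
    obtain ⟨v, ⟨⟨hv2, hv3⟩, hv4⟩, η, hη, rfl⟩ := (Measure.dense_of_ae ((A2.and A3).and A4)).inter_nhds_nonempty hN
    obtain ⟨Y, hYr, hY⟩ := hη
    obtain ⟨T, hT, hTx⟩ := hpts η Y hY
    have hTpos : 0 < T.card := by rw [hT, hYr]; exact hrpos
    obtain ⟨x0, hx0⟩ := Finset.card_pos.1 hTpos
    have hdef : ∀ x ∈ T, ∀ σ : ℝ, σ ≠ 0 → (∀ z, 0 ≤ σ * ∑ j, c j * eval x (pp u0 κ j) * (dotL (b j) z)^2) →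
        ∀ z, z ≠ 0 → 0 < σ * ∑ j, c j * eval x (pp u0 κ j) * (dotL (b j) z)^2 := by
      intro x hx σ hσ h z hz
      exact det_ne_imp b hb c u0 hu0 κ β hκ2 hκ3 hβ2 x (hTx x hx).1 (hv2 x (hTx x hx).1 (hTx x hx).2.1) σ hσ h z hz
    have hcnt : ∀ x ∈ T, ∀ σ : ℝ, σ ≠ 0 → (∀ z, 0 ≤ σ * ∑ j, c j * eval x (pp u0 κ j) * (dotL (b j) z)^2) →
        n ≤ (Finset.univ.filter fun j => 0 < σ * c j).card := by
      intro x hx σ hσ h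
      have h3 := def_count b (fun j => σ * c j * eval x (pp u0 κ j)) (fun z hz => by
        have h4 := hdef x hx σ hσ h z hz
        rw [Finset.mul_sum] at h4
        convert! h4 using 2
        ring)
      convert! h3 using 3
      exact (mul_pos_iff_of_pos_right ((hTx x hx).1 _)).symm
    have hnot : ∀ x ∈ T, ∀ x' ∈ T, (∀ z, 0 ≤ (1:ℝ) * ∑ j, c j * eval x (pp u0 κ j) * (dotL (b j) z)^2) →
        (∀ z, 0 ≤ (-1:ℝ) * ∑ j, c j * eval x' (pp u0 κ j) * (dotL (b j) z)^2) → False := by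
      intro x hx x' hx' h h'
      have e1 := hcnt x hx 1 one_ne_zero h
      have e2 := hcnt x' hx' (-1) (by norm_num) h'
      have hdis : Disjoint (Finset.univ.filter fun j => 0 < 1 * c j) (Finset.univ.filter fun j => 0 < (-1) * c j) := by
        rw [Finset.disjoint_filter]
        intro j _ h1 h2
        linarith
      have := Finset.card_union_of_disjoint hdis
      have h5 := Finset.card_le_univ ((Finset.univ.filter fun j => 0 < 1 * c j) ∪ (Finset.univ.filter fun j => 0 < (-1) * c j))
      rw [Fintype.card_fin] at h5
      omega
    obtain ⟨σ, hσ, hall⟩ : ∃ σ : ℝ, σ ≠ 0 ∧ ∀ x ∈ T, ∀ z, 0 ≤ σ * ∑ j, c j * eval x (pp u0 κ j) * (dotL (b j) z)^2 := by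
      rcases (hTx x0 hx0).2.2 with h0 | h0
      · exact ⟨1, one_ne_zero, fun x hx => (hTx x hx).2.2.resolve_right fun h => hnot x0 hx0 x hx h0 h⟩
      · exact ⟨-1, by norm_num, fun x hx => (hTx x hx).2.2.resolve_left fun h => hnot x hx x0 hx0 h h0⟩
    have hTD : ∀ x ∈ T, x ∈ {x | x ∈ Dlt (pp u0 κ) ∧ ∀ z, z ≠ 0 → 0 < σ * ∑ j, c j * eval x (pp u0 κ j) * (dotL (b j) z)^2} :=
      fun x hx => ⟨(hTx x hx).1, hdef x hx σ hσ (hall x hx)⟩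
    have hrT : (r:ℝ) = T.card := by rw [hT, hYr]
    rcases det_sign b c u0 hu0 κ β hκ1 hκ2 hβ3 σ _ rfl with h | h
    · have h1 := hv3 T (fun x hx => ⟨(hTx x hx).1, (hTx x hx).2.1⟩)
      rw [Finset.sum_congr rfl (fun x hx => if_pos (h x (hTD x hx)))] at h1
      simp only [Finset.sum_const, nsmul_eq_mul, mul_one] at h1
      rw [hrT]
      refine h1.trans (le_of_eq ?_)
      norm_num
    · have h1 := hv4 T (fun x hx => ⟨(hTx x hx).1, (hTx x hx).2.1⟩)
      rw [Finset.sum_congr rfl (fun x hx => if_neg (h x (hTD x hx)))] at h1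
      simp only [Finset.sum_const, nsmul_eq_mul, mul_one] at h1
      rw [hrT]
      refine h1.trans (le_of_eq ?_)
      norm_num

end PartPF3

section PartPF4
open scoped ContDiff Topology ENNReal
open MeasureTheory MvPolynomial Filter

noncomputable def GG {n M : ℕ} (c0 : ℝ) (b : Fin M → Fin n → ℝ) (c η : Fin M → ℝ) (y : Fin n → ℝ) : ℝ :=
  c0 + ∑ j, c j * Real.exp (η j) * ev b y j

theorem GG_cont {n M : ℕ} (c0 : ℝ) (b : Fin M → Fin n → ℝ) (c : Fin M → ℝ) :
    Continuous (fun q : (Fin M → ℝ) × (Fin n → ℝ) => GG c0 b c q.1 q.2) := by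
  unfold GG
  refine continuous_const.add (continuous_finsetSum _ fun j _ => ?_)
  refine (continuous_const.mul (Real.continuous_exp.comp ((continuous_apply j).comp continuous_fst))).mul ?_
  exact (continuous_ev b j).comp continuous_snd

theorem GG_line {n M : ℕ} (c0 : ℝ) (b : Fin M → Fin n → ℝ) (c η : Fin M → ℝ) (y z : Fin n → ℝ) (t : ℝ) :
    GG c0 b c η (y + t • z) = c0 + ∑ j, c j * Real.exp (η j) * ev b y j * Real.exp (t * dotL (b j) z) := by
  unfold GG
  congr 1
  exact Finset.sum_congr rfl fun j _ => by rw [ev_add]; ring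

theorem sum_exp_deriv {M : ℕ} (c0 : ℝ) (e s : Fin M → ℝ) (t : ℝ) :
    HasDerivAt (fun t : ℝ => c0 + ∑ j, e j * Real.exp (t * s j)) (∑ j, e j * s j * Real.exp (t * s j)) t := by
  apply HasDerivAt.const_add
  apply HasDerivAt.fun_sum
  intro j _
  have := ((((hasDerivAt_id t).mul_const (s j)).exp).const_mul (e j))
  convert! this using 1
  simp; ring

/-- second order condition for one-variable exponential sums -/
theorem second_order {M : ℕ} (c0 : ℝ) (e s : Fin M → ℝ) (h : IsLocalMin (fun t : ℝ => c0 + ∑ j, e j * Real.exp (t * s j)) 0) :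
    ∑ j, e j * s j = 0 ∧ 0 ≤ ∑ j, e j * (s j)^2 := by
  have d1 : deriv (fun t : ℝ => c0 + ∑ j, e j * Real.exp (t * s j)) = fun t => 0 + ∑ j, (e j * s j) * Real.exp (t * s j) := by
    funext t; rw [(sum_exp_deriv c0 e s t).deriv, zero_add]
  have h1 : ∑ j, e j * s j = 0 := by
    have := h.deriv_eq_zero
    rw [d1] at this
    simpa using this
  refine ⟨h1, ?_⟩
  by_contra! hneg
  have d2 : deriv (deriv (fun t : ℝ => c0 + ∑ j, e j * Real.exp (t * s j))) 0 = ∑ j, e j * (s j)^2 := by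
    rw [d1, (sum_exp_deriv 0 (fun j => e j * s j) s 0).deriv]
    exact Finset.sum_congr rfl fun j _ => by simp; ring
  have hmax : IsLocalMax (fun t : ℝ => c0 + ∑ j, e j * Real.exp (t * s j)) 0 := by
    apply isLocalMax_of_deriv_deriv_neg
    · rw [d2]; exact hneg
    · rw [d1]; simpa using h1
    · exact (sum_exp_deriv c0 e s 0).continuousAt
  have hc : (fun t : ℝ => c0 + ∑ j, e j * Real.exp (t * s j)) =ᶠ[𝓝 0] fun _ => (fun t : ℝ => c0 + ∑ j, e j * Real.exp (t * s j)) 0 := by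
    filter_upwards [h, hmax] with t h1 h2 using le_antisymm h2 h1
  have h3 := hc.deriv.deriv_eq
  rw [d2] at h3
  simp at h3
  rw [h3] at hneg
  exact lt_irrefl _ hneg

theorem locmin_crit {n M : ℕ} (c0 : ℝ) (b : Fin M → Fin n → ℝ) (c η : Fin M → ℝ) (y : Fin n → ℝ) (σ : ℝ) (hσ : σ ≠ 0)
    (h : IsLocalMin (fun y => σ * GG c0 b c η y) y) : CritH b c η y ∧ SDH σ b c η y := by
  have key : ∀ z, ∑ j, σ * (c j * Real.exp (η j) * ev b y j) * dotL (b j) z = 0 ∧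
      0 ≤ ∑ j, σ * (c j * Real.exp (η j) * ev b y j) * (dotL (b j) z)^2 := by
    intro z
    apply second_order (σ * c0)
    have hline : Tendsto (fun t : ℝ => y + t • z) (𝓝 0) (𝓝 y) := by
      have : Tendsto (fun t : ℝ => y + t • z) (𝓝 0) (𝓝 (y + (0:ℝ) • z)) := by
        apply Continuous.tendsto; fun_prop
      rwa [zero_smul, add_zero] at this
    have h1 : ∀ᶠ t in 𝓝 (0:ℝ), σ * GG c0 b c η y ≤ σ * GG c0 b c η (y + t • z) := hline.eventually h
    have h2 : ∀ t : ℝ, σ * GG c0 b c η (y + t • z) = σ * c0 + ∑ j, σ * (c j * Real.exp (η j) * ev b y j) * Real.exp (t * dotL (b j) z) := by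
      intro t
      rw [GG_line, mul_add, Finset.mul_sum]
      congr 1
      exact Finset.sum_congr rfl fun j _ => by ring
    filter_upwards [h1] with t ht
    rw [← h2 t, ← h2 0]
    simpa using ht
  constructor
  · intro i
    have h1 := (key (Pi.single i 1)).1
    have h8 : ∀ j, dotL (b j) (Pi.single i 1) = b j i := fun j => by simp [dotL_apply, Pi.single_apply]
    simp only [h8, mul_assoc, ← Finset.mul_sum] at h1
    simpa [mul_assoc] using (mul_eq_zero.1 h1).resolve_left hσ
  · intro z
    have := (key z).2
    rw [Finset.mul_sum]
    convert! this using 2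
    ring

theorem bounded_comp {n M : ℕ} (c0 : ℝ) (b : Fin M → Fin n → ℝ) (c : Fin M → ℝ) (W : Set (Fin n → ℝ)) (hWb : Bornology.IsBounded W)
    (hW0 : W.Nonempty) (σ : ℝ) (hσ : σ ≠ 0) (hneg : ∀ y ∈ W, σ * GG c0 b c 0 y < 0)
    (hnh : ∀ z ∈ closure W, GG c0 b c 0 z ≠ 0 → W ∈ 𝓝 z) :
    ∀ᶠ η in 𝓝 (0 : Fin M → ℝ), ∃ y ∈ W, CritH b c η y ∧ SDH σ b c η y := by
  obtain ⟨y0, hy0⟩ := hW0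
  have hK : IsCompact (closure W) := hWb.isCompact_closure
  set δ := - (σ * GG c0 b c 0 y0) with hδ
  have hδ0 : 0 < δ := by have := hneg y0 hy0; linarith
  have hcont : Continuous (fun q : (Fin M → ℝ) × (Fin n → ℝ) => σ * GG c0 b c q.1 q.2 - σ * GG c0 b c 0 q.2) :=
    (continuous_const.mul (GG_cont c0 b c)).sub (continuous_const.mul ((GG_cont c0 b c).comp (continuous_const.prodMk continuous_snd)))
  have hunif : ∀ᶠ η in 𝓝 (0 : Fin M → ℝ), ∀ y ∈ closure W, |σ * GG c0 b c η y - σ * GG c0 b c 0 y| < δ / 3 := by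
    refine hK.eventually_forall_of_forall_eventually fun y _ => ?_
    have h1 : Tendsto (fun q : (Fin M → ℝ) × (Fin n → ℝ) => |σ * GG c0 b c q.1 q.2 - σ * GG c0 b c 0 q.2|) (𝓝 (0, y)) (𝓝 0) := by
      have := (hcont.abs).tendsto (0, y)
      simpa using this
    exact h1.eventually (eventually_lt_nhds (by positivity))
  filter_upwards [hunif] with η hη
  have hcη : ContinuousOn (fun y => σ * GG c0 b c η y) (closure W) :=
    (continuous_const.mul ((GG_cont c0 b c).comp (continuous_const.prodMk continuous_id))).continuousOn
  obtain ⟨y, hy, hmin⟩ := hK.exists_isMinOn ⟨y0, subset_closure hy0⟩ hcη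
  have h1 := abs_lt.1 (hη y hy)
  have h2 := abs_lt.1 (hη y0 (subset_closure hy0))
  have h3 : σ * GG c0 b c η y ≤ σ * GG c0 b c η y0 := hmin (subset_closure hy0)
  have hne : GG c0 b c 0 y ≠ 0 := by
    intro h
    rw [h, mul_zero] at h1
    linarith [h1.1, h2.2]
  have hWn := hnh y hy hne
  have hloc : IsLocalMin (fun y => σ * GG c0 b c η y) y :=
    hmin.isLocalMin (mem_of_superset hWn subset_closure)
  exact ⟨y, mem_of_mem_nhds hWn, locmin_crit c0 b c η y σ hσ hloc⟩

/-- choice of a removable point -/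
theorem exists_removable {n M : ℕ} (a : Fin (M+1) → Fin n → ℝ) (ha : NotAllInAffineHyperplane a) (hM : n + 1 ≤ M) :
    ∃ i0 : Fin (M+1), NotAllInAffineHyperplane (fun j : Fin M => a (i0.succAbove j) - a i0) := by
  have h1 : LinearMap.ker (TL a) ≠ ⊥ := LinearMap.ker_ne_bot_of_finrank_lt (by simp; omega)
  obtain ⟨d, hd, hd0⟩ := (Submodule.ne_bot_iff _).1 h1
  obtain ⟨i0, hi0⟩ := Function.ne_iff.1 hd0
  refine ⟨i0, ?_⟩
  rintro ⟨w, t, hw, h⟩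
  have h2 : ∑ j, d j = 0 := congrArg Prod.fst hd
  have h3 : ∀ i, ∑ j, d j * a j i = 0 := fun i => congrFun (congrArg Prod.snd hd) i
  have h4 : ∀ j, ∑ i, w i * a (i0.succAbove j) i = t + ∑ i, w i * a i0 i := by
    intro j
    have := h j
    simp only [Pi.sub_apply, mul_sub, Finset.sum_sub_distrib] at this
    linarith
  have h5 : ∑ j, d j * ∑ i, w i * a j i = 0 := by
    simp only [Finset.mul_sum]
    rw [Finset.sum_comm]
    refine Finset.sum_eq_zero fun i _ => ?_
    rw [← mul_zero (w i), ← h3 i, Finset.mul_sum]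
    exact Finset.sum_congr rfl fun j _ => by ring
  rw [Fin.sum_univ_succAbove _ i0] at h5 h2
  simp only [h4, ← Finset.sum_mul] at h5
  have h6 : ∑ i, d (i0.succAbove i) = - d i0 := by linarith
  rw [h6] at h5
  have h7 : d i0 * t = 0 := by linarith
  have ht : t = 0 := (mul_eq_zero.1 h7).resolve_left hi0
  refine ha ⟨w, ∑ i, w i * a i0 i, hw, fun j => ?_⟩
  rcases Fin.eq_self_or_eq_succAbove i0 j with rfl | ⟨k, rfl⟩
  · rfl
  · rw [h4, ht, zero_add]

theorem GG_expSum {n M : ℕ} (a : Fin (M+1) → Fin n → ℝ) (c : Fin (M+1) → ℝ) (i0 : Fin (M+1)) (y : Fin n → ℝ) :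
    expSum a c y = ev a y i0 * GG (c i0) (fun j : Fin M => a (i0.succAbove j) - a i0) (fun j => c (i0.succAbove j)) 0 y := by
  rw [expSum_eq, Fin.sum_univ_succAbove _ i0, GG, mul_add, Finset.mul_sum]
  congr 1
  · ring
  · refine Finset.sum_congr rfl fun j _ => ?_
    have : ev a y (i0.succAbove j) = ev a y i0 * ev (fun j : Fin M => a (i0.succAbove j) - a i0) y j := by
      simp only [ev, ← Real.exp_add]
      congr 1
      simp only [dotL_apply, Pi.sub_apply, sub_mul, Finset.sum_sub_distrib]
      ring
    rw [this]; simp; ring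

theorem bounded_bound {n M l : ℕ} (a : Fin (M+1) → Fin n → ℝ) (ha : NotAllInAffineHyperplane a) (c : Fin (M+1) → ℝ) (hc : ∀ j, c j ≠ 0)
    (hM : M = n + 1 + l) (Q : Finset (ConnectedComponents {y : Fin n → ℝ // expSum a c y ≠ 0}))
    (hQ : ∀ q ∈ Q, Bornology.IsBounded (Wc (expSum a c) q)) :
    (Q.card : ℝ) ≤ FF ((n+1 : ℕ):ℝ) l + (l:ℝ)/2 * (((n+1+l:ℕ):ℝ) * FF ((n+1:ℕ):ℝ) (l-1)) ∧
    (1 ≤ l → M < 2 * n → (Q.card : ℝ) ≤ 1/2 * (FF ((n+1:ℕ):ℝ) l + ((l:ℝ)-1)/2*(((n+1+l:ℕ):ℝ)*FF ((n+1:ℕ):ℝ) (l-1))) +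
      (((n+1+l:ℕ):ℝ)*FF ((n+1:ℕ):ℝ) (l-1))/2) := by
  classical
  obtain ⟨i0, hb⟩ := exists_removable a ha (by omega)
  have : Nonempty (Fin M) := ⟨⟨0, by omega⟩⟩
  set b := (fun j : Fin M => a (i0.succAbove j) - a i0) with hbd
  set c' := (fun j : Fin M => c (i0.succAbove j)) with hcd
  refine gale_bound b hb c' (fun j => hc _) hM Q.card ?_
  have hGe : ∀ y, expSum a c y = ev a y i0 * GG (c i0) b c' 0 y := GG_expSum a c i0
  have hG0 : ∀ y, GG (c i0) b c' 0 y ≠ 0 → expSum a c y ≠ 0 := fun y h => by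
    rw [hGe]; exact mul_ne_zero (ev_pos a y i0).ne' h
  have h1 : ∀ q ∈ Q, ∀ᶠ η in 𝓝 (0 : Fin M → ℝ), ∃ y ∈ Wc (expSum a c) q, CritH b c' η y ∧ (SDH 1 b c' η y ∨ SDH (-1) b c' η y) := by
    intro q hq
    have hnh : ∀ z ∈ closure (Wc (expSum a c) q), GG (c i0) b c' 0 z ≠ 0 → Wc (expSum a c) q ∈ 𝓝 z :=
      fun z hz h => Wc_nhds _ (continuous_expSum a c) q z hz (hG0 z h)
    rcases Wc_sign _ (continuous_expSum a c) q with h | h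
    · have := bounded_comp (c i0) b c' _ (hQ q hq) (Wc_nonempty _ q) (-1) (by norm_num) (fun y hy => by
        have h2 := h y hy
        rw [hGe] at h2
        have := (mul_pos_iff_of_pos_left (ev_pos a y i0)).1 h2
        linarith) hnh
      filter_upwards [this] with η ⟨y, hy, h1, h2⟩ using ⟨y, hy, h1, Or.inr h2⟩
    · have := bounded_comp (c i0) b c' _ (hQ q hq) (Wc_nonempty _ q) 1 (by norm_num) (fun y hy => by
        have h2 := h y hy
        rw [hGe] at h2
        have := (pos_iff_neg_of_mul_neg h2).1 (ev_pos a y i0)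
        linarith) hnh
      filter_upwards [this] with η ⟨y, hy, h1, h2⟩ using ⟨y, hy, h1, Or.inl h2⟩
  have h2 := (eventually_all_finset Q).2 h1
  filter_upwards [h2] with η hη
  choose! f hfW hf using hη
  refine ⟨Q.image f, Finset.card_image_of_injOn ?_, ?_⟩
  · intro q hq q' hq' he
    have e1 := hfW q hq
    have e2 := hfW q' hq'
    have he' : f q = f q' := he
    rw [he'] at e1
    exact Wc_unique _ _ _ _ e1 e2
  · intro y hy
    obtain ⟨q, hq, rfl⟩ := Finset.mem_image.1 hy
    exact hf q hq

end PartPF4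

section PartPG
open scoped ContDiff Topology ENNReal
open MeasureTheory MvPolynomial Filter

theorem FF_closed (σ : ℝ) (l : ℕ) : FF σ l = 2 ^ (l * (l - 1) / 2) * σ ^ l := by
  unfold FF
  rw [Finset.prod_mul_distrib, Finset.prod_pow_eq_pow_sum, Finset.sum_range_id, Finset.prod_const, Finset.card_range]

theorem FF_last (σ : ℝ) (l : ℕ) : FF σ (l+1) = FF σ l * (2^l * σ) := by
  unfold FF; rw [Finset.prod_range_succ]

theorem S_lower (n l : ℕ) (hl : 2 ≤ l) :
    1.298 * (FF ((n+1:ℕ):ℝ) l * (((n+1:ℕ):ℝ) + l) / ((n+1:ℕ):ℝ)) ≤ S (n+2) l / 2 := by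
  have hm : (0:ℝ) < ((n+1:ℕ):ℝ) := by positivity
  have e1 : S (n+2) l = ((Real.exp 1) ^ 2 + 3) / 4 * (2 : ℝ) ^ (l * (l - 1) / 2) * (((n+2:ℕ):ℝ)) ^ l := by
    rw [S, if_neg (by omega), if_neg (by omega)]
  have e2 : ((n+2:ℕ):ℝ) = ((n+1:ℕ):ℝ) * (1 + 1/((n+1:ℕ):ℝ)) := by
    field_simp; push_cast; ring
  have e3 : 1 + (l:ℝ) * (1/((n+1:ℕ):ℝ)) ≤ (1 + 1/((n+1:ℕ):ℝ))^l := by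
    apply one_add_mul_le_pow
    have : 0 ≤ 1/((n+1:ℕ):ℝ) := by positivity
    linarith
  have e4 : 1.298 ≤ ((Real.exp 1) ^ 2 + 3) / 8 := by
    have := Real.exp_one_gt_d9
    nlinarith
  have e5 : FF ((n+1:ℕ):ℝ) l * (((n+1:ℕ):ℝ) + l) / ((n+1:ℕ):ℝ) = FF ((n+1:ℕ):ℝ) l * (1 + (l:ℝ) * (1/((n+1:ℕ):ℝ))) := by
    field_simp
  have hF := FF_nonneg (n+1) l
  rw [e1, e2, e5, mul_pow]
  calc 1.298 * (FF ((n+1:ℕ):ℝ) l * (1 + (l:ℝ) * (1/((n+1:ℕ):ℝ))))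
      ≤ ((Real.exp 1) ^ 2 + 3) / 8 * (FF ((n+1:ℕ):ℝ) l * (1 + 1/((n+1:ℕ):ℝ))^l) := by
        apply mul_le_mul e4 (mul_le_mul_of_nonneg_left e3 hF) (by positivity) (by positivity)
    _ = _ := by rw [FF_closed]; ring

theorem numerics (n l : ℕ) (hn : 2 ≤ n) (r : ℝ)
    (h1 : r ≤ FF ((n+1 : ℕ):ℝ) l + (l:ℝ)/2 * (((n+1+l:ℕ):ℝ) * FF ((n+1:ℕ):ℝ) (l-1)))
    (h2 : 1 ≤ l → n + 1 + l < 2 * n → r ≤ 1/2 * (FF ((n+1:ℕ):ℝ) l + ((l:ℝ)-1)/2*(((n+1+l:ℕ):ℝ)*FF ((n+1:ℕ):ℝ) (l-1))) +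
      (((n+1+l:ℕ):ℝ)*FF ((n+1:ℕ):ℝ) (l-1))/2) :
    r ≤ ((n:ℝ)+1+l)*((n:ℝ)+l)/2 + S (n+2) l / 2 := by
  have hn' : (2:ℝ) ≤ n := by exact_mod_cast hn
  rcases Nat.lt_or_ge l 2 with hl | hl
  · interval_cases l
    · simp [FF, S] at h1 ⊢
      nlinarith
    · simp [FF, S] at h1 ⊢
      nlinarith
  · have hS := S_lower n l hl
    obtain ⟨k, rfl⟩ : ∃ k, l = k + 1 := ⟨l - 1, by omega⟩
    simp only [Nat.add_sub_cancel] at h1 h2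
    have hm : (0:ℝ) < ((n+1:ℕ):ℝ) := by positivity
    have hF := FF_nonneg (n+1) k
    rw [FF_last] at h1 h2 hS
    have hq : 0 ≤ ((n:ℝ)+1+(k+1:ℕ))*((n:ℝ)+(k+1:ℕ))/2 := by positivity
    have hS' : 1.298 * (FF ((n+1:ℕ):ℝ) k * 2^k * (((n+1:ℕ):ℝ) + (k+1:ℕ))) ≤ S (n+2) (k+1) / 2 := by
      refine le_trans (le_of_eq ?_) hS
      field_simp
    have hk1 : (k:ℝ) + 1 ≤ 2^k := by
      have : k + 1 ≤ 2^k := Nat.lt_two_pow_self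
      exact_mod_cast this
    have hcast : (((n+1+(k+1):ℕ)):ℝ) = ((n+1:ℕ):ℝ) + (k+1:ℕ) := by push_cast; ring
    rw [hcast] at h1 h2
    set F := FF ((n+1:ℕ):ℝ) k
    set m := ((n+1:ℕ):ℝ) with hmd
    have hkr : ((k+1:ℕ):ℝ) = (k:ℝ) + 1 := by push_cast; ring
    rw [hkr] at h1 h2 hS' hq ⊢
    have hk0 : (0:ℝ) ≤ k := by positivity
    set t := (2:ℝ)^k
    by_cases hc : n + 1 + (k+1) < 2 * n
    · have h3 := h2 (by omega) hc
      have h4 : 1/2 * (F * (t * m) + ((k:ℝ) + 1 - 1)/2*((m + (k+1)) * F)) + ((m+(k+1))*F)/2 ≤ 1.298 * (F * t * (m + (k+1))) := by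
        have h5 : 1/2 * (t * m + (k:ℝ)/2*(m + (k+1))) + (m+(k+1))/2 ≤ 1.298 * (t * (m + (k+1))) := by
          have : (k+1) * (m + (k+1)) ≤ t * (m + (k+1)) := mul_le_mul_of_nonneg_right hk1 (by positivity)
          nlinarith [mul_nonneg hk0 hm.le, mul_nonneg (by positivity : 0 ≤ t) hk0]
        nlinarith [mul_le_mul_of_nonneg_left h5 hF]
      linarith
    · have hml : m ≤ (k:ℝ) + 3 := by
        have : n + 1 ≤ k + 3 := by omega
        rw [hmd]; exact_mod_cast this
      have hk1' : (1:ℝ) ≤ k := by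
        have : 1 ≤ k := by omega
        exact_mod_cast this
      have h4 : F * (t * m) + ((k:ℝ)+1)/2 * ((m + (k+1)) * F) ≤ 1.298 * (F * t * (m + (k+1))) := by
        have h5 : t * m + ((k:ℝ)+1)/2 * (m + (k+1)) ≤ 1.298 * (t * (m + (k+1))) := by
          have h6 : (k+1) * (m + (k+1)) ≤ t * (m + (k+1)) := mul_le_mul_of_nonneg_right hk1 (by positivity)
          have h7 : 0 ≤ t * (0.798 * (k+1) - 0.202 * m) := mul_nonneg (by positivity) (by linarith)
          nlinarith
        nlinarith [mul_le_mul_of_nonneg_left h5 hF]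
      linarith

theorem S_nonneg (m l : ℕ) : 0 ≤ S m l := by
  unfold S; split_ifs <;> positivity

end PartPG

theorem stmt2 (n k : ℕ) (hn : 2 ≤ n) (hk : 2 ≤ k)
    (a : Fin (n + k) → Fin n → ℝ)
    (ha : NotAllInAffineHyperplane a)
    (hcs : CombSimplicial a) :
    ∃ U : Set (Fin (n + k) → ℝ), IsOpen U ∧ Dense U ∧
      ∀ c ∈ U,
        Finite (ConnectedComponents {y : Fin n → ℝ // expSum a c y = 0}) ∧
        (Nat.card (ConnectedComponents {y : Fin n → ℝ // expSum a c y = 0}) : ℤ)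
          ≤ ((n + k) * (n + k - 1) / 2 : ℕ) + ⌊S (n + 2) (k - 2) / 2⌋ := by
  obtain ⟨l, rfl⟩ : ∃ l, k = l + 2 := ⟨k - 2, by omega⟩
  have : Nonempty (Fin (n + (l + 2))) := ⟨⟨0, by omega⟩⟩
  refine ⟨UU a, isOpen_UU a, dense_UU a ha hcs, fun c hc => ?_⟩
  simp only [Nat.add_sub_cancel]
  have hN : n + (l + 2) = (n + 1 + l) + 1 := by omega
  clear this
  generalize hNd : n + (l + 2) = N at a ha hcs c hc hN ⊢
  subst hN
  have hq : (n + 1 + l + 1) * (n + 1 + l + 1 - 1) / 2 = (n + 1 + l) + (n + 1 + l) * (n + l) / 2 := by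
    have : (n + 1 + l + 1) * (n + 1 + l + 1 - 1) = (n + 1 + l) * (n + l) + (n + 1 + l) * 2 := by
      rw [Nat.add_sub_cancel]; ring
    rw [this, Nat.add_mul_div_right _ _ (by norm_num)]; ring
  have heven : 2 ∣ (n + 1 + l) * (n + l) := by
    have := Nat.even_mul_succ_self (n + l)
    have h2 : (n + 1 + l) * (n + l) = (n + l) * (n + l + 1) := by ring
    rw [h2]; exact this.two_dvd
  have hSn := S_nonneg (n+2) l
  obtain ⟨hf, hcard⟩ := zero_comps a ha hcs c hc ((n + 1 + l) * (n + l) / 2 + ⌊S (n + 2) l / 2⌋₊) (by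
    intro Q hQ
    have hb := bounded_bound (l := l) a ha c hc.1 rfl Q hQ
    have hnum := numerics n l hn Q.card hb.1 hb.2
    have : Q.card - (n + 1 + l) * (n + l) / 2 ≤ ⌊S (n + 2) l / 2⌋₊ := by
      apply Nat.le_floor
      rcases le_total Q.card ((n + 1 + l) * (n + l) / 2) with h | h
      · rw [Nat.sub_eq_zero_of_le h]; simp; positivity
      · rw [Nat.cast_sub h, Nat.cast_div heven (by norm_num)]
        push_cast
        linarith
    omega)
  refine ⟨hf, ?_⟩
  have hfl : ⌊S (n + 2) l / 2⌋ = ((⌊S (n + 2) l / 2⌋₊ : ℕ) : ℤ) := (Int.natCast_floor_eq_floor (by positivity)).symm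
  rw [hfl, hq]
  exact_mod_cast (by omega)
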